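/- arXiv:1112.5737 — 4 statements merged into one kernel-verified Lean document; each statement's English description precedes it below -/
import Mathlib

section
/- Let d ≥ 1 and let μ be a nice measure on ℝ^d. Then there exists a convex partition of ℝ^d into 3·2^(d−1) parts, each of μ-measure 1/(3·2^(d−1)), such that every hyperplane in ℝ^d avoids at least two of the parts. -/
open MeasureTheory Set Metric
open scoped ENNReal
noncomputable section

abbrev Euc (d : ℕ) := EuclideanSpace ℝ (Fin d)

/-- A nice measure on ℝ^d: a probability measure with a continuous,
strictly positive density with respect to Lebesgue measure. -/
def NiceMeasure (d : ℕ) (μ : Measure (Euc d)) : Prop :=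
  IsProbabilityMeasure μ ∧ ∃ f : Euc d → ℝ, Continuous f ∧ (∀ x, 0 < f x) ∧
    μ = volume.withDensity (fun x => ENNReal.ofReal (f x))

/-- The affine hyperplane with normal vector `v` and offset `c`. -/
def Hyperplane {d : ℕ} (v : Euc d) (c : ℝ) : Set (Euc d) := {x | inner (𝕜 := ℝ) v x = c}

/-- A set `H` avoids a set `C` if `H` is disjoint from the interior of `C`. -/
def Avoids {d : ℕ} (H C : Set (Euc d)) : Prop := H ∩ interior C = ∅

/-- A convex partition of ℝ^d into `n` parts: `n` closed convex sets with pairwise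
disjoint interiors whose union is all of ℝ^d. -/
def IsConvexPartition {d n : ℕ} (C : Fin n → Set (Euc d)) : Prop :=
  (∀ i, IsClosed (C i)) ∧ (∀ i, Convex ℝ (C i)) ∧
  (∀ i j, i ≠ j → interior (C i) ∩ interior (C j) = ∅) ∧ (⋃ i, C i) = univ

/-- A `k`-equipartition of `μ` into `n` parts: a convex partition into `n` parts,
each of measure `1/n`, such that every hyperplane avoids at least `k` parts. -/
def IsEquipartition {d n : ℕ} (μ : Measure (Euc d)) (k : ℕ) (C : Fin n → Set (Euc d)) : Prop :=
  IsConvexPartition C ∧ (∀ i, μ (C i) = (n : ℝ≥0∞)⁻¹) ∧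
  ∀ v : Euc d, ∀ c : ℝ, v ≠ 0 → k ≤ {i | Avoids (Hyperplane v c) (C i)}.ncard

/-- Every nice measure on ℝ^d admits a `k`-equipartition into `n` parts. -/
def HasEquipartition (d k n : ℕ) : Prop :=
  ∀ μ : Measure (Euc d), NiceMeasure d μ → ∃ C : Fin n → Set (Euc d), IsEquipartition μ k C

/-- `N_d(k)`: the smallest positive `n` such that every nice measure on ℝ^d admits a
`k`-equipartition into `n` parts. -/
def Nd (d k : ℕ) : ℕ := sInf {n | 0 < n ∧ HasEquipartition d k n}

/-! ## Abstract decision trees -/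

inductive YTree (Ω : Type) : Type where
  | leaf : YTree Ω
  | node (s : Ω → ℝ) (p n : YTree Ω) : YTree Ω

namespace YTree

variable {Ω : Type}

def Idx : YTree Ω → Type
  | leaf => Unit
  | node _ p n => Idx p ⊕ Idx n

theorem finite_idx : ∀ t : YTree Ω, Finite (Idx t)
  | leaf => inferInstanceAs (Finite Unit)
  | node _ p n =>
    have := finite_idx p
    have := finite_idx n
    inferInstanceAs (Finite (Idx p ⊕ Idx n))

/-- all functions at the nodes satisfy `P` -/
def All (P : (Ω → ℝ) → Prop) : YTree Ω → Prop
  | leaf => True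
  | node s p n => P s ∧ All P p ∧ All P n

theorem All.mono {P Q : (Ω → ℝ) → Prop} (h : ∀ s, P s → Q s) :
    ∀ t : YTree Ω, All P t → All Q t
  | leaf, _ => trivial
  | node s p n, ⟨h1, h2, h3⟩ => ⟨h s h1, All.mono h p h2, All.mono h n h3⟩

def cell : (t : YTree Ω) → Set Ω → Idx t → Set Ω
  | leaf, R, _ => R
  | node s p _, R, Sum.inl i => cell p (R ∩ {x | 0 ≤ s x}) i
  | node s _ n, R, Sum.inr i => cell n (R ∩ {x | s x ≤ 0}) i

/-- admissible families of cutting functions at the leaves -/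
def Adm : (t : YTree Ω) → (Ω → ℝ) → (Idx t → Ω → ℝ) → Prop
  | leaf, f, g => g () = f
  | node s p n, f, g => ∃ v : ℝ, Adm p (fun x => f x - v * s x) (fun i => g (Sum.inl i)) ∧
      Adm n (fun x => f x - v * s x) (fun i => g (Sum.inr i))

def grow : (t : YTree Ω) → (Idx t → Ω → ℝ) → YTree Ω
  | leaf, g => node (g ()) leaf leaf
  | node s p n, g => node s (grow p fun i => g (Sum.inl i)) (grow n fun i => g (Sum.inr i))

def AV : YTree Ω → Set (Ω → ℝ) → Prop
  | leaf, W => ∀ l ∈ W, ∀ x, l x = 0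
  | node s p n, W => ∃ W' : Set (Ω → ℝ), AV p W' ∧ AV n W' ∧
      ∀ l ∈ W, ∃ b : ℝ, (fun x => l x - b * s x) ∈ W'

theorem cell_subset : ∀ (t : YTree Ω) (R : Set Ω) (i : Idx t), cell t R i ⊆ R
  | leaf, _, _ => subset_rfl
  | node _ p _, _, Sum.inl i => (cell_subset p _ i).trans inter_subset_left
  | node _ _ n, _, Sum.inr i => (cell_subset n _ i).trans inter_subset_left

theorem cell_induct {P : Set Ω → Prop} : ∀ (t : YTree Ω) (R : Set Ω) (_ : P R)
    (_ : All (fun s => ∀ S, P S → P (S ∩ {x | 0 ≤ s x}) ∧ P (S ∩ {x | s x ≤ 0})) t)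
    (i : Idx t), P (cell t R i)
  | leaf, _, h, _, _ => h
  | node _ p _, _, h, H, Sum.inl i => cell_induct p _ (H.1 _ h).1 H.2.1 i
  | node _ _ n, _, h, H, Sum.inr i => cell_induct n _ (H.1 _ h).2 H.2.2 i

theorem cell_cover : ∀ (t : YTree Ω) (R : Set Ω) (x : Ω), x ∈ R → ∃ i, x ∈ cell t R i
  | leaf, _, _, h => ⟨(), h⟩
  | node s p n, R, x, h => by
    rcases le_total 0 (s x) with hs | hs
    · obtain ⟨i, hi⟩ := cell_cover p (R ∩ {x | 0 ≤ s x}) x ⟨h, hs⟩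
      exact ⟨Sum.inl i, hi⟩
    · obtain ⟨i, hi⟩ := cell_cover n (R ∩ {x | s x ≤ 0}) x ⟨h, hs⟩
      exact ⟨Sum.inr i, hi⟩

theorem cell_grow : ∀ (t : YTree Ω) (g : Idx t → Ω → ℝ) (R : Set Ω) (i : Idx (grow t g)),
    ∃ j, cell (grow t g) R i = cell t R j ∩ {x | 0 ≤ g j x} ∨
      cell (grow t g) R i = cell t R j ∩ {x | g j x ≤ 0}
  | leaf, _, _, Sum.inl _ => ⟨(), Or.inl rfl⟩
  | leaf, _, _, Sum.inr _ => ⟨(), Or.inr rfl⟩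
  | node _ p _, g, _, Sum.inl i => by
    obtain ⟨j, hj⟩ := cell_grow p (fun i => g (Sum.inl i)) _ i
    exact ⟨Sum.inl j, hj⟩
  | node _ _ n, g, _, Sum.inr i => by
    obtain ⟨j, hj⟩ := cell_grow n (fun i => g (Sum.inr i)) _ i
    exact ⟨Sum.inr j, hj⟩

theorem card_grow : ∀ (t : YTree Ω) (g : Idx t → Ω → ℝ),
    Nat.card (Idx (grow t g)) = 2 * Nat.card (Idx t)
  | leaf, g => by
    change Nat.card (Unit ⊕ Unit) = 2 * Nat.card Unit
    simp
  | node s p n, g => by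
    have := finite_idx p
    have := finite_idx n
    have := finite_idx (grow p fun i => g (Sum.inl i))
    have := finite_idx (grow n fun i => g (Sum.inr i))
    change Nat.card (Idx (grow p fun i => g (Sum.inl i)) ⊕ Idx (grow n fun i => g (Sum.inr i)))
      = 2 * Nat.card (Idx p ⊕ Idx n)
    rw [Nat.card_sum, Nat.card_sum, card_grow, card_grow]
    ring

theorem all_grow {P : (Ω → ℝ) → Prop} : ∀ (t : YTree Ω) (g : Idx t → Ω → ℝ),
    All P t → (∀ i, P (g i)) → All P (grow t g)
  | leaf, _, _, h => ⟨h (), trivial, trivial⟩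
  | node _ p n, _, H, h => ⟨H.1, all_grow p _ H.2.1 fun i => h (Sum.inl i),
      all_grow n _ H.2.2 fun i => h (Sum.inr i)⟩

theorem adm_all {P Q : (Ω → ℝ) → Prop}
    (hPQ : ∀ f s v, Q f → P s → Q (fun x => f x - v * s x)) :
    ∀ (t : YTree Ω) (f : Ω → ℝ) (g : Idx t → Ω → ℝ), All P t → Q f → Adm t f g → ∀ i, Q (g i)
  | leaf, f, g, _, hf, h, () => by
    have h : g () = f := h
    rw [h]; exact hf
  | node s p n, f, g, H, hf, ⟨v, h1, h2⟩, Sum.inl i =>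
    adm_all hPQ p _ _ H.2.1 (hPQ f s v hf H.1) h1 i
  | node s p n, f, g, H, hf, ⟨v, h1, h2⟩, Sum.inr i =>
    adm_all hPQ n _ _ H.2.2 (hPQ f s v hf H.1) h2 i

theorem AV.anti : ∀ (t : YTree Ω) (W W' : Set (Ω → ℝ)), W' ⊆ W → AV t W → AV t W'
  | leaf, _, _, h, H => fun l hl => H l (h hl)
  | node _ _ _, _, _, h, ⟨V, h1, h2, h3⟩ => ⟨V, h1, h2, fun l hl => h3 l (h hl)⟩

theorem AV_grow : ∀ (t : YTree Ω) (W : Set (Ω → ℝ)) (f : Ω → ℝ) (g : Idx t → Ω → ℝ),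
    AV t W → Adm t f g → AV (grow t g) {l | ∃ w ∈ W, ∃ b : ℝ, l = fun x => w x + b * f x}
  | leaf, W, f, g, h, hg => by
    refine ⟨{fun _ => 0}, ?_, ?_, ?_⟩
    · rintro l rfl x; rfl
    · rintro l rfl x; rfl
    · rintro l ⟨w, hw, b, rfl⟩
      refine ⟨b, ?_⟩
      have hg : g () = f := hg
      have := h w hw
      simp only [mem_singleton_iff, hg]
      funext x
      rw [this x]; ring
  | node s p n, W, f, g, ⟨W', h1, h2, h3⟩, ⟨v, k1, k2⟩ => by
    refine ⟨{l | ∃ w ∈ W', ∃ b : ℝ, l = fun x => w x + b * (f x - v * s x)},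
      AV_grow p W' _ _ h1 k1, AV_grow n W' _ _ h2 k2, ?_⟩
    rintro l ⟨w, hw, b, rfl⟩
    obtain ⟨b0, hb0⟩ := h3 w hw
    refine ⟨b0 + b * v, _, hb0, b, ?_⟩
    funext x
    ring

theorem AV_avoid : ∀ (t : YTree Ω) (W : Set (Ω → ℝ)) (f : Ω → ℝ) (g : Idx t → Ω → ℝ) (R : Set Ω),
    AV t W → Adm t f g → ∀ l ∈ W, ∀ b : ℝ, ∃ i, ∃ β : ℝ, ∀ x ∈ cell t R i,
      β * g i x ≤ l x + b * f x
  | leaf, W, f, g, R, h, hg, l, hl, b => by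
    refine ⟨(), b, fun x _ => ?_⟩
    have hg : g () = f := hg
    rw [hg, h l hl x]; simp
  | node s p n, W, f, g, R, ⟨W', h1, h2, h3⟩, ⟨v, k1, k2⟩, l, hl, b => by
    obtain ⟨b0, hb0⟩ := h3 l hl
    rcases le_total 0 (b0 + b * v) with h | h
    · obtain ⟨i, β, hi⟩ := AV_avoid p W' _ _ (R ∩ {x | 0 ≤ s x}) h1 k1 _ hb0 b
      refine ⟨Sum.inl i, β, fun x hx => ?_⟩
      have hx' : 0 ≤ s x := (cell_subset p _ i hx).2
      have := hi x hx
      nlinarith [mul_nonneg h hx']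
    · obtain ⟨i, β, hi⟩ := AV_avoid n W' _ _ (R ∩ {x | s x ≤ 0}) h2 k2 _ hb0 b
      refine ⟨Sum.inr i, β, fun x hx => ?_⟩
      have hx' : s x ≤ 0 := (cell_subset n _ i hx).2
      have := hi x hx
      nlinarith [mul_nonneg_of_nonpos_of_nonpos h hx']

/-! ### Balancing -/

variable [MeasurableSpace Ω]

def Low (μ : Measure Ω) (q : ℝ) : (t : YTree Ω) → (Idx t → Set Ω) → (Ω → ℝ) → Prop
  | leaf, A, f => μ.real (A () ∩ {x | f x ≤ 0}) < q * μ.real (A ())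
  | node s p n, A, f => ∃ v : ℝ, Low μ q p (fun i => A (Sum.inl i)) (fun x => f x - v * s x) ∧
      Low μ q n (fun i => A (Sum.inr i)) (fun x => f x - v * s x)

def Valid (μ : Measure Ω) : (t : YTree Ω) → (Idx t → Set Ω) → Prop
  | leaf, A => MeasurableSet (A ()) ∧ 0 < μ.real (A ())
  | node s p n, A => Measurable s ∧ μ {x | s x = 0} = 0 ∧
      (∀ i, ∀ x ∈ A (Sum.inl i), 0 ≤ s x) ∧ (∀ i, ∀ x ∈ A (Sum.inr i), s x ≤ 0) ∧
      Valid μ p (fun i => A (Sum.inl i)) ∧ Valid μ n (fun i => A (Sum.inr i))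

theorem valid_of_cell {μ : Measure Ω} : ∀ (t : YTree Ω) (R : Set Ω) (A : Idx t → Set Ω),
    All (fun s => Measurable s ∧ μ {x | s x = 0} = 0) t → (∀ i, A i ⊆ cell t R i) →
    (∀ i, MeasurableSet (A i)) → (∀ i, 0 < μ.real (A i)) → Valid μ t A
  | leaf, R, A, _, _, h2, h3 => ⟨h2 (), h3 ()⟩
  | node s p n, R, A, H, h1, h2, h3 => by
    refine ⟨H.1.1, H.1.2, ?_, ?_, ?_, ?_⟩
    · intro i x hx
      exact (cell_subset p _ i (h1 (Sum.inl i) hx)).2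
    · intro i x hx
      exact (cell_subset n _ i (h1 (Sum.inr i) hx)).2
    · exact valid_of_cell p _ _ H.2.1 (fun i => h1 (Sum.inl i)) (fun i => h2 (Sum.inl i))
        (fun i => h3 (Sum.inl i))
    · exact valid_of_cell n _ _ H.2.2 (fun i => h1 (Sum.inr i)) (fun i => h2 (Sum.inr i))
        (fun i => h3 (Sum.inr i))

theorem cell_null {μ : Measure Ω} : ∀ (t : YTree Ω) (R : Set Ω),
    All (fun s => Measurable s ∧ μ {x | s x = 0} = 0) t → ∀ i j, i ≠ j →
    μ (cell t R i ∩ cell t R j) = 0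
  | leaf, _, _, (), (), h => absurd rfl h
  | node s p n, R, H, Sum.inl i, Sum.inl j, h =>
    cell_null p _ H.2.1 i j fun e => h (by rw [e])
  | node s p n, R, H, Sum.inr i, Sum.inr j, h =>
    cell_null n _ H.2.2 i j fun e => h (by rw [e])
  | node s p n, R, H, Sum.inl i, Sum.inr j, h =>
    measure_mono_null (fun _ hx => le_antisymm (cell_subset n _ j hx.2).2
      (cell_subset p _ i hx.1).2) H.1.2
  | node s p n, R, H, Sum.inr i, Sum.inl j, h =>
    measure_mono_null (fun _ hx => le_antisymm (cell_subset n _ i hx.1).2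
      (cell_subset p _ j hx.2).2) H.1.2

variable {μ : Measure Ω} [IsFiniteMeasure μ]

theorem Low.mono {q : ℝ} : ∀ (t : YTree Ω) (A : Idx t → Set Ω) (f g : Ω → ℝ),
    (∀ i, ∀ x ∈ A i, f x ≤ g x) → Low μ q t A f → Low μ q t A g
  | leaf, A, f, g, h, H => by
    refine lt_of_le_of_lt (measureReal_mono ?_) H
    rintro x ⟨hx, hx'⟩
    exact ⟨hx, (h () x hx).trans hx'⟩
  | node s p n, A, f, g, h, ⟨v, h1, h2⟩ =>
    ⟨v, Low.mono p _ _ _ (fun i x hx => sub_le_sub_right (h (Sum.inl i) x hx) _) h1,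
      Low.mono n _ _ _ (fun i x hx => sub_le_sub_right (h (Sum.inr i) x hx) _) h2⟩

theorem leaf_aux {B : ℕ → Set Ω} (hB : Antitone B) (hm : ∀ n, MeasurableSet (B n)) {c : ℝ}
    (h : μ.real (⋂ n, B n) < c) : ∃ n, μ.real (B n) < c := by
  have h1 := tendsto_measure_iInter_atTop (μ := μ) (fun n => (hm n).nullMeasurableSet) hB
    ⟨0, measure_ne_top _ _⟩
  have h2 := (ENNReal.tendsto_toReal (measure_ne_top μ (⋂ n, B n))).comp h1
  exact (h2.eventually (gt_mem_nhds h)).exists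

theorem low_open {q : ℝ} : ∀ (t : YTree Ω) (A : Idx t → Set Ω) (f s : Ω → ℝ),
    Valid μ t A → Measurable f → Measurable s →
    IsOpen {u : ℝ | Low μ q t A (fun x => f x - u * s x)}
  | leaf, A, f, s, hA, hf, hs => by
    rw [Metric.isOpen_iff]
    intro u hu
    have hu : μ.real (A () ∩ {x | f x - u * s x ≤ 0}) < q * μ.real (A ()) := hu
    obtain ⟨n, hn⟩ := leaf_aux (μ := μ)
      (B := fun n : ℕ => A () ∩ {x | f x - u * s x ≤ |s x| * (1 / ((n : ℝ) + 1))})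
      (c := q * μ.real (A ()))
      (by
        intro m n hmn x hx
        refine ⟨hx.1, ?_⟩
        have hx2 : f x - u * s x ≤ |s x| * (1 / ((n : ℝ) + 1)) := hx.2
        change f x - u * s x ≤ |s x| * (1 / ((m : ℝ) + 1))
        refine hx2.trans ?_
        exact mul_le_mul_of_nonneg_left (Nat.one_div_le_one_div hmn) (abs_nonneg _))
      (by
        intro n
        exact hA.1.inter (measurableSet_le (by fun_prop) (by fun_prop)))
      (by
        refine lt_of_le_of_lt (measureReal_mono ?_) hu
        intro x hx
        rw [mem_iInter] at hx
        refine ⟨(hx 0).1, ?_⟩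
        have h1 := (tendsto_one_div_add_atTop_nhds_zero_nat (𝕜 := ℝ)).const_mul |s x|
        rw [mul_zero] at h1
        exact ge_of_tendsto' h1 fun n => (hx n).2)
    refine ⟨1 / ((n : ℝ) + 1), Nat.one_div_pos_of_nat, ?_⟩
    intro w hw
    refine lt_of_le_of_lt (measureReal_mono ?_) hn
    rintro x ⟨hx, hx'⟩
    refine ⟨hx, ?_⟩
    have hx' : f x - w * s x ≤ 0 := hx'
    change f x - u * s x ≤ _
    rw [Metric.mem_ball, Real.dist_eq] at hw
    have h3 : (w - u) * s x ≤ |s x| * (1 / ((n : ℝ) + 1)) := by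
      refine (le_abs_self _).trans ?_
      rw [abs_mul, mul_comm]
      exact mul_le_mul_of_nonneg_left hw.le (abs_nonneg _)
    linarith
  | node s' p n, A, f, s, hA, hf, hs => by
    have : {u : ℝ | Low μ q (node s' p n) A (fun x => f x - u * s x)} = ⋃ v : ℝ,
        ({u : ℝ | Low μ q p (fun i => A (Sum.inl i)) (fun x => (f x - v * s' x) - u * s x)} ∩
        {u : ℝ | Low μ q n (fun i => A (Sum.inr i)) (fun x => (f x - v * s' x) - u * s x)}) := by
      ext u
      simp only [mem_iUnion, mem_inter_iff, mem_ofPred_eq, Low, sub_right_comm]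
    rw [this]
    have hs' : Measurable s' := hA.1
    exact isOpen_iUnion fun v => (low_open p _ _ _ hA.2.2.2.2.1 (by fun_prop) hs).inter
      (low_open n _ _ _ hA.2.2.2.2.2 (by fun_prop) hs)

theorem low_excl {q : ℝ} : ∀ (t : YTree Ω) (A : Idx t → Set Ω) (f : Ω → ℝ),
    Valid μ t A → Low μ q t A f → Low μ (1 - q) t A (fun x => - f x) → False
  | leaf, A, f, hA, h1, h2 => by
    have h1 : μ.real (A () ∩ {x | f x ≤ 0}) < q * μ.real (A ()) := h1
    have h2 : μ.real (A () ∩ {x | - f x ≤ 0}) < (1 - q) * μ.real (A ()) := h2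
    have h3 : μ.real (A ()) ≤ μ.real (A () ∩ {x | f x ≤ 0}) + μ.real (A () ∩ {x | - f x ≤ 0}) := by
      refine le_trans (measureReal_mono ?_) (measureReal_union_le _ _)
      intro x hx
      rcases le_total (f x) 0 with h | h
      · exact Or.inl ⟨hx, h⟩
      · exact Or.inr ⟨hx, by simpa using h⟩
    linarith
  | node s p n, A, f, hA, ⟨v, h1, h2⟩, ⟨w, k1, k2⟩ => by
    obtain ⟨hs, -, hp, hn, Vp, Vn⟩ := hA
    rcases le_total (-w) v with h | h
    · refine low_excl p _ _ Vp h1 (Low.mono p _ _ _ ?_ k1)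
      intro i x hx
      nlinarith [mul_nonneg (sub_nonneg.2 h) (hp i x hx)]
    · refine low_excl n _ _ Vn h2 (Low.mono n _ _ _ ?_ k2)
      intro i x hx
      nlinarith [mul_nonneg (sub_nonneg.2 h) (neg_nonneg.2 (hn i x hx))]

theorem low_nonempty {q : ℝ} (hq : 0 < q) : ∀ (t : YTree Ω) (A : Idx t → Set Ω) (f s : Ω → ℝ),
    Valid μ t A → Measurable f → Measurable s → μ {x | s x = 0} = 0 →
    (∀ i, ∀ x ∈ A i, 0 ≤ s x) →
    ∃ v : ℝ, Low μ q t A (fun x => f x + v * s x)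
  | leaf, A, f, s, hA, hf, hs, hs0, hsA => by
    obtain ⟨n, hn⟩ := leaf_aux (μ := μ)
      (B := fun n : ℕ => A () ∩ {x | f x + n * s x ≤ 0})
      (c := q * μ.real (A ()))
      (by
        intro m n hmn x hx
        refine ⟨hx.1, ?_⟩
        have hx2 : f x + n * s x ≤ 0 := hx.2
        have : (m : ℝ) ≤ n := by exact_mod_cast hmn
        have := mul_le_mul_of_nonneg_right this (hsA () x hx.1)
        change f x + m * s x ≤ 0
        linarith)
      (by
        intro n
        exact hA.1.inter (measurableSet_le (by fun_prop) (by fun_prop)))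
      (by
        have h0 : μ (⋂ n : ℕ, A () ∩ {x | f x + n * s x ≤ 0}) = 0 := by
          refine measure_mono_null ?_ hs0
          intro x hx
          rw [mem_iInter] at hx
          have h1 := hsA () x (hx 0).1
          by_contra hne
          have hpos : 0 < s x := lt_of_le_of_ne h1 (Ne.symm hne)
          obtain ⟨n, hn⟩ := exists_nat_gt (-f x / s x)
          have h2 : f x + n * s x ≤ 0 := (hx n).2
          rw [div_lt_iff₀ hpos] at hn
          linarith
        rw [measureReal_def, h0]
        simpa using mul_pos hq hA.2)
    exact ⟨n, hn⟩
  | node s' p n, A, f, s, hA, hf, hs, hs0, hsA => by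
    obtain ⟨hs', -, hp, hn, Vp, Vn⟩ := hA
    obtain ⟨v, hv⟩ := low_nonempty hq p _ f s Vp hf hs hs0 (fun i => hsA (Sum.inl i))
    obtain ⟨w, hw⟩ := low_nonempty hq n _ f s Vn hf hs hs0 (fun i => hsA (Sum.inr i))
    refine ⟨max v w, 0, Low.mono p _ _ _ ?_ hv, Low.mono n _ _ _ ?_ hw⟩
    · intro i x hx
      have := mul_le_mul_of_nonneg_right (le_max_left v w) (hsA (Sum.inl i) x hx)
      simpa using this
    · intro i x hx
      have := mul_le_mul_of_nonneg_right (le_max_right v w) (hsA (Sum.inr i) x hx)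
      simpa using this

theorem conn_aux {U V : Set ℝ} (hU : IsOpen U) (hV : IsOpen V) (hU' : U.Nonempty)
    (hV' : V.Nonempty) (h : ∀ x ∈ U, x ∉ V) : ∃ x, x ∉ U ∧ x ∉ V := by
  by_contra! hc
  obtain ⟨x, -, hx⟩ := isPreconnected_univ (α := ℝ) U V hU hV
    (fun x _ => by
      by_cases hx : x ∈ U
      · exact Or.inl hx
      · exact Or.inr (hc x hx)) (by simpa using hU') (by simpa using hV')
  exact h x hx.1 hx.2

theorem high_open {q : ℝ} (t : YTree Ω) (A : Idx t → Set Ω) (f s : Ω → ℝ)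
    (hA : Valid μ t A) (hf : Measurable f) (hs : Measurable s) :
    IsOpen {u : ℝ | Low μ q t A (fun x => -(f x - u * s x))} := by
  have := low_open (q := q) t A (fun x => - f x) (fun x => - s x) hA hf.neg hs.neg
  convert this using 4
  funext x
  ring

theorem balance {q : ℝ} (hq : 0 < q) (hq1 : q < 1) :
    ∀ (t : YTree Ω) (A : Idx t → Set Ω) (f : Ω → ℝ),
    Valid μ t A → Measurable f → ¬ Low μ q t A f → ¬ Low μ (1 - q) t A (fun x => - f x) →
    ∃ g, Adm t f g ∧ ∀ i, q * μ.real (A i) ≤ μ.real (A i ∩ {x | g i x ≤ 0}) ∧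
      (1 - q) * μ.real (A i) ≤ μ.real (A i ∩ {x | 0 ≤ g i x})
  | leaf, A, f, hA, hf, h1, h2 => by
    have h1 : q * μ.real (A ()) ≤ μ.real (A () ∩ {x | f x ≤ 0}) := not_lt.1 h1
    have h2 : (1 - q) * μ.real (A ()) ≤ μ.real (A () ∩ {x | - f x ≤ 0}) := not_lt.1 h2
    simp only [neg_nonpos] at h2
    exact ⟨fun _ => f, rfl, fun i => ⟨h1, h2⟩⟩
  | node s p n, A, f, hA, hf, h1, h2 => by
    obtain ⟨hs, hs0, hp, hn, Vp, Vn⟩ := hA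
    obtain ⟨v, hv1, hv2⟩ := conn_aux
      (U := {v | Low μ q p (fun i => A (Sum.inl i)) (fun x => f x - v * s x)} ∪
        {v | Low μ (1 - q) n (fun i => A (Sum.inr i)) (fun x => -(f x - v * s x))})
      (V := {v | Low μ q n (fun i => A (Sum.inr i)) (fun x => f x - v * s x)} ∪
        {v | Low μ (1 - q) p (fun i => A (Sum.inl i)) (fun x => -(f x - v * s x))})
      ((low_open p _ _ _ Vp hf hs).union (high_open n _ _ _ Vn hf hs))
      ((low_open n _ _ _ Vn hf hs).union (high_open p _ _ _ Vp hf hs))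
      (by
        obtain ⟨v, hv⟩ := low_nonempty hq p _ f s Vp hf hs hs0 hp
        refine ⟨-v, Or.inl ?_⟩
        simpa using hv)
      (by
        obtain ⟨v, hv⟩ := low_nonempty hq n _ f (fun x => - s x) Vn hf hs.neg (by simpa using hs0)
          (fun i x hx => neg_nonneg.2 (hn i x hx))
        refine ⟨v, Or.inl ?_⟩
        simpa [sub_eq_add_neg] using hv)
      (by
        have key : ∀ v, Low μ (1 - q) n (fun i => A (Sum.inr i)) (fun x => -(f x - v * s x)) →
            Low μ (1 - q) p (fun i => A (Sum.inl i)) (fun x => -(f x - v * s x)) → False := by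
          intro v hv hv'
          apply h2
          have e : (fun x => -(f x - v * s x)) = fun x => - f x - (-v) * s x := by
            funext x; ring
          rw [e] at hv hv'
          exact ⟨-v, hv', hv⟩
        rintro v (hv | hv) (hv' | hv')
        · exact h1 ⟨v, hv, hv'⟩
        · exact low_excl p _ _ Vp hv hv'
        · exact low_excl n _ _ Vn hv' hv
        · exact key v hv hv')
    simp only [mem_union, mem_ofPred_eq, not_or] at hv1 hv2
    obtain ⟨g1, a1, b1⟩ := balance hq hq1 p _ _ Vp (by fun_prop) hv1.1 hv2.2
    obtain ⟨g2, a2, b2⟩ := balance hq hq1 n _ _ Vn (by fun_prop) hv2.1 hv1.2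
    refine ⟨Sum.elim g1 g2, ⟨v, a1, a2⟩, ?_⟩
    rintro (i | i)
    · exact b1 i
    · exact b2 i

theorem balance_top {q : ℝ} (hq : 0 < q) (hq1 : q < 1) (t : YTree Ω) (A : Idx t → Set Ω)
    (f : Ω → ℝ) (hA : Valid μ t A) (hf : Measurable f) :
    ∃ c : ℝ, ∃ g, Adm t (fun x => f x - c) g ∧
      ∀ i, q * μ.real (A i) ≤ μ.real (A i ∩ {x | g i x ≤ 0}) ∧
      (1 - q) * μ.real (A i) ≤ μ.real (A i ∩ {x | 0 ≤ g i x}) := by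
  have m1 : Measurable (fun _ : Ω => (1 : ℝ)) := measurable_const
  have z1 : μ {x | (fun _ : Ω => (1 : ℝ)) x = 0} = 0 := by simp
  obtain ⟨c, hc1, hc2⟩ := conn_aux
    (low_open (q := q) t A f (fun _ => 1) hA hf m1)
    (high_open (q := 1 - q) t A f (fun _ => 1) hA hf m1)
    (by
      obtain ⟨v, hv⟩ := low_nonempty hq t A f _ hA hf m1 z1 (fun _ _ _ => zero_le_one)
      refine ⟨-v, ?_⟩
      simpa using hv)
    (by
      obtain ⟨v, hv⟩ := low_nonempty (sub_pos.2 hq1) t A (fun x => - f x) _ hA hf.neg m1 z1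
        (fun _ _ _ => zero_le_one)
      refine ⟨v, ?_⟩
      simpa [add_comm, sub_eq_add_neg] using hv)
    (fun v hv hv' => low_excl t A _ hA hv hv')
  simp only [mem_ofPred_eq, mul_one] at hc1 hc2
  exact ⟨c, balance hq hq1 t A _ hA (by fun_prop) hc1 hc2⟩

end YTree

/-! ## Geometry -/

section Geometry

variable {d : ℕ}

/-- affine functions with leading coordinate `k` -/
def AffL (k : Fin d) (g : Euc d → ℝ) : Prop :=
  ∃ a : Euc d, ∃ b : ℝ, (∀ x, g x = inner ℝ a x + b) ∧ a k = 1 ∧ ∀ j, k < j → a j = 0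

theorem AffL.sub {k j : Fin d} (hjk : j < k) {f s : Euc d → ℝ} (v : ℝ) (hf : AffL k f)
    (hs : AffL j s) : AffL k (fun x => f x - v * s x) := by
  obtain ⟨a, b, h1, h2, h3⟩ := hf
  obtain ⟨a', b', k1, k2, k3⟩ := hs
  refine ⟨a - v • a', b - v * b', ?_, ?_, ?_⟩
  · intro x
    change f x - v * s x = _
    rw [h1, k1, inner_sub_left, real_inner_smul_left]
    ring
  · simp [h2, k3 k hjk]
  · intro i hi
    simp [h3 i hi, k3 i (hjk.trans hi)]

theorem AffL.coord (k : Fin d) (c : ℝ) : AffL k (fun x : Euc d => x k - c) := by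
  refine ⟨EuclideanSpace.single k 1, -c, ?_, ?_, ?_⟩
  · intro x
    have := EuclideanSpace.inner_single_left (𝕜 := ℝ) k 1 x
    rw [this]
    simp [sub_eq_add_neg]
  · simp
  · intro j hj
    simp [hj.ne']

theorem AffL.continuous {k : Fin d} {g : Euc d → ℝ} (h : AffL k g) : Continuous g := by
  obtain ⟨a, b, h1, -, -⟩ := h
  rw [funext h1]
  fun_prop

theorem AffL.null {k : Fin d} {g : Euc d → ℝ} (h : AffL k g) :
    (volume : Measure (Euc d)) {x | g x = 0} = 0 := by
  obtain ⟨a, b, h1, h2, -⟩ := h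
  by_cases he : ∃ x0, g x0 = 0
  · obtain ⟨x0, hx0⟩ := he
    have : {x | g x = 0} = (fun x => x + -x0) ⁻¹'
        ((innerₛₗ ℝ a).ker : Set (Euc d)) := by
      ext x
      simp only [mem_ofPred_eq, mem_preimage, SetLike.mem_coe, LinearMap.mem_ker, innerₛₗ_apply_apply,
        inner_add_right, inner_neg_right]
      rw [h1] at hx0 ⊢
      constructor <;> intro h <;> linarith
    rw [this, measure_preimage_add_right]
    apply Measure.addHaar_submodule
    intro ht
    have : a ∈ (innerₛₗ ℝ a).ker := by rw [ht]; trivial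
    rw [LinearMap.mem_ker, innerₛₗ_apply_apply, inner_self_eq_zero] at this
    rw [this] at h2
    simp at h2
  · have : {x | g x = 0} = ∅ := by
      ext x
      simp only [mem_ofPred_eq, mem_empty_iff_false, iff_false]
      exact fun h => he ⟨x, h⟩
    rw [this, measure_empty]

theorem AffL.convex_ge {k : Fin d} {g : Euc d → ℝ} (h : AffL k g) :
    Convex ℝ {x | 0 ≤ g x} := by
  obtain ⟨a, b, h1, -, -⟩ := h
  have := convex_halfSpace_ge (𝕜 := ℝ) (f := innerₛₗ ℝ a) (innerₛₗ ℝ a).isLinear (-b)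
  have e : {x | 0 ≤ g x} = {w | -b ≤ innerₛₗ ℝ a w} := by
    ext x
    simp only [mem_ofPred_eq, h1, innerₛₗ_apply_apply]
    constructor <;> intro h <;> linarith
  rw [e]
  exact this

theorem AffL.convex_le {k : Fin d} {g : Euc d → ℝ} (h : AffL k g) :
    Convex ℝ {x | g x ≤ 0} := by
  obtain ⟨a, b, h1, -, -⟩ := h
  have := convex_halfSpace_le (𝕜 := ℝ) (f := innerₛₗ ℝ a) (innerₛₗ ℝ a).isLinear (-b)
  have e : {x | g x ≤ 0} = {w | innerₛₗ ℝ a w ≤ -b} := by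
    ext x
    simp only [mem_ofPred_eq, h1, innerₛₗ_apply_apply]
    constructor <;> intro h <;> linarith
  rw [e]
  exact this

/-- closed convex sets -/
def CC (S : Set (Euc d)) : Prop := IsClosed S ∧ Convex ℝ S

theorem CC.ge {S : Set (Euc d)} (hS : CC S) {k : Fin d} {g : Euc d → ℝ} (h : AffL k g) :
    CC (S ∩ {x | 0 ≤ g x}) :=
  ⟨hS.1.inter (isClosed_le continuous_const h.continuous), hS.2.inter h.convex_ge⟩

theorem CC.le {S : Set (Euc d)} (hS : CC S) {k : Fin d} {g : Euc d → ℝ} (h : AffL k g) :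
    CC (S ∩ {x | g x ≤ 0}) :=
  ⟨hS.1.inter (isClosed_le h.continuous continuous_const), hS.2.inter h.convex_le⟩

theorem half_add {μ : Measure (Euc d)} [IsFiniteMeasure μ] (hμ : μ ≪ volume)
    {S : Set (Euc d)} (hS : CC S) {k : Fin d} {g : Euc d → ℝ} (h : AffL k g) :
    μ.real (S ∩ {x | g x ≤ 0}) + μ.real (S ∩ {x | 0 ≤ g x}) = μ.real S := by
  rw [← measureReal_union_add_inter (hS.ge h).1.measurableSet]
  have h1 : S ∩ {x | g x ≤ 0} ∪ S ∩ {x | 0 ≤ g x} = S := by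
    ext x
    constructor
    · rintro (h | h)
      · exact h.1
      · exact h.1
    · intro hx
      rcases le_total (g x) 0 with h | h
      · exact Or.inl ⟨hx, h⟩
      · exact Or.inr ⟨hx, h⟩
  have h2 : μ ((S ∩ {x | g x ≤ 0}) ∩ (S ∩ {x | 0 ≤ g x})) = 0 := by
    refine measure_mono_null ?_ (hμ h.null)
    rintro x ⟨⟨-, hx⟩, -, hx'⟩
    exact le_antisymm hx hx'
  rw [h1, measureReal_def μ (_ ∩ _), h2]
  simp

open YTree

/-- trees whose node functions have leading coordinates below `k` -/
def TOK (k : ℕ) (t : YTree (Euc d)) : Prop :=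
  All (fun s => ∃ j : Fin d, j.val < k ∧ AffL j s) t

def WW (k : ℕ) (p : Fin d → ℝ) : Set (Euc d → ℝ) :=
  {l | ∃ b : Fin d → ℝ, (∀ j, k ≤ j.val → b j = 0) ∧ l = fun x => ∑ j, b j * (x j - p j)}

theorem TOK.cell {k : ℕ} {t : YTree (Euc d)} (h : TOK k t) (i : Idx t) : CC (cell t univ i) := by
  refine cell_induct (P := CC) t univ ⟨isClosed_univ, convex_univ⟩ ?_ i
  refine All.mono ?_ t h
  rintro s ⟨j, -, hj⟩ S hS
  exact ⟨hS.ge hj, hS.le hj⟩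

theorem TOK.null {μ : Measure (Euc d)} (hμ : μ ≪ volume) {k : ℕ} {t : YTree (Euc d)}
    (h : TOK k t) : All (fun s => Measurable s ∧ μ {x | s x = 0} = 0) t := by
  refine All.mono ?_ t h
  rintro s ⟨j, -, hj⟩
  exact ⟨hj.continuous.measurable, hμ hj.null⟩

theorem TOK.adm {k : Fin d} {t : YTree (Euc d)} (h : TOK k.val t) {f : Euc d → ℝ}
    (hf : AffL k f) {g : Idx t → Euc d → ℝ} (hg : Adm t f g) (i : Idx t) : AffL k (g i) := by
  refine adm_all (Q := AffL k) ?_ t f g h hf hg i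
  rintro f s v hf ⟨j, hj, hs⟩
  exact hf.sub (Fin.lt_def.2 hj) v hs

/-- the cutting step -/
theorem cut {μ : Measure (Euc d)} [IsFiniteMeasure μ] (hμ : μ ≪ volume) {k : Fin d}
    {t : YTree (Euc d)} (ht : TOK k.val t) {q : ℝ} (hq : 0 < q) (hq1 : q < 1)
    (A : Idx t → Set (Euc d)) (hA : ∀ i, A i ⊆ cell t univ i) (hA' : ∀ i, CC (A i))
    (hpos : ∀ i, 0 < μ.real (A i)) :
    ∃ c : ℝ, ∃ g, Adm t (fun x : Euc d => x k - c) g ∧ (∀ i, AffL k (g i)) ∧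
      ∀ i, μ.real (A i ∩ {x | g i x ≤ 0}) = q * μ.real (A i) ∧
        μ.real (A i ∩ {x | 0 ≤ g i x}) = (1 - q) * μ.real (A i) := by
  obtain ⟨c, g, h1, h2⟩ := balance_top hq hq1 t A (fun x : Euc d => x k)
    (valid_of_cell t univ A (ht.null hμ) hA (fun i => (hA' i).1.measurableSet) hpos)
    (by fun_prop)
  have h3 := ht.adm (AffL.coord k c) h1
  refine ⟨c, g, h1, h3, fun i => ?_⟩
  have h4 := half_add hμ (hA' i) (h3 i)
  have h5 := h2 i
  constructor <;> linarith [h5.1, h5.2]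

theorem stage {μ : Measure (Euc d)} [IsProbabilityMeasure μ] (hμ : μ ≪ volume) :
    ∀ k : ℕ, k ≤ d → ∃ t : YTree (Euc d), ∃ p : Fin d → ℝ, TOK k t ∧ AV t (WW k p) ∧
      Nat.card (Idx t) = 2 ^ k ∧ ∀ i, μ.real (cell t univ i) = (1 / 2) ^ k
  | 0, _ => by
    refine ⟨leaf, 0, trivial, ?_, ?_, ?_⟩
    · rintro l ⟨b, hb, rfl⟩ x
      simp [hb]
    · change Nat.card Unit = _
      simp
    · intro i
      change μ.real univ = _
      simp
  | k + 1, hk => by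
    obtain ⟨t, p, h1, h2, h3, h4⟩ := stage hμ k (by omega)
    let e : Fin d := ⟨k, hk⟩
    obtain ⟨c, g, g1, g2, g3⟩ := cut hμ (k := e) h1 (q := 1 / 2) (by norm_num) (by norm_num)
      (cell t univ) (fun _ => subset_rfl) (fun i => h1.cell i) (fun i => by rw [h4]; positivity)
    refine ⟨grow t g, Function.update p e c, ?_, ?_, ?_, ?_⟩
    · refine all_grow t g (All.mono ?_ t h1) fun i => ⟨e, Nat.lt_succ_self k, g2 i⟩
      rintro s ⟨j, hj, hs⟩
      exact ⟨j, hj.trans (Nat.lt_succ_self k), hs⟩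
    · refine AV.anti _ _ _ ?_ (AV_grow t _ _ g h2 g1)
      rintro l ⟨b, hb, rfl⟩
      refine ⟨_, ⟨Function.update b e 0, ?_, rfl⟩, b e, ?_⟩
      · intro j hj
        by_cases hje : j = e
        · rw [hje, Function.update_self]
        · rw [Function.update_of_ne hje]
          apply hb
          have : j.val ≠ k := fun h => hje (Fin.ext h)
          omega
      · funext x
        rw [← Finset.sum_erase_add _ _ (Finset.mem_univ e),
          ← Finset.sum_erase_add Finset.univ (fun j => Function.update b e 0 j * (x j - p j))
            (Finset.mem_univ e)]
        simp only [Function.update_self, zero_mul, add_zero]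
        congr 1
        refine Finset.sum_congr rfl fun j hj => ?_
        have := Finset.ne_of_mem_erase hj
        rw [Function.update_of_ne this, Function.update_of_ne this]
    · rw [card_grow, h3]; ring
    · intro i
      obtain ⟨j, hj | hj⟩ := cell_grow t g univ i
      · rw [hj, (g3 j).2, h4]; ring
      · rw [hj, (g3 j).1, h4]; ring

theorem avoids_of {v : Euc d} (hv : v ≠ 0) {c σ : ℝ} (hσ : σ ≠ 0) {S : Set (Euc d)}
    (h : ∀ x ∈ S, 0 ≤ σ * (inner ℝ v x - c)) : Avoids (Hyperplane v c) S := by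
  rw [Avoids, eq_empty_iff_forall_notMem]
  rintro x ⟨hx, hx'⟩
  have hx : inner ℝ v x = c := hx
  have h1 : Filter.Tendsto (fun t : ℝ => x - (t * σ) • v) (nhds 0) (nhds x) := by
    have : Continuous (fun t : ℝ => x - (t * σ) • v) := by fun_prop
    simpa using this.tendsto 0
  have h2 := (h1.eventually (isOpen_interior.mem_nhds hx')).filter_mono
    (nhdsWithin_le_nhds (s := Ioi 0))
  obtain ⟨t, ht, ht'⟩ := (h2.and self_mem_nhdsWithin).exists
  have h3 := h _ (interior_subset ht)
  rw [inner_sub_right, real_inner_smul_right, hx, real_inner_self_eq_norm_sq] at h3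
  have h4 : 0 < t * (σ ^ 2 * ‖v‖ ^ 2) := mul_pos ht' (by positivity)
  nlinarith

theorem side {m : ℕ} {t : YTree (Euc (m + 1))} {p : Fin (m + 1) → ℝ} (hAV : AV t (WW m p)) {c1 : ℝ}
    {g : Idx t → Euc (m + 1) → ℝ}
    (hg : Adm t (fun x : Euc (m + 1) => x (Fin.last m) - c1) g) (v : Euc (m + 1)) (c : ℝ) :
    ∃ σ : ℝ, σ ≠ 0 ∧ ∃ i, ∃ β : ℝ, ∀ x ∈ cell t univ i, β * g i x ≤ σ * (inner ℝ v x - c) := by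
  set κ : ℝ := ∑ j : Fin m, v j.castSucc * p j.castSucc + v (Fin.last m) * c1 - c with hκ
  obtain ⟨σ, hσ, hσκ⟩ : ∃ σ : ℝ, σ ≠ 0 ∧ 0 ≤ σ * κ := by
    rcases le_total 0 κ with h | h
    · exact ⟨1, one_ne_zero, by linarith⟩
    · exact ⟨-1, by norm_num, by linarith⟩
  refine ⟨σ, hσ, ?_⟩
  obtain ⟨i, β, h⟩ := AV_avoid t _ _ g univ hAV hg
    (fun x => ∑ j, (if j = Fin.last m then 0 else σ * v j) * (x j - p j))
    ⟨_, fun j hj => by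
      have : j = Fin.last m := Fin.ext (le_antisymm (Nat.lt_succ_iff.1 j.2) hj)
      simp [this], rfl⟩ (σ * v (Fin.last m))
  refine ⟨i, β, fun x hx => (h x hx).trans ?_⟩
  have e : (inner ℝ v x : ℝ) = ∑ j : Fin m, v j.castSucc * x j.castSucc
      + v (Fin.last m) * x (Fin.last m) := by
    rw [PiLp.inner_apply, Fin.sum_univ_castSucc]
    simp [mul_comm]
  have e2 : ∑ j, (if j = Fin.last m then 0 else σ * v j) * (x j - p j) =
      σ * (∑ j : Fin m, v j.castSucc * x j.castSucc - ∑ j : Fin m, v j.castSucc * p j.castSucc) := by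
    rw [Fin.sum_univ_castSucc, ← Finset.sum_sub_distrib, Finset.mul_sum]
    simp only [if_true, zero_mul, add_zero]
    refine Finset.sum_congr rfl fun j _ => ?_
    rw [if_neg (Fin.castSucc_lt_last j).ne]
    ring
  simp only [e, e2]
  rw [hκ] at hσκ
  nlinarith

end Geometry

/-- Theorem (Yao–Yao for two avoided parts): any nice measure on ℝ^d (d ≥ 1) admits a
convex equipartition into 3·2^(d-1) parts such that every hyperplane avoids at least two. -/
theorem yao_yao_avoids_two (d : ℕ) (hd : 1 ≤ d) (μ : Measure (Euc d)) (hμ : NiceMeasure d μ) :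
    ∃ C : Fin (3 * 2 ^ (d - 1)) → Set (Euc d), IsEquipartition μ 2 C := by
  obtain ⟨m, rfl⟩ : ∃ m, d = m + 1 := ⟨d - 1, by omega⟩
  change ∃ C : Fin (3 * 2 ^ m) → Set (Euc (m + 1)), IsEquipartition μ 2 C
  obtain ⟨hprob, ρ, hρc, hρpos, hρ⟩ := hμ
  have hac : μ ≪ volume := hρ ▸ withDensity_absolutelyContinuous _ _
  have hca : volume ≪ μ := by
    rw [hρ]
    refine withDensity_absolutelyContinuous' (by fun_prop) (Filter.Eventually.of_forall fun x => ?_)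
    simpa using hρpos x
  obtain ⟨t, p, h1, h2, h3, h4⟩ := stage hac m (Nat.le_succ m)
  have hcc := h1.cell
  obtain ⟨c1, g, g1, g2, g3⟩ := cut hac (k := Fin.last m) h1 (q := 1 / 3) (by norm_num)
    (by norm_num) (YTree.cell t univ) (fun _ => subset_rfl) hcc
    (fun i => by rw [h4]; positivity)
  obtain ⟨c2, h, k1, k2, k3⟩ := cut hac (k := Fin.last m) h1 (q := 1 / 2) (by norm_num)
    (by norm_num) (fun i => YTree.cell t univ i ∩ {x | 0 ≤ g i x}) (fun _ => inter_subset_left)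
    (fun i => (hcc i).ge (g2 i)) (fun i => by rw [(g3 i).2, h4]; norm_num)
  let D : YTree.Idx t × Fin 3 → Set (Euc (m + 1)) := fun y =>
    ![YTree.cell t univ y.1 ∩ {x | g y.1 x ≤ 0},
      (YTree.cell t univ y.1 ∩ {x | 0 ≤ g y.1 x}) ∩ {x | h y.1 x ≤ 0},
      (YTree.cell t univ y.1 ∩ {x | 0 ≤ g y.1 x}) ∩ {x | 0 ≤ h y.1 x}] y.2
  have hfin := YTree.finite_idx t
  have hcard : Nat.card (YTree.Idx t × Fin 3) = 3 * 2 ^ m := by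
    rw [Nat.card_prod, h3, Nat.card_fin, mul_comm]
  let Φ : Fin (3 * 2 ^ m) ≃ YTree.Idx t × Fin 3 := (Finite.equivFinOfCardEq hcard).symm
  have hDcell : ∀ y, D y ⊆ YTree.cell t univ y.1 := by
    rintro ⟨i, a⟩ x hx
    fin_cases a
    · exact hx.1
    · exact hx.1.1
    · exact hx.1.1
  have hDcc : ∀ y, CC (D y) := by
    rintro ⟨i, a⟩
    fin_cases a
    · exact (hcc i).le (g2 i)
    · exact ((hcc i).ge (g2 i)).le (k2 i)
    · exact ((hcc i).ge (g2 i)).ge (k2 i)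
  have hgn : ∀ i, μ {x | g i x = 0} = 0 := fun i => hac (g2 i).null
  have hhn : ∀ i, μ {x | h i x = 0} = 0 := fun i => hac (k2 i).null
  have hDnull : ∀ y z, y ≠ z → μ (D y ∩ D z) = 0 := by
    rintro ⟨i, a⟩ ⟨j, b⟩ hne
    by_cases hij : i = j
    · subst hij
      have hab : a ≠ b := fun e => hne (by rw [e])
      fin_cases a <;> fin_cases b
      · exact absurd rfl hab
      · exact measure_mono_null (fun x hx => le_antisymm hx.1.2 hx.2.1.2) (hgn i)
      · exact measure_mono_null (fun x hx => le_antisymm hx.1.2 hx.2.1.2) (hgn i)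
      · exact measure_mono_null (fun x hx => le_antisymm hx.2.2 hx.1.1.2) (hgn i)
      · exact absurd rfl hab
      · exact measure_mono_null (fun x hx => le_antisymm hx.1.2 hx.2.2) (hhn i)
      · exact measure_mono_null (fun x hx => le_antisymm hx.2.2 hx.1.1.2) (hgn i)
      · exact measure_mono_null (fun x hx => le_antisymm hx.2.2 hx.1.2) (hhn i)
      · exact absurd rfl hab
    · exact measure_mono_null (inter_subset_inter (hDcell _) (hDcell _))
        (YTree.cell_null t univ (h1.null hac) i j hij)
  have hDcover : ∀ x, ∃ y, x ∈ D y := by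
    intro x
    obtain ⟨i, hi⟩ := YTree.cell_cover t univ x (mem_univ x)
    rcases le_total (g i x) 0 with hg | hg
    · exact ⟨(i, 0), hi, hg⟩
    · rcases le_total (h i x) 0 with hh | hh
      · exact ⟨(i, 1), ⟨hi, hg⟩, hh⟩
      · exact ⟨(i, 2), ⟨hi, hg⟩, hh⟩
  have hDmass : ∀ y, μ.real (D y) = 1 / 3 * (1 / 2) ^ m := by
    rintro ⟨i, a⟩
    fin_cases a
    · exact (g3 i).1.trans (by rw [h4])
    · exact (k3 i).1.trans (by rw [(g3 i).2, h4]; ring)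
    · exact (k3 i).2.trans (by rw [(g3 i).2, h4]; ring)
  refine ⟨fun n => D (Φ n), ⟨fun n => (hDcc _).1, fun n => (hDcc _).2, ?_, ?_⟩, ?_, ?_⟩
  · intro a b hab
    have h0 := hDnull (Φ a) (Φ b) (Φ.injective.ne hab)
    have h5 : volume (interior (D (Φ a)) ∩ interior (D (Φ b))) = 0 :=
      hca (measure_mono_null (inter_subset_inter interior_subset interior_subset) h0)
    exact ((isOpen_interior.inter isOpen_interior).measure_eq_zero_iff volume).1 h5
  · rw [eq_univ_iff_forall]
    intro x
    obtain ⟨y, hy⟩ := hDcover x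
    exact mem_iUnion.2 ⟨Φ.symm y, by simpa using hy⟩
  · intro n
    have h5 := hDmass (Φ n)
    rw [measureReal_def] at h5
    rw [← ENNReal.toReal_eq_toReal_iff' (measure_ne_top _ _) (by simp), h5]
    simp [mul_comm]
  · intro v c hv
    obtain ⟨σ, hσ, i, β, hi⟩ := side h2 g1 v c
    obtain ⟨τ, hτ, j, γ, hj⟩ := side h2 k1 v c
    have key : ∃ y z, y ≠ z ∧ Avoids (Hyperplane v c) (D y) ∧ Avoids (Hyperplane v c) (D z) := by
      rcases le_total 0 β with hβ | hβ
      · have : ∀ x ∈ YTree.cell t univ i ∩ {x | 0 ≤ g i x}, 0 ≤ σ * (inner ℝ v x - c) :=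
          fun x hx => (mul_nonneg hβ hx.2).trans (hi x hx.1)
        refine ⟨(i, 1), (i, 2), by simp, avoids_of hv hσ ?_, avoids_of hv hσ ?_⟩
        · exact fun x hx => this x hx.1
        · exact fun x hx => this x hx.1
      · have h0 : Avoids (Hyperplane v c) (D (i, 0)) := avoids_of hv hσ fun x hx =>
          (mul_nonneg_of_nonpos_of_nonpos hβ hx.2).trans (hi x hx.1)
        rcases le_total 0 γ with hγ | hγ
        · refine ⟨(i, 0), (j, 2), by simp, h0, avoids_of hv hτ fun x hx => ?_⟩
          exact (mul_nonneg hγ hx.2).trans (hj x hx.1.1)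
        · refine ⟨(i, 0), (j, 1), by simp, h0, avoids_of hv hτ fun x hx => ?_⟩
          exact (mul_nonneg_of_nonpos_of_nonpos hγ hx.2).trans (hj x hx.1.1)
    obtain ⟨y, z, hyz, hy, hz⟩ := key
    refine (Set.one_lt_ncard_iff (Set.toFinite _)).2 ⟨Φ.symm y, Φ.symm z, ?_, ?_, ?_⟩
    · simpa using hy
    · simpa using hz
    · exact Φ.symm.injective.ne hyz
end
end

section
/- Let μ be a nice measure on ℝ². Then there exist two distinct parallel lines ℓ1, ℓ2 and a third line ℓ3 meeting both of them, such that the closures of the six connected components of the complement of ℓ1 ∪ ℓ2 ∪ ℓ3 each have μ-measure 1/6, and every line in ℝ² avoids at least two of these six regions. -/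
open MeasureTheory Set Metric
open scoped ENNReal
noncomputable section

namespace Six

open Filter Topology

/-- Coordinate along the rotated first axis. -/
def S (θ : ℝ) (x : Euc 2) : ℝ := Real.cos θ * x 0 + Real.sin θ * x 1
/-- Coordinate along the rotated second axis. -/
def T (θ : ℝ) (x : Euc 2) : ℝ := -Real.sin θ * x 0 + Real.cos θ * x 1
/-- The point with given rotated coordinates. -/
def P (θ s t : ℝ) : Euc 2 :=
  !₂[Real.cos θ * s - Real.sin θ * t, Real.sin θ * s + Real.cos θ * t]

lemma S_P (θ s t : ℝ) : S θ (P θ s t) = s := by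
  simp [S, P]; linear_combination s * Real.sin_sq_add_cos_sq θ
lemma T_P (θ s t : ℝ) : T θ (P θ s t) = t := by
  simp [T, P]; linear_combination t * Real.sin_sq_add_cos_sq θ

lemma S_cont (θ : ℝ) : Continuous (S θ) := by unfold S; fun_prop
lemma T_cont (θ : ℝ) : Continuous (T θ) := by unfold T; fun_prop
lemma S_cont' (x : Euc 2) : Continuous (fun θ => S θ x) := by unfold S; fun_prop
lemma T_cont' (x : Euc 2) : Continuous (fun θ => T θ x) := by unfold T; fun_prop
lemma S_pi (θ : ℝ) (x : Euc 2) : S (θ + Real.pi) x = - S θ x := by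
  simp [S]; ring
lemma T_pi (θ : ℝ) (x : Euc 2) : T (θ + Real.pi) x = - T θ x := by
  simp [T]; ring

lemma vol_line (α β c : ℝ) (h : α ≠ 0 ∨ β ≠ 0) :
    (volume : Measure (Euc 2)) {x | α * x 0 + β * x 1 = c} = 0 := by
  have hv : (!₂[α, β] : Euc 2) ≠ 0 := by
    intro h0
    have h1 := congrFun (congrArg WithLp.ofLp h0) 0
    have h2 := congrFun (congrArg WithLp.ofLp h0) 1
    simp at h1 h2
    tauto
  have hpos : 0 < α ^ 2 + β ^ 2 := by
    rcases h with h | h <;> positivity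
  let x0 : Euc 2 := !₂[c * α / (α ^ 2 + β ^ 2), c * β / (α ^ 2 + β ^ 2)]
  let K : Submodule ℝ (Euc 2) := (ℝ ∙ (!₂[α, β] : Euc 2))ᗮ
  have hK : ∀ x : Euc 2, x ∈ K ↔ α * x 0 + β * x 1 = 0 := by
    intro x
    rw [Submodule.mem_orthogonal_singleton_iff_inner_right]
    simp [PiLp.inner_apply, Fin.sum_univ_two, mul_comm]
  have hset : {x : Euc 2 | α * x 0 + β * x 1 = c} = (fun x => x + (-x0)) ⁻¹' (K : Set (Euc 2)) := by
    ext x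
    simp only [mem_ofPred_eq, mem_preimage, SetLike.mem_coe, hK]
    have : α * (x + -x0) 0 + β * (x + -x0) 1 = α * x 0 + β * x 1 - c := by
      simp [x0]; field_simp; ring
    rw [this, sub_eq_zero]
  rw [hset, measure_preimage_add_right]
  apply Measure.addHaar_submodule
  intro htop
  have : (!₂[α, β] : Euc 2) ∈ K := by rw [htop]; trivial
  rw [hK] at this
  simp at this
  nlinarith

/-- Working properties of the measure. -/
structure Good (μ : Measure (Euc 2)) : Prop where
  prob : IsProbabilityMeasure μ
  line : ∀ α β c : ℝ, (α ≠ 0 ∨ β ≠ 0) → μ {x | α * x 0 + β * x 1 = c} = 0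
  pos : ∀ U : Set (Euc 2), IsOpen U → U.Nonempty → 0 < μ U

lemma good_of_nice {μ : Measure (Euc 2)} (h : NiceMeasure 2 μ) : Good μ := by
  obtain ⟨hp, f, hf, hpos, hμ⟩ := h
  refine ⟨hp, fun α β c h => ?_, fun U hU hn => ?_⟩
  · rw [hμ]
    exact withDensity_absolutelyContinuous _ _ (vol_line α β c h)
  · rw [pos_iff_ne_zero]
    intro h0
    have hac : (volume : Measure (Euc 2)) ≪ μ := by
      rw [hμ]
      apply withDensity_absolutelyContinuous'
      · exact (hf.measurable.ennreal_ofReal).aemeasurable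
      · exact Eventually.of_forall fun x => by simp [hpos x]
    exact (hU.measure_pos volume hn).ne' (hac h0)

lemma cs (θ : ℝ) : Real.cos θ ≠ 0 ∨ Real.sin θ ≠ 0 := by
  by_contra h
  push Not at h
  have := Real.sin_sq_add_cos_sq θ
  rw [h.1, h.2] at this
  norm_num at this

section
variable {μ : Measure (Euc 2)}

lemma nullS (h : Good μ) (θ c : ℝ) : μ {x | S θ x - c = 0} = 0 := by
  have := h.line _ _ c (cs θ)
  convert this using 3
  simp [S, sub_eq_zero]

lemma nullT (h : Good μ) (θ p q : ℝ) : μ {x | T θ x - (p + q * S θ x) = 0} = 0 := by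
  have := h.line (-Real.sin θ - q * Real.cos θ) (Real.cos θ - q * Real.sin θ) p (by
    by_contra h
    push Not at h
    have h1 := Real.sin_sq_add_cos_sq θ
    have : Real.sin θ = 0 := by
      have : Real.sin θ * (1 + q ^ 2) = 0 := by linear_combination -h.1 - q * h.2
      rcases mul_eq_zero.1 this with h | h
      · exact h
      · nlinarith
    have h2 := h.2
    rw [this] at h1 h2
    simp at h2
    rw [h2] at h1; norm_num at h1)
  convert this using 3
  funext x
  simp only [S, T, eq_iff_iff]
  constructor <;> intro h <;> linear_combination h

lemma cont_meas (h : Good μ) {X : Type*} [TopologicalSpace X] [FirstCountableTopology X]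
    (f g : X → Euc 2 → ℝ) (hf : ∀ y, Continuous (fun x => f x y)) (hf' : ∀ x, Continuous (f x))
    (hg : ∀ y, Continuous (fun x => g x y)) (hg' : ∀ x, Continuous (g x))
    (nf : ∀ x, μ {y | f x y = 0} = 0) (ng : ∀ x, μ {y | g x y = 0} = 0) :
    Continuous (fun x => μ.real {y | f x y ≤ 0 ∧ g x y ≤ 0}) := by
  have := h.prob
  have hm : ∀ x, MeasurableSet {y | f x y ≤ 0 ∧ g x y ≤ 0} := fun x =>
    ((isClosed_le (hf' x) continuous_const).inter
      (isClosed_le (hg' x) continuous_const)).measurableSet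
  have : (fun x => μ.real {y | f x y ≤ 0 ∧ g x y ≤ 0}) =
      fun x => ∫ y, ({y | f x y ≤ 0 ∧ g x y ≤ 0}.indicator (fun _ => (1:ℝ))) y ∂μ := by
    funext x
    rw [integral_indicator_const _ (hm x)]; simp
  rw [this, continuous_iff_continuousAt]
  intro x0
  apply continuousAt_of_dominated (bound := fun _ => 1)
  · exact Eventually.of_forall fun x =>
      (measurable_const.indicator (hm x)).aestronglyMeasurable
  · refine Eventually.of_forall fun x => Eventually.of_forall fun y => ?_
    by_cases hy : y ∈ {y | f x y ≤ 0 ∧ g x y ≤ 0}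
    · rw [indicator_of_mem hy]; simp
    · rw [indicator_of_notMem hy]; simp
  · exact integrable_const _
  · have n1 : ∀ᵐ y ∂μ, f x0 y ≠ 0 := by rw [ae_iff]; simpa using nf x0
    have n2 : ∀ᵐ y ∂μ, g x0 y ≠ 0 := by rw [ae_iff]; simpa using ng x0
    filter_upwards [n1, n2] with y h1 h2
    by_cases hy : f x0 y < 0 ∧ g x0 y < 0
    · have e1 : ∀ᶠ x in 𝓝 x0, f x y < 0 := (hf y).continuousAt.eventually_lt continuousAt_const hy.1
      have e2 : ∀ᶠ x in 𝓝 x0, g x y < 0 := (hg y).continuousAt.eventually_lt continuousAt_const hy.2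
      apply ContinuousAt.congr (f := fun _ => (1:ℝ)) continuousAt_const
      filter_upwards [e1, e2] with x h1 h2
      rw [indicator_of_mem]; exact ⟨h1.le, h2.le⟩
    · have : 0 < f x0 y ∨ 0 < g x0 y := by
        by_contra hc
        push Not at hc
        exact hy ⟨lt_of_le_of_ne hc.1 h1, lt_of_le_of_ne hc.2 h2⟩
      apply ContinuousAt.congr (f := fun _ => (0:ℝ)) continuousAt_const
      rcases this with h | h
      · filter_upwards [continuousAt_const.eventually_lt (hf y).continuousAt h] with x hx
        rw [indicator_of_notMem]; intro hc; exact absurd hc.1 (not_le.2 hx)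
      · filter_upwards [continuousAt_const.eventually_lt (hg y).continuousAt h] with x hx
        rw [indicator_of_notMem]; intro hc; exact absurd hc.2 (not_le.2 hx)

lemma implicit_cont {X : Type*} [TopologicalSpace X] (G : X → ℝ → ℝ) (c : ℝ)
    (hG : ∀ y, Continuous (fun x => G x y)) (mono : ∀ x, StrictMono (G x)) (z : X → ℝ)
    (hz : ∀ x, G x (z x) = c) : Continuous z := by
  rw [continuous_iff_continuousAt]
  intro x0
  rw [ContinuousAt, tendsto_order]
  constructor
  · intro y hy
    have h1 : G x0 y < c := by rw [← hz x0]; exact mono x0 hy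
    filter_upwards [(hG y).continuousAt.eventually_lt continuousAt_const h1] with x hx
    rw [← hz x] at hx
    exact (mono x).lt_iff_lt.1 hx
  · intro y hy
    have h1 : c < G x0 y := by rw [← hz x0]; exact mono x0 hy
    filter_upwards [continuousAt_const.eventually_lt (hG y).continuousAt h1] with x hx
    rw [← hz x] at hx
    exact (mono x).lt_iff_lt.1 hx

lemma real_lt (h : Good μ) {A B U : Set (Euc 2)} (hAB : A ⊆ B)
    (hU : IsOpen U) (hn : U.Nonempty) (hUB : U ⊆ B) (hd : ∀ x ∈ U, x ∉ A) :
    μ.real A < μ.real B := by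
  have := h.prob
  have h1 : μ.real (A ∪ U) = μ.real A + μ.real U :=
    measureReal_union (Set.disjoint_left.2 fun x hx hu => hd x hu hx) hU.measurableSet
  have h2 : 0 < μ.real U := by
    rw [measureReal_def]; exact ENNReal.toReal_pos (h.pos U hU hn).ne' (measure_ne_top _ _)
  have h3 : μ.real (A ∪ U) ≤ μ.real B := measureReal_mono (union_subset hAB hUB)
  linarith

lemma lim_top (h : Good μ) (A : Set (Euc 2)) (f : Euc 2 → ℝ) (r : ℝ)
    (hr : r < μ.real A) : ∃ K : ℝ, ∀ k ≥ K, r < μ.real (A ∩ {x | f x ≤ k}) := by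
  have := h.prob
  have hm : Monotone (fun k : ℝ => A ∩ {x | f x ≤ k}) := fun k l hkl x hx =>
    ⟨hx.1, le_trans hx.2 hkl⟩
  have ht := tendsto_measure_iUnion_atTop (μ := μ) hm
  have hU : (⋃ k : ℝ, A ∩ {x | f x ≤ k}) = A := by
    ext x; simp only [mem_iUnion, mem_inter_iff, mem_ofPred_eq]
    exact ⟨fun ⟨_, h⟩ => h.1, fun h => ⟨f x, h, le_rfl⟩⟩
  rw [hU] at ht
  have ht' := (ENNReal.tendsto_toReal (measure_ne_top μ A)).comp ht
  have := ht'.eventually (lt_mem_nhds hr)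
  obtain ⟨K, hK⟩ := eventually_atTop.1 this
  exact ⟨K, hK⟩

lemma lim_bot (h : Good μ) (A : Set (Euc 2)) (hA : MeasurableSet A) (f : Euc 2 → ℝ)
    (hf : Continuous f) (r : ℝ)
    (hr : 0 < r) : ∃ K : ℝ, ∀ k ≤ K, μ.real (A ∩ {x | f x ≤ k}) < r := by
  have := h.prob
  have hm : Monotone (fun k : ℝ => A ∩ {x | f x ≤ k}) := fun k l hkl x hx =>
    ⟨hx.1, le_trans hx.2 hkl⟩
  have ht := tendsto_measure_iInter_atBot (μ := μ) (s := fun k : ℝ => A ∩ {x | f x ≤ k})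
    (fun k => (hA.inter (isClosed_le hf continuous_const).measurableSet).nullMeasurableSet) hm
    ⟨0, measure_ne_top _ _⟩
  have hU : (⋂ k : ℝ, A ∩ {x | f x ≤ k}) = ∅ := by
    ext x; simp only [mem_iInter, mem_inter_iff, mem_ofPred_eq, mem_empty_iff_false, iff_false]
    intro h
    have := (h (f x - 1)).2
    linarith
  rw [hU, measure_empty] at ht
  have ht' := (ENNReal.tendsto_toReal ENNReal.zero_ne_top).comp ht
  have := ht'.eventually (gt_mem_nhds (by simpa using hr))
  obtain ⟨K, hK⟩ := eventually_atBot.1 this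
  exact ⟨K, hK⟩

lemma compl_meas (h : Good μ) (f g : Euc 2 → ℝ) (hf : Continuous f) (hg : Continuous g)
    (nf : μ {y | f y = 0} = 0) (ng : μ {y | g y = 0} = 0) :
    μ.real {y | 0 ≤ f y ∧ 0 ≤ g y} =
      1 - μ.real {y | f y ≤ 0} - μ.real {y | g y ≤ 0} + μ.real {y | f y ≤ 0 ∧ g y ≤ 0} := by
  have := h.prob
  have n1 : ∀ᵐ y ∂μ, f y ≠ 0 := by rw [ae_iff]; simpa using nf
  have n2 : ∀ᵐ y ∂μ, g y ≠ 0 := by rw [ae_iff]; simpa using ng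
  have mf : MeasurableSet {y | f y ≤ 0} := (isClosed_le hf continuous_const).measurableSet
  have mg : MeasurableSet {y | g y ≤ 0} := (isClosed_le hg continuous_const).measurableSet
  have h1 : μ.real {y | 0 ≤ f y ∧ 0 ≤ g y} = μ.real ({y | f y ≤ 0} ∪ {y | g y ≤ 0})ᶜ := by
    apply measureReal_congr
    filter_upwards [n1, n2] with y h1 h2
    apply propext
    change (0 ≤ f y ∧ 0 ≤ g y) ↔ ¬ (f y ≤ 0 ∨ g y ≤ 0)
    rw [not_or, not_le, not_le]
    exact ⟨fun h => ⟨lt_of_le_of_ne h.1 h1.symm, lt_of_le_of_ne h.2 h2.symm⟩,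
      fun h => ⟨h.1.le, h.2.le⟩⟩
  rw [h1, probReal_compl_eq_one_sub (mf.union mg)]
  have h2 := measureReal_union_add_inter (μ := μ) (s := {y | f y ≤ 0}) (t := {y | g y ≤ 0}) mg
  have h3 : {y | f y ≤ 0} ∩ {y | g y ≤ 0} = {y | f y ≤ 0 ∧ g y ≤ 0} := rfl
  rw [h3] at h2
  linarith

end

section
variable {μ : Measure (Euc 2)}

/-- Measure of a half plane. -/
def Mf (μ : Measure (Euc 2)) (θ c : ℝ) : ℝ := μ.real {x | S θ x ≤ c}
/-- Measure below the third line. -/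
def Nf (μ : Measure (Euc 2)) (θ p q : ℝ) : ℝ := μ.real {x | T θ x ≤ p + q * S θ x}
/-- Measure of the quadrant below the third line. -/
def Lf (μ : Measure (Euc 2)) (θ c p q : ℝ) : ℝ :=
  μ.real {x | S θ x ≤ c ∧ T θ x ≤ p + q * S θ x}

lemma comp_cont (X : Type*) [TopologicalSpace X] (θ : X → ℝ) (hθ : Continuous θ) (y : Euc 2) :
    Continuous (fun x => S (θ x) y) ∧ Continuous (fun x => T (θ x) y) :=
  ⟨(S_cont' y).comp hθ, (T_cont' y).comp hθ⟩

lemma Lf_cont (h : Good μ) {X : Type*} [TopologicalSpace X] [FirstCountableTopology X]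
    {θ c p q : X → ℝ} (hθ : Continuous θ) (hc : Continuous c) (hp : Continuous p)
    (hq : Continuous q) : Continuous (fun x => Lf μ (θ x) (c x) (p x) (q x)) := by
  have := cont_meas h (fun x y => S (θ x) y - c x)
    (fun x y => T (θ x) y - (p x + q x * S (θ x) y))
    (fun y => ((comp_cont X θ hθ y).1).sub hc)
    (fun x => (S_cont _).sub continuous_const)
    (fun y => ((comp_cont X θ hθ y).2).sub (hp.add (hq.mul (comp_cont X θ hθ y).1)))
    (fun x => (T_cont _).sub (continuous_const.add (continuous_const.mul (S_cont _))))
    (fun x => nullS h _ _) (fun x => nullT h _ _ _)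
  simpa only [sub_nonpos, Lf] using this

lemma Mf_cont (h : Good μ) {X : Type*} [TopologicalSpace X] [FirstCountableTopology X]
    {θ c : X → ℝ} (hθ : Continuous θ) (hc : Continuous c) :
    Continuous (fun x => Mf μ (θ x) (c x)) := by
  have := cont_meas h (fun x y => S (θ x) y - c x)
    (fun x y => S (θ x) y - c x)
    (fun y => ((comp_cont X θ hθ y).1).sub hc)
    (fun x => (S_cont _).sub continuous_const)
    (fun y => ((comp_cont X θ hθ y).1).sub hc)
    (fun x => (S_cont _).sub continuous_const)
    (fun x => nullS h _ _) (fun x => nullS h _ _)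
  simpa only [sub_nonpos, and_self, Mf] using this

lemma Nf_cont (h : Good μ) {X : Type*} [TopologicalSpace X] [FirstCountableTopology X]
    {θ p q : X → ℝ} (hθ : Continuous θ) (hp : Continuous p)
    (hq : Continuous q) : Continuous (fun x => Nf μ (θ x) (p x) (q x)) := by
  have := cont_meas h (fun x y => T (θ x) y - (p x + q x * S (θ x) y))
    (fun x y => T (θ x) y - (p x + q x * S (θ x) y))
    (fun y => ((comp_cont X θ hθ y).2).sub (hp.add (hq.mul (comp_cont X θ hθ y).1)))
    (fun x => (T_cont _).sub (continuous_const.add (continuous_const.mul (S_cont _))))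
    (fun y => ((comp_cont X θ hθ y).2).sub (hp.add (hq.mul (comp_cont X θ hθ y).1)))
    (fun x => (T_cont _).sub (continuous_const.add (continuous_const.mul (S_cont _))))
    (fun x => nullT h _ _ _) (fun x => nullT h _ _ _)
  simpa only [sub_nonpos, and_self, Nf] using this

lemma line_cont (θ p q : ℝ) : Continuous (fun x => p + q * S θ x) :=
  continuous_const.add (continuous_const.mul (S_cont _))

lemma Mf_pi (h : Good μ) (θ c : ℝ) : Mf μ (θ + Real.pi) (-c) = 1 - Mf μ θ c := by
  have := compl_meas h (fun y => S θ y - c) (fun y => S θ y - c)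
    ((S_cont _).sub continuous_const) ((S_cont _).sub continuous_const)
    (nullS h _ _) (nullS h _ _)
  simp only [sub_nonpos, and_self, sub_nonneg] at this
  simp only [Mf, S_pi, neg_le_neg_iff]
  linarith

lemma Nf_pi (h : Good μ) (θ p q : ℝ) : Nf μ (θ + Real.pi) (-p) q = 1 - Nf μ θ p q := by
  have := compl_meas h (fun y => T θ y - (p + q * S θ y)) (fun y => T θ y - (p + q * S θ y))
    ((T_cont _).sub (line_cont _ _ _)) ((T_cont _).sub (line_cont _ _ _))
    (nullT h _ _ _) (nullT h _ _ _)
  simp only [sub_nonpos, and_self, sub_nonneg] at this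
  have e : ∀ x, (T (θ + Real.pi) x ≤ -p + q * S (θ + Real.pi) x) ↔ p + q * S θ x ≤ T θ x := by
    intro x
    rw [S_pi, T_pi]
    constructor <;> intro h <;> linarith
  simp only [Nf, e]
  linarith

lemma Lf_pi (h : Good μ) (θ c p q : ℝ) : Lf μ (θ + Real.pi) (-c) (-p) q =
    1 - Mf μ θ c - Nf μ θ p q + Lf μ θ c p q := by
  have := compl_meas h (fun y => S θ y - c) (fun y => T θ y - (p + q * S θ y))
    ((S_cont _).sub continuous_const) ((T_cont _).sub (line_cont _ _ _))
    (nullS h _ _) (nullT h _ _ _)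
  simp only [sub_nonpos, sub_nonneg] at this
  have e : ∀ x, (T (θ + Real.pi) x ≤ -p + q * S (θ + Real.pi) x) ↔ p + q * S θ x ≤ T θ x := by
    intro x
    rw [S_pi, T_pi]
    constructor <;> intro h <;> linarith
  simp only [Lf, e]
  simp only [S_pi, neg_le_neg_iff]
  exact this

lemma Mf_mono (h : Good μ) (θ : ℝ) : StrictMono (Mf μ θ) := by
  intro c d hcd
  apply real_lt h (U := {x | c < S θ x ∧ S θ x < d})
  · intro x hx; exact le_trans hx hcd.le
  · exact (isOpen_lt continuous_const (S_cont θ)).inter (isOpen_lt (S_cont θ) continuous_const)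
  · exact ⟨P θ ((c + d) / 2) 0, by
      change _ < _ ∧ _ < _
      rw [S_P]; constructor <;> linarith⟩
  · intro x hx; exact hx.2.le
  · intro x hx hc; exact absurd hc (not_le.2 hx.1)

lemma Lf_mono (h : Good μ) (θ c q : ℝ) : StrictMono (fun p => Lf μ θ c p q) := by
  intro p p' hp
  apply real_lt h (U := {x | S θ x < c ∧ p + q * S θ x < T θ x ∧ T θ x < p' + q * S θ x})
  · intro x hx; exact ⟨hx.1, by have := hx.2; linarith⟩
  · exact (isOpen_lt (S_cont θ) continuous_const).inter
      ((isOpen_lt (line_cont _ _ _) (T_cont θ)).inter (isOpen_lt (T_cont θ) (line_cont _ _ _)))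
  · exact ⟨P θ (c - 1) ((p + p') / 2 + q * (c - 1)), by
      change _ < _ ∧ _ < _ ∧ _ < _
      rw [S_P, T_P]; refine ⟨?_, ?_, ?_⟩ <;> linarith⟩
  · intro x hx; exact ⟨hx.1.le, hx.2.2.le⟩
  · intro x hx hc; exact absurd hc.2 (not_le.2 hx.2.1)

lemma Rf_eq (h : Good μ) (θ c p q : ℝ) : Nf μ θ p q - Lf μ θ c p q =
    μ.real {x | c < S θ x ∧ T θ x ≤ p + q * S θ x} := by
  have := h.prob
  have h1 := measureReal_inter_add_sdiff (μ := μ) (s := {x | T θ x ≤ p + q * S θ x})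
    (t := {x | S θ x ≤ c}) (isClosed_le (S_cont θ) continuous_const).measurableSet
  have h2 : {x | T θ x ≤ p + q * S θ x} ∩ {x | S θ x ≤ c} =
    {x | S θ x ≤ c ∧ T θ x ≤ p + q * S θ x} := by rw [inter_comm]; rfl
  have h3 : {x | T θ x ≤ p + q * S θ x} \ {x | S θ x ≤ c} =
    {x | c < S θ x ∧ T θ x ≤ p + q * S θ x} := by
    ext x
    change (_ ∧ ¬ _) ↔ (_ ∧ _)
    rw [and_comm]
    exact and_congr_left' (not_le (a := S θ x) (b := c))
  rw [h2, h3] at h1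
  unfold Nf Lf
  linarith

lemma Rf_mono (h : Good μ) {θ a b p q p' q' r : ℝ} (hab : a < b)
    (h1 : Lf μ θ a p q = r) (h2 : Lf μ θ a p' q' = r) (hq : q < q') :
    Nf μ θ p q - Lf μ θ b p q < Nf μ θ p' q' - Lf μ θ b p' q' := by
  have := h.prob
  have key : p + q * a < p' + q' * a := by
    by_contra hc
    push Not at hc
    have hlt : Lf μ θ a p' q' < Lf μ θ a p q := by
      apply real_lt h (U := {x | S θ x < a ∧ p' + q' * S θ x < T θ x ∧ T θ x < p + q * S θ x})
      · intro x hx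
        refine ⟨hx.1, ?_⟩
        have h1 := hx.2
        have h2 := hx.1
        nlinarith
      · exact (isOpen_lt (S_cont θ) continuous_const).inter
          ((isOpen_lt (line_cont _ _ _) (T_cont θ)).inter (isOpen_lt (T_cont θ) (line_cont _ _ _)))
      · exact ⟨P θ (a - 1) ((p + q * (a - 1) + (p' + q' * (a - 1))) / 2), by
          change _ < _ ∧ _ < _ ∧ _ < _
          rw [S_P, T_P]; refine ⟨?_, ?_, ?_⟩ <;> linarith⟩
      · intro x hx; exact ⟨hx.1.le, hx.2.2.le⟩
      · intro x hx hc; exact absurd hc.2 (not_le.2 hx.2.1)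
    linarith
  rw [Rf_eq h, Rf_eq h]
  apply real_lt h (U := {x | b < S θ x ∧ p + q * S θ x < T θ x ∧ T θ x < p' + q' * S θ x})
  · intro x hx
    refine ⟨hx.1, ?_⟩
    have h1 := hx.2
    have h2 := hx.1
    nlinarith
  · exact (isOpen_lt continuous_const (S_cont θ)).inter
      ((isOpen_lt (line_cont _ _ _) (T_cont θ)).inter (isOpen_lt (T_cont θ) (line_cont _ _ _)))
  · exact ⟨P θ (b + 1) ((p + q * (b + 1) + (p' + q' * (b + 1))) / 2), by
      change _ < _ ∧ _ < _ ∧ _ < _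
      rw [S_P, T_P]; refine ⟨?_, ?_, ?_⟩ <;> nlinarith⟩
  · intro x hx; exact ⟨hx.1, hx.2.2.le⟩
  · intro x hx hc; exact absurd hc.2 (not_le.2 hx.2.1)

lemma Mf_ex (h : Good μ) (θ r : ℝ) (h0 : 0 < r) (h1 : r < 1) : ∃ c, Mf μ θ c = r := by
  have := h.prob
  have hc : Continuous (Mf μ θ) := Mf_cont h (θ := fun _ => θ) continuous_const continuous_id
  obtain ⟨K, hK⟩ := lim_top h univ (S θ) r (by simpa using h1)
  obtain ⟨K', hK'⟩ := lim_bot h univ MeasurableSet.univ (S θ) (S_cont θ) r h0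
  have hK := hK K le_rfl
  have hK' := hK' K' le_rfl
  rw [univ_inter] at hK hK'
  exact mem_range_of_exists_le_of_exists_ge hc ⟨K', hK'.le⟩ ⟨K, hK.le⟩

lemma Lf_ex (h : Good μ) (θ a q r : ℝ) (h0 : 0 < r) (h1 : r < Mf μ θ a) :
    ∃ p, Lf μ θ a p q = r := by
  have := h.prob
  have hc : Continuous (fun p => Lf μ θ a p q) :=
    Lf_cont h (θ := fun _ => θ) (c := fun _ => a) (q := fun _ => q)
      continuous_const continuous_const continuous_id continuous_const
  have hA : MeasurableSet {x | S θ x ≤ a} := (isClosed_le (S_cont θ) continuous_const).measurableSet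
  obtain ⟨K, hK⟩ := lim_top h {x | S θ x ≤ a} (fun x => T θ x - q * S θ x) r h1
  obtain ⟨K', hK'⟩ := lim_bot h {x | S θ x ≤ a} hA (fun x => T θ x - q * S θ x)
    ((T_cont θ).sub (continuous_const.mul (S_cont _))) r h0
  have hK := hK K le_rfl
  have hK' := hK' K' le_rfl
  have e : ∀ k, μ.real ({x | S θ x ≤ a} ∩ {x | T θ x - q * S θ x ≤ k}) = Lf μ θ a k q := by
    intro k
    unfold Lf
    congr 1
    ext x
    change (_ ∧ _) ↔ (_ ∧ _)
    exact and_congr_right' (sub_le_iff_le_add (a := T θ x))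
  rw [e] at hK hK'
  exact mem_range_of_exists_le_of_exists_ge hc ⟨K', hK'.le⟩ ⟨K, hK.le⟩

lemma Rex (h : Good μ) {θ a b : ℝ} (hab : a < b) (ha : Mf μ θ a = 1/3) (hb : Mf μ θ b = 2/3)
    (p : ℝ → ℝ) (hp : ∀ q, Lf μ θ a (p q) q = 1/6)
    (hc : Continuous fun q => Nf μ θ (p q) q - Lf μ θ b (p q) q) :
    ∃ q, Nf μ θ (p q) q - Lf μ θ b (p q) q = 1/6 := by
  have := h.prob
  have hA : MeasurableSet {x | S θ x ≤ a} :=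
    (isClosed_le (S_cont θ) continuous_const).measurableSet
  have hC : MeasurableSet {x | b < S θ x} :=
    (isOpen_lt continuous_const (S_cont θ)).measurableSet
  have hCm : μ.real {x | b < S θ x} = 1/3 := by
    have h1 : {x | b < S θ x} = {x | S θ x ≤ b}ᶜ := by
      ext x; exact (not_le (a := S θ x) (b := b)).symm
    rw [h1, probReal_compl_eq_one_sub
      (isClosed_le (S_cont θ) continuous_const).measurableSet]
    have := hb
    unfold Mf at this
    rw [this]; norm_num
  have hAm : μ.real {x | S θ x ≤ a} = 1/3 := ha
  have hd : 0 < b - a := sub_pos.2 (hab)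
  apply mem_range_of_exists_le_of_exists_ge hc
  · obtain ⟨M, hM⟩ := lim_top h {x | S θ x ≤ a} (T θ) (1/6) (by rw [hAm]; norm_num)
    obtain ⟨K, hK⟩ := lim_bot h {x | b < S θ x} hC (T θ) (T_cont θ) (1/6) (by norm_num)
    obtain ⟨q, hq⟩ : ∃ q, q = -((max M K - K) / (b - a)) := ⟨_, rfl⟩
    have hq0 : q ≤ 0 := by
      rw [hq, neg_nonpos]; exact div_nonneg (sub_nonneg.2 (le_max_right _ _)) hd.le
    have hqd : q * (b - a) = K - max M K := by
      rw [hq]; field_simp; ring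
    have hpM : p q + q * a < max M K := by
      by_contra hcon
      push Not at hcon
      have h1 := hM (max M K) (le_max_left _ _)
      have h2 : μ.real ({x | S θ x ≤ a} ∩ {x | T θ x ≤ max M K}) ≤ Lf μ θ (a) (p q) q := by
        refine measureReal_mono ?_ (measure_ne_top _ _)
        intro x hx
        refine ⟨hx.1, ?_⟩
        have h1 : S θ x ≤ a := hx.1
        have h2 : T θ x ≤ max M K := hx.2
        nlinarith
      have h3 := hp q
      linarith
    refine ⟨q, ?_⟩
    change Nf μ θ (p q) q - Lf μ θ (b) (p q) q ≤ 1/6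
    rw [Rf_eq h]
    refine le_trans (measureReal_mono ?_) (hK K le_rfl).le
    intro x hx
    refine ⟨hx.1, ?_⟩
    have h1 : b < S θ x := hx.1
    have h2 : T θ x ≤ _ := hx.2
    change T θ x ≤ K
    nlinarith
  · obtain ⟨M, hM⟩ := lim_bot h {x | S θ x ≤ a} hA (T θ) (T_cont θ) (1/6) (by norm_num)
    obtain ⟨K, hK⟩ := lim_top h {x | b < S θ x} (T θ) (1/6) (by rw [hCm]; norm_num)
    obtain ⟨q, hq⟩ : ∃ q, q = (max K M - M) / (b - a) := ⟨_, rfl⟩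
    have hq0 : 0 ≤ q := by
      rw [hq]; exact div_nonneg (sub_nonneg.2 (le_max_right _ _)) hd.le
    have hqd : q * (b - a) = max K M - M := by
      rw [hq]; field_simp
    have hpM : M < p q + q * a := by
      by_contra hcon
      push Not at hcon
      have h1 := hM M le_rfl
      have h2 : Lf μ θ (a) (p q) q ≤ μ.real ({x | S θ x ≤ a} ∩ {x | T θ x ≤ M}) := by
        refine measureReal_mono ?_ (measure_ne_top _ _)
        intro x hx
        refine ⟨hx.1, ?_⟩
        have h1 : S θ x ≤ a := hx.1
        have h2 : T θ x ≤ _ := hx.2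
        change T θ x ≤ M
        nlinarith
      have h3 := hp q
      linarith
    refine ⟨q, ?_⟩
    change 1/6 ≤ Nf μ θ (p q) q - Lf μ θ (b) (p q) q
    rw [Rf_eq h]
    refine le_trans (hK (max K M) (le_max_left _ _)).le (measureReal_mono ?_)
    intro x hx
    refine ⟨hx.1, ?_⟩
    have h1 : b < S θ x := hx.1
    have h2 : T θ x ≤ max K M := hx.2
    nlinarith

theorem exists_params (h : Good μ) : ∃ θ a b p q, a < b ∧ Mf μ θ a = 1/3 ∧ Mf μ θ b = 2/3 ∧
    Lf μ θ a p q = 1/6 ∧ Lf μ θ b p q = 1/3 ∧ Nf μ θ p q = 1/2 := by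
  have := h.prob
  have Aex : ∀ θ : ℝ, ∃ c, Mf μ θ c = 1/3 :=
    fun θ => Mf_ex h θ (1/3) (by norm_num) (by norm_num)
  have Bex : ∀ θ : ℝ, ∃ c, Mf μ θ c = 2/3 :=
    fun θ => Mf_ex h θ (2/3) (by norm_num) (by norm_num)
  choose a ha using Aex
  choose b hb using Bex
  have hab : ∀ θ, a θ < b θ := fun θ => by
    rw [← (Mf_mono h θ).lt_iff_lt, ha, hb]; norm_num
  have ac : Continuous a := implicit_cont (fun θ c => Mf μ θ c) _
    (fun y => Mf_cont h (X := ℝ) (θ := fun x => x) (c := fun _ => y) continuous_id continuous_const) (fun θ => Mf_mono h θ) a ha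
  have bc : Continuous b := implicit_cont (fun θ c => Mf μ θ c) _
    (fun y => Mf_cont h (X := ℝ) (θ := fun x => x) (c := fun _ => y) continuous_id continuous_const) (fun θ => Mf_mono h θ) b hb
  have Pex : ∀ z : ℝ × ℝ, ∃ p, Lf μ z.1 (a z.1) p z.2 = 1/6 :=
    fun z => Lf_ex h z.1 (a z.1) z.2 (1/6) (by norm_num) (by rw [ha]; norm_num)
  choose p hp using Pex
  have pc1 : ∀ y, Continuous (fun z : ℝ × ℝ => Lf μ z.1 (a z.1) y z.2) := fun y =>
    Lf_cont h (X := ℝ × ℝ) (θ := fun z => z.1) (c := fun z => a z.1) (p := fun _ => y)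
      (q := fun z => z.2) continuous_fst (ac.comp continuous_fst) continuous_const continuous_snd
  have pc : Continuous p := implicit_cont (X := ℝ × ℝ) (fun z p => Lf μ z.1 (a z.1) p z.2) (1/6)
    pc1 (fun z => Lf_mono h z.1 (a z.1) z.2) p hp
  let R : ℝ → ℝ → ℝ := fun θ q => Nf μ θ (p (θ, q)) q - Lf μ θ (b θ) (p (θ, q)) q
  have Rc : Continuous (fun z : ℝ × ℝ => R z.1 z.2) := by
    apply Continuous.sub
    · exact Nf_cont h (X := ℝ × ℝ) (θ := fun z => z.1) (p := p) (q := fun z => z.2)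
        continuous_fst pc continuous_snd
    · exact Lf_cont h (X := ℝ × ℝ) (θ := fun z => z.1) (c := fun z => b z.1) (p := p)
        (q := fun z => z.2) continuous_fst (bc.comp continuous_fst) pc continuous_snd
  have Rm : ∀ θ, StrictMono (R θ) := by
    intro θ q q' hq
    have h1 : Lf μ θ (a θ) (p (θ, q)) q = 1/6 := hp (θ, q)
    have h2 : Lf μ θ (a θ) (p (θ, q')) q' = 1/6 := hp (θ, q')
    have h3 := Rf_mono h (hab θ) h1 h2 hq
    simp only [R]
    exact h3
  have Rex : ∀ θ, ∃ q, R θ q = 1/6 := by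
    intro θ
    have h1 : ∀ q, Lf μ θ (a θ) (p (θ, q)) q = 1/6 := fun q => hp (θ, q)
    have h2 : Continuous (fun q => R θ q) := 
      Continuous.comp (g := fun z : ℝ × ℝ => R z.1 z.2) (f := fun q : ℝ => (θ, q)) Rc (by fun_prop)
    simp only [R] at h2 ⊢
    exact Rex h (hab θ) (ha θ) (hb θ) (fun q => p (θ, q)) h1 h2
  choose q hq using Rex
  have qc : Continuous q := implicit_cont R _
    (fun y => Continuous.comp (g := fun z : ℝ × ℝ => R z.1 z.2) (f := fun x : ℝ => (x, y)) Rc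
      (by fun_prop)) Rm q hq
  have Fc : Continuous (fun θ => Nf μ θ (p (θ, q θ)) (q θ)) :=
    Nf_cont h (θ := fun θ => θ) (p := fun θ => p (θ, q θ)) continuous_id (pc.comp (continuous_id.prodMk qc)) qc
  have api : a (0 + Real.pi) = - b 0 := by
    apply (Mf_mono h (0 + Real.pi)).injective
    rw [ha, Mf_pi h, hb]; norm_num
  have bpi : b (0 + Real.pi) = - a 0 := by
    apply (Mf_mono h (0 + Real.pi)).injective
    rw [hb, Mf_pi h, ha]; norm_num
  have hp0 := hp (0, q 0)
  have hq0 : Nf μ 0 (p (0, q 0)) (q 0) - Lf μ 0 (b 0) (p (0, q 0)) (q 0) = 1/6 := hq 0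
  simp only at hp0
  have ppi : p (0 + Real.pi, q 0) = - p (0, q 0) := by
    apply (Lf_mono h (0 + Real.pi) (a (0 + Real.pi)) (q 0)).injective
    have := hp (0 + Real.pi, q 0)
    simp only at this ⊢
    rw [this, api, Lf_pi h, hb]
    linarith
  have qpi : q (0 + Real.pi) = q 0 := by
    apply (Rm (0 + Real.pi)).injective
    rw [hq]
    change _ = Nf μ (0 + Real.pi) (p (0 + Real.pi, q 0)) (q 0) -
      Lf μ (0 + Real.pi) (b (0 + Real.pi)) (p (0 + Real.pi, q 0)) (q 0)
    rw [ppi, bpi, Nf_pi h, Lf_pi h, ha]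
    linarith
  have Fpi : Nf μ (0 + Real.pi) (p (0 + Real.pi, q (0 + Real.pi))) (q (0 + Real.pi)) =
      1 - Nf μ 0 (p (0, q 0)) (q 0) := by
    rw [qpi, ppi, Nf_pi h]
  obtain ⟨θ, hθ⟩ : ∃ θ, Nf μ θ (p (θ, q θ)) (q θ) = 1/2 := by
    apply mem_range_of_exists_le_of_exists_ge Fc
    · rcases le_total (Nf μ 0 (p (0, q 0)) (q 0)) (1/2) with h | h
      · exact ⟨0, h⟩
      · exact ⟨0 + Real.pi, by rw [Fpi]; linarith⟩
    · rcases le_total (Nf μ 0 (p (0, q 0)) (q 0)) (1/2) with h | h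
      · exact ⟨0 + Real.pi, by rw [Fpi]; linarith⟩
      · exact ⟨0, h⟩
  refine ⟨θ, a θ, b θ, p (θ, q θ), q θ, hab θ, ha θ, hb θ, hp (θ, q θ), ?_, hθ⟩
  have : Nf μ θ (p (θ, q θ)) (q θ) - Lf μ θ (b θ) (p (θ, q θ)) (q θ) = 1/6 := hq θ
  linarith

end

section
variable {μ : Measure (Euc 2)}

/-- Strips. -/
def I6 (a b : ℝ) : Fin 6 → Set ℝ := ![Iio a, Iio a, Ioo a b, Ioo a b, Ioi b, Ioi b]
/-- Sides. -/
def J6 : Fin 6 → Set ℝ := ![Ioi 0, Iio 0, Ioi 0, Iio 0, Ioi 0, Iio 0]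
/-- Sample strip coordinates. -/
def s6 (a b : ℝ) : Fin 6 → ℝ := ![a - 1, a - 1, (a + b) / 2, (a + b) / 2, b + 1, b + 1]
/-- Sample side coordinates. -/
def d6 : Fin 6 → ℝ := ![1, -1, 1, -1, 1, -1]
/-- Signed height above the third line. -/
def D (θ p q : ℝ) (x : Euc 2) : ℝ := T θ x - (p + q * S θ x)
/-- The six open regions. -/
def Reg (θ a b p q : ℝ) (i : Fin 6) : Set (Euc 2) := {x | S θ x ∈ I6 a b i ∧ D θ p q x ∈ J6 i}
/-- Sample points. -/
def pt (θ a b p q : ℝ) (i : Fin 6) : Euc 2 := P θ (s6 a b i) (p + q * s6 a b i + d6 i)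
/-- Normal of parallel lines. -/
def vv (θ : ℝ) : Euc 2 := !₂[Real.cos θ, Real.sin θ]
/-- Normal of the third line. -/
def ww (θ q : ℝ) : Euc 2 :=
  !₂[-Real.sin θ - q * Real.cos θ, Real.cos θ - q * Real.sin θ]
/-- Complement of the three lines. -/
def Cm (θ a b p q : ℝ) : Set (Euc 2) :=
  (Hyperplane (vv θ) a ∪ Hyperplane (vv θ) b ∪ Hyperplane (ww θ q) p)ᶜ

lemma mem_reg {θ a b p q : ℝ} {i : Fin 6} {x : Euc 2} :
    x ∈ Reg θ a b p q i ↔ S θ x ∈ I6 a b i ∧ D θ p q x ∈ J6 i := Iff.rfl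

lemma mem_vv (θ c : ℝ) (x : Euc 2) : x ∈ Hyperplane (vv θ) c ↔ S θ x = c := by
  change inner ℝ (vv θ) x = c ↔ _
  simp [vv, S, PiLp.inner_apply, Fin.sum_univ_two, mul_comm]

lemma mem_ww (θ p q : ℝ) (x : Euc 2) : x ∈ Hyperplane (ww θ q) p ↔ D θ p q x = 0 := by
  change inner ℝ (ww θ q) x = p ↔ _
  simp only [ww, D, S, T, PiLp.inner_apply, Fin.sum_univ_two]
  simp
  constructor <;> intro h <;> linear_combination h

lemma mem_Cm (θ a b p q : ℝ) (x : Euc 2) :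
    x ∈ Cm θ a b p q ↔ S θ x ≠ a ∧ S θ x ≠ b ∧ D θ p q x ≠ 0 := by
  change ¬ ((_ ∨ _) ∨ _) ↔ _
  rw [mem_vv, mem_vv, mem_ww]
  tauto

lemma D_cont (θ p q : ℝ) : Continuous (D θ p q) := (T_cont θ).sub (line_cont θ p q)

lemma I6_open (a b : ℝ) (i : Fin 6) : IsOpen (I6 a b i) := by
  fin_cases i <;> simp [I6, isOpen_Iio, isOpen_Ioo, isOpen_Ioi]
lemma J6_open (i : Fin 6) : IsOpen (J6 i) := by
  fin_cases i <;> simp [J6, isOpen_Iio, isOpen_Ioi]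
lemma I6_conv (a b : ℝ) (i : Fin 6) : Convex ℝ (I6 a b i) := by
  fin_cases i <;> simp [I6, convex_Iio, convex_Ioo, convex_Ioi]
lemma J6_conv (i : Fin 6) : Convex ℝ (J6 i) := by
  fin_cases i <;> simp [J6, convex_Iio, convex_Ioi]

lemma I6_ne {a b s : ℝ} (hab : a < b) {i : Fin 6} (h : s ∈ I6 a b i) : s ≠ a ∧ s ≠ b := by
  fin_cases i <;> simp [I6] at h <;> constructor <;> intro h' <;> linarith
lemma J6_ne {s : ℝ} {i : Fin 6} (h : s ∈ J6 i) : s ≠ 0 := by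
  fin_cases i <;> simp [J6] at h <;> intro h' <;> linarith

lemma IJ_disj {a b s d : ℝ} (hab : a < b) {i j : Fin 6} (h1 : s ∈ I6 a b i) (h2 : s ∈ I6 a b j)
    (h3 : d ∈ J6 i) (h4 : d ∈ J6 j) : i = j := by
  fin_cases i <;> fin_cases j <;> first | rfl | (exfalso; simp [I6, J6] at h1 h2 h3 h4; linarith)

lemma IJ_cover {a b s d : ℝ} (h1 : s ≠ a) (h2 : s ≠ b) (h3 : d ≠ 0) :
    ∃ i, s ∈ I6 a b i ∧ d ∈ J6 i := by
  rcases lt_or_gt_of_ne h3 with h3 | h3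
  · rcases lt_or_gt_of_ne h1 with h1 | h1
    · exact ⟨1, h1, h3⟩
    · rcases lt_or_gt_of_ne h2 with h2 | h2
      · exact ⟨3, ⟨h1, h2⟩, h3⟩
      · exact ⟨5, h2, h3⟩
  · rcases lt_or_gt_of_ne h1 with h1 | h1
    · exact ⟨0, h1, h3⟩
    · rcases lt_or_gt_of_ne h2 with h2 | h2
      · exact ⟨2, ⟨h1, h2⟩, h3⟩
      · exact ⟨4, h2, h3⟩

lemma I6_stay {a b : ℝ} {K : Set ℝ} (hK : IsPreconnected K) (ha : a ∉ K) (hb : b ∉ K)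
    {s t : ℝ} (hs : s ∈ K) (ht : t ∈ K) {i : Fin 6} (h : s ∈ I6 a b i) : t ∈ I6 a b i := by
  have ho := hK.ordConnected
  have o1 := ho.out hs ht
  have o2 := ho.out ht hs
  have a1 : ¬ (s ≤ a ∧ a ≤ t) := fun hh => ha (o1 hh)
  have a2 : ¬ (t ≤ a ∧ a ≤ s) := fun hh => ha (o2 hh)
  have b1 : ¬ (s ≤ b ∧ b ≤ t) := fun hh => hb (o1 hh)
  have b2 : ¬ (t ≤ b ∧ b ≤ s) := fun hh => hb (o2 hh)
  fin_cases i <;> simp [I6] at h ⊢ <;> grind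

lemma J6_stay {K : Set ℝ} (hK : IsPreconnected K) (ha : (0:ℝ) ∉ K)
    {s t : ℝ} (hs : s ∈ K) (ht : t ∈ K) {i : Fin 6} (h : s ∈ J6 i) : t ∈ J6 i := by
  have ho := hK.ordConnected
  have o1 := ho.out hs ht
  have o2 := ho.out ht hs
  have a1 : ¬ (s ≤ 0 ∧ 0 ≤ t) := fun hh => ha (o1 hh)
  have a2 : ¬ (t ≤ 0 ∧ 0 ≤ s) := fun hh => ha (o2 hh)
  fin_cases i <;> simp [J6] at h ⊢ <;> grind

lemma reg_open (θ a b p q : ℝ) (i : Fin 6) : IsOpen (Reg θ a b p q i) :=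
  ((I6_open a b i).preimage (S_cont θ)).inter ((J6_open i).preimage (D_cont θ p q))

lemma reg_conv (θ a b p q : ℝ) (i : Fin 6) : Convex ℝ (Reg θ a b p q i) := by
  intro x hx y hy α β hα hβ hαβ
  have e1 : S θ (α • x + β • y) = α • S θ x + β • S θ y := by
    simp [S]; ring
  have e2 : D θ p q (α • x + β • y) = α • D θ p q x + β • D θ p q y := by
    simp [D, S, T]; linear_combination p * hαβ
  rw [mem_reg, e1, e2]
  exact ⟨I6_conv a b i hx.1 hy.1 hα hβ hαβ, J6_conv i hx.2 hy.2 hα hβ hαβ⟩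

lemma pt_mem {θ a b p q : ℝ} (hab : a < b) (i : Fin 6) : pt θ a b p q i ∈ Reg θ a b p q i := by
  rw [mem_reg]
  have e : D θ p q (pt θ a b p q i) = d6 i := by
    rw [D, pt, S_P, T_P]; ring
  rw [e, pt, S_P]
  constructor
  · fin_cases i <;> simp [I6, s6] <;> (try constructor) <;> linarith
  · fin_cases i <;> simp [J6, d6]

lemma reg_sub {θ a b p q : ℝ} (hab : a < b) (i : Fin 6) : Reg θ a b p q i ⊆ Cm θ a b p q := by
  intro x hx
  rw [mem_Cm]
  exact ⟨(I6_ne hab hx.1).1, (I6_ne hab hx.1).2, J6_ne hx.2⟩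

lemma comp_eq {θ a b p q : ℝ} (hab : a < b) {i : Fin 6} {x : Euc 2} (hx : x ∈ Reg θ a b p q i) :
    connectedComponentIn (Cm θ a b p q) x = Reg θ a b p q i := by
  apply Subset.antisymm
  · intro y hy
    have hpre := isPreconnected_connectedComponentIn (F := Cm θ a b p q) (x := x)
    have hsub := connectedComponentIn_subset (Cm θ a b p q) x
    have hxm := mem_connectedComponentIn (reg_sub hab i hx)
    refine ⟨I6_stay (hpre.image (S θ) (S_cont θ).continuousOn) ?_ ?_
      (mem_image_of_mem _ hxm) (mem_image_of_mem _ hy) hx.1,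
      J6_stay (hpre.image (D θ p q) (D_cont θ p q).continuousOn) ?_
      (mem_image_of_mem _ hxm) (mem_image_of_mem _ hy) hx.2⟩
    · rintro ⟨z, hz, h⟩; exact ((mem_Cm ..).1 (hsub hz)).1 h
    · rintro ⟨z, hz, h⟩; exact ((mem_Cm ..).1 (hsub hz)).2.1 h
    · rintro ⟨z, hz, h⟩; exact ((mem_Cm ..).1 (hsub hz)).2.2 h
  · exact (reg_conv θ a b p q i).isPreconnected.subset_connectedComponentIn hx (reg_sub hab i)

lemma reg_disj {θ a b p q : ℝ} (hab : a < b) {i j : Fin 6} {x : Euc 2}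
    (h1 : x ∈ Reg θ a b p q i) (h2 : x ∈ Reg θ a b p q j) : i = j :=
  IJ_disj hab h1.1 h2.1 h1.2 h2.2

lemma reg_cover {θ a b p q : ℝ} {x : Euc 2} (h : x ∈ Cm θ a b p q) :
    ∃ i, x ∈ Reg θ a b p q i := by
  rw [mem_Cm] at h
  exact IJ_cover h.1 h.2.1 h.2.2

lemma int_closure {θ a b p q : ℝ} (hab : a < b) (i : Fin 6) :
    interior (closure (Reg θ a b p q i)) = Reg θ a b p q i := by
  have ho := reg_open θ a b p q i
  rw [(reg_conv θ a b p q i).interior_closure_eq_interior_of_nonempty_interior, ho.interior_eq]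
  rw [ho.interior_eq]
  exact ⟨_, pt_mem hab i⟩

lemma ae_Cm (h : Good μ) (θ a b p q : ℝ) : ∀ᵐ x ∂μ, x ∈ Cm θ a b p q := by
  have n1 : ∀ᵐ x ∂μ, S θ x - a ≠ 0 := by rw [ae_iff]; simpa using nullS h θ a
  have n2 : ∀ᵐ x ∂μ, S θ x - b ≠ 0 := by rw [ae_iff]; simpa using nullS h θ b
  have n3 : ∀ᵐ x ∂μ, D θ p q x ≠ 0 := by rw [ae_iff]; simpa [D] using nullT h θ p q
  filter_upwards [n1, n2, n3] with x h1 h2 h3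
  rw [mem_Cm]
  exact ⟨sub_ne_zero.1 h1, sub_ne_zero.1 h2, h3⟩

lemma meas_closure (h : Good μ) {θ a b p q : ℝ} (hab : a < b) (i : Fin 6) :
    μ (closure (Reg θ a b p q i)) = μ (Reg θ a b p q i) := by
  apply measure_congr
  filter_upwards [ae_Cm h θ a b p q] with x hx
  apply propext
  change x ∈ closure (Reg θ a b p q i) ↔ x ∈ Reg θ a b p q i
  constructor
  · intro hc
    obtain ⟨j, hj⟩ := reg_cover hx
    obtain ⟨y, hy1, hy2⟩ := mem_closure_iff.1 hc _ (reg_open θ a b p q j) hj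
    rw [reg_disj hab hy2 hy1]; exact hj
  · exact fun h => subset_closure h

lemma meas_sum (h : Good μ) {θ a b p q : ℝ} (hab : a < b) (A : Set (Euc 2)) (F : Finset (Fin 6))
    (hA : ∀ i, ∀ x ∈ Reg θ a b p q i, (x ∈ A ↔ i ∈ F)) :
    μ.real A = ∑ i ∈ F, μ.real (Reg θ a b p q i) := by
  have := h.prob
  rw [← measureReal_biUnion_finset]
  · apply measureReal_congr
    filter_upwards [ae_Cm h θ a b p q] with x hx
    apply propext
    change x ∈ A ↔ x ∈ ⋃ i ∈ F, Reg θ a b p q i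
    obtain ⟨j, hj⟩ := reg_cover hx
    rw [hA j x hj, mem_iUnion₂]
    constructor
    · intro hF; exact ⟨j, hF, hj⟩
    · rintro ⟨k, hk, hx⟩; rwa [reg_disj hab hj hx]
  · intro i _ j _ hij
    exact Set.disjoint_left.2 fun x hx hy => hij (reg_disj hab hx hy)
  · intro i _; exact (reg_open θ a b p q i).measurableSet

lemma meas_reg (h : Good μ) {θ a b p q : ℝ} (hab : a < b) (h1 : Mf μ θ a = 1/3)
    (h2 : Mf μ θ b = 2/3) (h3 : Lf μ θ a p q = 1/6) (h4 : Lf μ θ b p q = 1/3)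
    (h5 : Nf μ θ p q = 1/2) (i : Fin 6) : μ (Reg θ a b p q i) = (6 : ℝ≥0∞)⁻¹ := by
  have := h.prob
  have e0 := meas_sum h hab (θ := θ) (p := p) (q := q) univ Finset.univ (by simp)
  have e1 := meas_sum h hab (θ := θ) (p := p) (q := q) {x | S θ x ≤ a} {0, 1} (by
    intro i x hx
    have hx1 := hx.1
    change S θ x ≤ a ↔ _
    fin_cases i <;> simp [I6] at hx1 ⊢ <;> linarith)
  have e2 := meas_sum h hab (θ := θ) (p := p) (q := q) {x | S θ x ≤ b} {0, 1, 2, 3} (by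
    intro i x hx
    have hx1 := hx.1
    change S θ x ≤ b ↔ _
    fin_cases i <;> simp [I6] at hx1 ⊢ <;> linarith)
  have eD : ∀ x, T θ x ≤ p + q * S θ x ↔ D θ p q x ≤ 0 := fun x => by rw [D, sub_nonpos]
  have e3 := meas_sum h hab (θ := θ) (p := p) (q := q)
    {x | S θ x ≤ a ∧ T θ x ≤ p + q * S θ x} {1} (by
    intro i x hx
    have hx1 := hx.1
    have hx2 := hx.2
    change (S θ x ≤ a ∧ T θ x ≤ p + q * S θ x) ↔ _
    rw [eD]
    fin_cases i <;> simp [I6, J6] at hx1 hx2 ⊢ <;> grind)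
  have e4 := meas_sum h hab (θ := θ) (p := p) (q := q)
    {x | S θ x ≤ b ∧ T θ x ≤ p + q * S θ x} {1, 3} (by
    intro i x hx
    have hx1 := hx.1
    have hx2 := hx.2
    change (S θ x ≤ b ∧ T θ x ≤ p + q * S θ x) ↔ _
    rw [eD]
    fin_cases i <;> simp [I6, J6] at hx1 hx2 ⊢ <;> grind)
  have e5 := meas_sum h hab (θ := θ) (p := p) (q := q)
    {x | T θ x ≤ p + q * S θ x} {1, 3, 5} (by
    intro i x hx
    have hx2 := hx.2
    change (T θ x ≤ p + q * S θ x) ↔ _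
    rw [eD]
    fin_cases i <;> simp [J6] at hx2 ⊢ <;> grind)
  unfold Mf at h1 h2
  unfold Lf at h3 h4
  unfold Nf at h5
  rw [h1] at e1
  rw [h2] at e2
  rw [h3] at e3
  rw [h4] at e4
  rw [h5] at e5
  rw [probReal_univ] at e0
  simp [Fin.sum_univ_six] at e0 e1 e2 e3 e4 e5
  have key : μ.real (Reg θ a b p q i) = 1/6 := by
    fin_cases i <;> simp <;> linarith
  rw [← ENNReal.ofReal_toReal (measure_ne_top μ (Reg θ a b p q i)), ← measureReal_def, key,
    one_div, ENNReal.ofReal_inv_of_pos (by norm_num)]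
  norm_num

lemma inner_eq (θ : ℝ) (u x : Euc 2) : inner ℝ u x = S θ u * S θ x + T θ u * T θ x := by
  simp only [S, T, PiLp.inner_apply, Fin.sum_univ_two]
  simp
  linear_combination (-(u 0 * x 0) - u 1 * x 1) * Real.sin_sq_add_cos_sq θ

lemma u_zero (θ : ℝ) (u : Euc 2) (h1 : S θ u = 0) (h2 : T θ u = 0) : u = 0 := by
  rw [← inner_self_eq_zero (𝕜 := ℝ), inner_eq θ, h1, h2]; simp

lemma avoid_two {θ a b p q : ℝ} (hab : a < b) (u : Euc 2) (c : ℝ) (hu : u ≠ 0) :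
    ∃ i j : Fin 6, i ≠ j ∧ ∀ x, inner ℝ u x = c →
      ¬ (S θ x ∈ I6 a b i ∧ D θ p q x ∈ J6 i) ∧ ¬ (S θ x ∈ I6 a b j ∧ D θ p q x ∈ J6 j) := by
  by_cases ht : T θ u = 0
  · have hs : S θ u ≠ 0 := fun hs => hu (u_zero θ u hs ht)
    have hline : ∀ x, inner ℝ u x = c → S θ x = c / S θ u := by
      intro x hx
      rw [inner_eq θ, ht] at hx
      rw [eq_div_iff hs]; linarith
    rcases le_total (c / S θ u) a with h | h
    · refine ⟨4, 5, by decide, fun x hx => ?_⟩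
      have := hline x hx
      simp [I6, J6]; constructor <;> intro <;> linarith
    · refine ⟨0, 1, by decide, fun x hx => ?_⟩
      have := hline x hx
      simp [I6, J6]; constructor <;> intro <;> linarith
  · obtain ⟨k, m, hline⟩ : ∃ k m : ℝ, ∀ x, inner ℝ u x = c → D θ p q x = k * S θ x + m := by
      refine ⟨- S θ u / T θ u - q, c / T θ u - p, fun x hx => ?_⟩
      rw [inner_eq θ] at hx
      rw [D, ← hx]; field_simp; ring
    have conv : ∀ (i j : Fin 6), i ≠ j →
        (∀ s d : ℝ, d = k * s + m →
          ¬ (s ∈ I6 a b i ∧ d ∈ J6 i) ∧ ¬ (s ∈ I6 a b j ∧ d ∈ J6 j)) →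
        ∃ i j : Fin 6, i ≠ j ∧ ∀ x, inner ℝ u x = c →
          ¬ (S θ x ∈ I6 a b i ∧ D θ p q x ∈ J6 i) ∧ ¬ (S θ x ∈ I6 a b j ∧ D θ p q x ∈ J6 j) :=
      fun i j hij hh => ⟨i, j, hij, fun x hx => hh _ _ (hline x hx)⟩
    rcases le_total 0 k with hk | hk
    · rcases le_total 0 (k * a + m) with h | h
      · refine conv 3 5 (by decide) fun s d hd => ?_
        simp [I6, J6]; constructor <;> intros <;> nlinarith
      · rcases le_total 0 (k * b + m) with h' | h'
        · refine conv 0 5 (by decide) fun s d hd => ?_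
          simp [I6, J6]; constructor <;> intros <;> nlinarith
        · refine conv 0 2 (by decide) fun s d hd => ?_
          simp [I6, J6]; constructor <;> intros <;> nlinarith
    · rcases le_total (k * a + m) 0 with h | h
      · refine conv 2 4 (by decide) fun s d hd => ?_
        simp [I6, J6]; constructor <;> intros <;> nlinarith
      · rcases le_total (k * b + m) 0 with h' | h'
        · refine conv 1 4 (by decide) fun s d hd => ?_
          simp [I6, J6]; constructor <;> intros <;> nlinarith
        · refine conv 1 3 (by decide) fun s d hd => ?_
          simp [I6, J6]; constructor <;> intros <;> nlinarith

end

end Six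

/-- In the plane, for any nice measure there are two distinct parallel lines and a third
line meeting both, cutting the plane into six regions (the closures of the connected
components of the complement of the three lines), each of measure 1/6, so that every
line avoids at least two of the six regions. -/
theorem six_regions_by_three_lines (μ : Measure (Euc 2)) (hμ : NiceMeasure 2 μ) :
    ∃ (v : Euc 2) (c₁ c₂ : ℝ) (w : Euc 2) (c₃ : ℝ),
      v ≠ 0 ∧ c₁ ≠ c₂ ∧ w ≠ 0 ∧
      (Hyperplane w c₃ ∩ Hyperplane v c₁).Nonempty ∧
      (Hyperplane w c₃ ∩ Hyperplane v c₂).Nonempty ∧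
      ∃ x : Fin 6 → Euc 2,
        (∀ i, x i ∈ (Hyperplane v c₁ ∪ Hyperplane v c₂ ∪ Hyperplane w c₃)ᶜ) ∧
        (∀ i j, i ≠ j →
          connectedComponentIn (Hyperplane v c₁ ∪ Hyperplane v c₂ ∪ Hyperplane w c₃)ᶜ (x i) ≠
          connectedComponentIn (Hyperplane v c₁ ∪ Hyperplane v c₂ ∪ Hyperplane w c₃)ᶜ (x j)) ∧
        (∀ y ∈ (Hyperplane v c₁ ∪ Hyperplane v c₂ ∪ Hyperplane w c₃)ᶜ, ∃ i,
          connectedComponentIn (Hyperplane v c₁ ∪ Hyperplane v c₂ ∪ Hyperplane w c₃)ᶜ y =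
          connectedComponentIn (Hyperplane v c₁ ∪ Hyperplane v c₂ ∪ Hyperplane w c₃)ᶜ (x i)) ∧
        (∀ i, μ (closure (connectedComponentIn
            (Hyperplane v c₁ ∪ Hyperplane v c₂ ∪ Hyperplane w c₃)ᶜ (x i))) = (6 : ℝ≥0∞)⁻¹) ∧
        (∀ u : Euc 2, ∀ c : ℝ, u ≠ 0 → 2 ≤ {i | Avoids (Hyperplane u c)
          (closure (connectedComponentIn
            (Hyperplane v c₁ ∪ Hyperplane v c₂ ∪ Hyperplane w c₃)ᶜ (x i)))}.ncard) := by
  have h := Six.good_of_nice hμ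
  obtain ⟨θ, a, b, p, q, hab, h1, h2, h3, h4, h5⟩ := Six.exists_params h
  have hv : ∀ c : ℝ, Six.P θ c (p + q * c) ∈
      Hyperplane (Six.ww θ q) p ∩ Hyperplane (Six.vv θ) c := by
    intro c
    refine ⟨(Six.mem_ww ..).2 ?_, (Six.mem_vv ..).2 ?_⟩
    · rw [Six.D, Six.S_P, Six.T_P]; ring
    · rw [Six.S_P]
  have hCm : (Hyperplane (Six.vv θ) a ∪ Hyperplane (Six.vv θ) b ∪ Hyperplane (Six.ww θ q) p)ᶜ =
    Six.Cm θ a b p q := rfl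
  have hcomp : ∀ i, connectedComponentIn (Six.Cm θ a b p q) (Six.pt θ a b p q i) =
      Six.Reg θ a b p q i := fun i => Six.comp_eq hab (Six.pt_mem hab i)
  refine ⟨Six.vv θ, a, b, Six.ww θ q, p, ?_, hab.ne, ?_, ⟨_, hv a⟩, ⟨_, hv b⟩,
    Six.pt θ a b p q, ?_, ?_, ?_, ?_, ?_⟩
  · intro h0
    have hx := (Six.mem_vv θ 1 (Six.P θ 1 0)).2 (Six.S_P θ 1 0)
    rw [h0] at hx
    have hx' : inner ℝ (0 : Euc 2) (Six.P θ 1 0) = 1 := hx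
    simp at hx'
  · intro h0
    have hx := (Six.mem_ww θ 1 q (Six.P θ 0 1)).2 (by rw [Six.D, Six.S_P, Six.T_P]; ring)
    rw [h0] at hx
    have hx' : inner ℝ (0 : Euc 2) (Six.P θ 0 1) = 1 := hx
    simp at hx'
  · intro i
    exact Six.reg_sub hab i (Six.pt_mem hab i)
  · intro i j hij
    rw [hCm, hcomp, hcomp]
    intro he
    have hm := Six.pt_mem (θ := θ) (p := p) (q := q) hab i
    have hm' := hm
    rw [he] at hm'
    exact hij (Six.reg_disj hab hm hm')
  · intro y hy
    rw [hCm] at hy ⊢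
    obtain ⟨i, hi⟩ := Six.reg_cover hy
    exact ⟨i, by rw [hcomp, Six.comp_eq hab hi]⟩
  · intro i
    rw [hCm, hcomp, Six.meas_closure h hab]
    exact Six.meas_reg h hab h1 h2 h3 h4 h5 i
  · intro u c hu
    rw [hCm]
    simp only [hcomp, Avoids, Six.int_closure hab]
    obtain ⟨i, j, hij, hav⟩ := Six.avoid_two (θ := θ) (p := p) (q := q) hab u c hu
    refine (Set.ncard_pair hij).symm.le.trans ?_
    refine Set.ncard_le_ncard ?_ (Set.toFinite _)
    rintro k (rfl | hk)
    · exact Set.eq_empty_iff_forall_notMem.2 fun x hx => (hav x hx.1).1 hx.2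
    · rw [Set.mem_singleton_iff] at hk
      subst hk
      exact Set.eq_empty_iff_forall_notMem.2 fun x hx => (hav x hx.1).2 hx.2
end
end

section
/- Let d ≥ 1, let μ be a nice measure on ℝ^d, and let a_1, …, a_{2^d} be positive real numbers with a_1 + ⋯ + a_{2^d} = 1. Then there exists a convex partition {C_1, …, C_{2^d}} of ℝ^d into 2^d parts with μ(C_i) = a_i for every i, such that every hyperplane in ℝ^d avoids at least one of the parts. -/
open MeasureTheory Set Metric
open scoped ENNReal
noncomputable section

open Function Filter Topology

namespace YY

lemma implicit_zero {P : Type*} [TopologicalSpace P] (D : P → ℝ → ℝ)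
    (hc : Continuous (fun q : P × ℝ => D q.1 q.2)) (hs : ∀ p, StrictAnti (D p))
    (hpos : ∀ p, ∃ y, 0 < D p y) (hneg : ∀ p, ∃ y, D p y < 0) :
    ∃ ω : P → ℝ, Continuous ω ∧ ∀ p, D p (ω p) = 0 := by
  have hc1 : ∀ p, Continuous (D p) := fun p => hc.comp (Continuous.prodMk_right p)
  have hc2 : ∀ y, Continuous (fun p => D p y) := fun y => hc.comp (Continuous.prodMk_left y)
  have hz : ∀ p, ∃ y, D p y = 0 := by
    intro p
    obtain ⟨y1, h1⟩ := hpos p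
    obtain ⟨y2, h2⟩ := hneg p
    obtain ⟨y, hy⟩ := mem_range_of_exists_le_of_exists_ge (hc1 p) ⟨y2, h2.le⟩ ⟨y1, h1.le⟩
    exact ⟨y, hy⟩
  choose ω hω using hz
  refine ⟨ω, ?_, hω⟩
  rw [OrderTopology.continuous_iff]
  intro a
  constructor
  · have : ω ⁻¹' Ioi a = {p | 0 < D p a} := by
      ext p
      simp only [mem_preimage, mem_Ioi, mem_ofPred_eq]
      rw [← (hs p).lt_iff_gt, hω]
    rw [this]
    exact isOpen_lt continuous_const (hc2 a)
  · have : ω ⁻¹' Iio a = {p | D p a < 0} := by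
      ext p
      simp only [mem_preimage, mem_Iio, mem_ofPred_eq]
      rw [← (hs p).lt_iff_gt, hω]
    rw [this]
    exact isOpen_lt (hc2 a) continuous_const

def sg (b : Bool) : ℝ := if b then 1 else -1

@[simp] lemma sg_true : sg true = 1 := rfl
@[simp] lemma sg_false : sg false = -1 := rfl

structure Good (n : ℕ) (Φ : (ℕ → Bool) → (ℕ → ℝ) → ℝ) : Prop where
  dep : ∀ σ τ, (∀ i < n, σ i = τ i) → Φ σ = Φ τ
  cont : ∀ σ, Continuous (Φ σ)
  anti : ∀ σ p i, i < n → StrictAnti fun y => Φ σ (update p i (sg (σ i) * y))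
  top : ∀ σ p i, i < n → Tendsto (fun y => Φ σ (update p i (sg (σ i) * y))) atTop atBot
  bot : ∀ σ p i, i < n → Tendsto (fun y => Φ σ (update p i (sg (σ i) * y))) atBot atTop

lemma tree (n : ℕ) : ∀ (Φ : (ℕ → Bool) → (ℕ → ℝ) → ℝ), Good n Φ →
    ∃ (c : ℝ) (w : ℕ → (ℕ → Bool) → ℝ),
      (∀ i σ τ, (∀ j < i, σ j = τ j) → w i σ = w i τ) ∧ (∀ i, n ≤ i → w i = 0) ∧
      ∀ σ, Φ σ (fun i => w i σ) = c := by
  induction n with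
  | zero =>
    intro Φ h
    refine ⟨Φ (fun _ => true) 0, 0, ?_, ?_, ?_⟩
    · intros; rfl
    · intros; rfl
    · intro σ
      rw [h.dep σ (fun _ => true) (by simp)]
      rfl
  | succ n ih =>
    intro Φ h
    let Φp : (ℕ → Bool) → (ℕ → ℝ) → ℝ → ℝ := fun σ p y => Φ (update σ n true) (update p n y)
    let Φm : (ℕ → Bool) → (ℕ → ℝ) → ℝ → ℝ := fun σ p y => Φ (update σ n false) (update p n y)
    have anp : ∀ σ p, StrictAnti (Φp σ p) := by
      intro σ p
      have := h.anti (update σ n true) p n (by omega)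
      simpa using this
    have mom : ∀ σ p, StrictMono (Φm σ p) := by
      intro σ p
      have := h.anti (update σ n false) p n (by omega)
      intro x y hxy
      have := this (neg_lt_neg hxy)
      simpa using this
    have cup : Continuous (fun q : (ℕ → ℝ) × ℝ => update q.1 n q.2) :=
      Continuous.update continuous_fst n continuous_snd
    have key : ∀ σ, ∃ ω : (ℕ → ℝ) → ℝ, Continuous ω ∧ ∀ p, Φp σ p (ω p) - Φm σ p (ω p) = 0 := by
      intro σ
      apply implicit_zero (fun p y => Φp σ p y - Φm σ p y)
      · exact ((h.cont _).comp cup).sub ((h.cont _).comp cup)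
      · intro p x y hxy
        have := anp σ p hxy
        have := mom σ p hxy
        dsimp only
        linarith
      · intro p
        have h1 := h.bot (update σ n true) p n (by omega)
        have h2 := (h.top (update σ n false) p n (by omega)).comp tendsto_neg_atBot_atTop
        obtain ⟨y, hy1, hy2⟩ := ((h1.eventually_gt_atTop 0).and (h2.eventually_lt_atBot 0)).exists
        refine ⟨y, ?_⟩
        simp at hy1 hy2
        simp only [Φp, Φm]
        linarith
      · intro p
        have h1 := h.top (update σ n true) p n (by omega)
        have h2 := (h.bot (update σ n false) p n (by omega)).comp tendsto_neg_atTop_atBot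
        obtain ⟨y, hy1, hy2⟩ := ((h1.eventually_lt_atBot 0).and (h2.eventually_gt_atTop 0)).exists
        refine ⟨y, ?_⟩
        simp at hy1 hy2
        simp only [Φp, Φm]
        linarith
    choose ω ωc ωz using key
    have ωz' : ∀ σ p, Φp σ p (ω σ p) = Φm σ p (ω σ p) := fun σ p => sub_eq_zero.1 (ωz σ p)
    have upd : ∀ σ τ : ℕ → Bool, (∀ i < n, σ i = τ i) → ∀ b, ∀ i < n + 1,
        update σ n b i = update τ n b i := by
      intro σ τ hst b i hi
      by_cases hin : i = n
      · subst hin; simp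
      · simp [hin, hst i (by omega)]
    have ωdep : ∀ σ τ, (∀ i < n, σ i = τ i) → ω σ = ω τ := by
      intro σ τ hst
      funext p
      have e1 : Φp σ = Φp τ := by
        funext p y
        simp only [Φp]
        rw [h.dep _ _ (upd σ τ hst true)]
      have e2 : Φm σ = Φm τ := by
        funext p y
        simp only [Φm]
        rw [h.dep _ _ (upd σ τ hst false)]
      have h1 := ωz' σ p
      have h2 := ωz' τ p
      rw [← e1, ← e2] at h2
      rcases lt_trichotomy (ω σ p) (ω τ p) with hl | hl | hl
      · have := anp σ p hl
        have := mom σ p hl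
        linarith
      · exact hl
      · have := anp σ p hl
        have := mom σ p hl
        linarith
    let Ψ : (ℕ → Bool) → (ℕ → ℝ) → ℝ := fun σ p => Φp σ p (ω σ p)
    have up : ∀ σ p y, Ψ σ p ≤ max (Φp σ p y) (Φm σ p y) := by
      intro σ p y
      rcases le_total (ω σ p) y with hl | hl
      · refine le_trans ?_ (le_max_right _ _)
        simp only [Ψ]
        rw [ωz']
        exact (mom σ p).monotone hl
      · exact le_trans ((anp σ p).antitone hl) (le_max_left _ _)
    have lo : ∀ σ p y, min (Φp σ p y) (Φm σ p y) ≤ Ψ σ p := by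
      intro σ p y
      rcases le_total (ω σ p) y with hl | hl
      · exact le_trans (min_le_left _ _) ((anp σ p).antitone hl)
      · refine le_trans (min_le_right _ _) ?_
        simp only [Ψ]
        rw [ωz']
        exact (mom σ p).monotone hl
    have com : ∀ (p : ℕ → ℝ) i y z, i < n →
        update (update p i z) n y = update (update p n y) i z := by
      intro p i y z hi
      exact update_comm (by omega) _ _ _
    have usg : ∀ (σ : ℕ → Bool) i b, i < n → update σ n b i = σ i := by
      intro σ i b hi
      exact update_of_ne (by omega) _ _
    have hΨ : Good n Ψ := by
      refine ⟨?_, ?_, ?_, ?_, ?_⟩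
      · intro σ τ hst
        funext p
        simp only [Ψ, Φp]
        rw [ωdep σ τ hst, h.dep _ _ (upd σ τ hst true)]
      · intro σ
        exact (h.cont _).comp (cup.comp (continuous_id.prodMk (ωc σ)))
      · intro σ p i hi x y hxy
        dsimp only
        set q := update p i (sg (σ i) * x) with hq
        refine lt_of_le_of_lt (up σ _ (ω σ q)) (max_lt ?_ ?_)
        · have := h.anti (update σ n true) (update p n (ω σ q)) i (by omega) hxy
          simp only [usg σ i _ hi] at this
          simp only [Ψ, Φp]
          rw [com _ _ _ _ hi]
          refine this.trans_eq ?_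
          rw [← com _ _ _ _ hi]
        · have := h.anti (update σ n false) (update p n (ω σ q)) i (by omega) hxy
          simp only [usg σ i _ hi] at this
          simp only [Ψ]
          rw [ωz']
          simp only [Φm]
          rw [com _ _ _ _ hi]
          refine this.trans_eq ?_
          rw [← com _ _ _ _ hi]
      · intro σ p i hi
        rw [tendsto_atBot]
        intro b
        have h1 := h.top (update σ n true) (update p n 0) i (by omega)
        have h2 := h.top (update σ n false) (update p n 0) i (by omega)
        filter_upwards [h1.eventually_le_atBot b, h2.eventually_le_atBot b] with y hy1 hy2
        refine (up σ _ 0).trans (max_le ?_ ?_)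
        · simp only [usg σ i _ hi] at hy1
          simpa only [Φp, com _ _ _ _ hi] using hy1
        · simp only [usg σ i _ hi] at hy2
          simpa only [Φm, com _ _ _ _ hi] using hy2
      · intro σ p i hi
        rw [Filter.tendsto_atTop]
        intro b
        have h1 := h.bot (update σ n true) (update p n 0) i (by omega)
        have h2 := h.bot (update σ n false) (update p n 0) i (by omega)
        filter_upwards [h1.eventually_ge_atTop b, h2.eventually_ge_atTop b] with y hy1 hy2
        refine le_trans (le_min ?_ ?_) (lo σ _ 0)
        · simp only [usg σ i _ hi] at hy1
          simpa only [Φp, com _ _ _ _ hi] using hy1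
        · simp only [usg σ i _ hi] at hy2
          simpa only [Φm, com _ _ _ _ hi] using hy2
    obtain ⟨c, w, hw1, hw2, hw3⟩ := ih Ψ hΨ
    refine ⟨c, update w n (fun σ => ω σ (fun i => w i σ)), ?_, ?_, ?_⟩
    · intro i σ τ hst
      by_cases hin : i = n
      · subst hin
        simp only [update_self]
        rw [ωdep σ τ hst]
        congr 1
        funext k
        by_cases hk : k < i
        · exact hw1 k σ τ (fun j hj => hst j (by omega))
        · rw [hw2 k (by omega)]; rfl
      · simp only [update_of_ne hin]
        exact hw1 i σ τ hst
    · intro i hi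
      rw [update_of_ne (by omega)]
      exact hw2 i (by omega)
    · intro σ
      have e : (fun i => update w n (fun σ => ω σ (fun i => w i σ)) i σ)
          = update (fun i => w i σ) n (ω σ (fun i => w i σ)) := by
        funext k
        by_cases hk : k = n
        · subst hk; simp
        · simp [hk]
      rw [e]
      have := hw3 σ
      cases hb : σ n with
      | true =>
        rw [← this]
        simp only [Ψ, Φp]
        rw [show update σ n true = σ by rw [← hb]; exact update_eq_self _ _]
      | false =>
        rw [← this]
        simp only [Ψ]
        rw [ωz']
        simp only [Φm]
        rw [show update σ n false = σ by rw [← hb]; exact update_eq_self _ _]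


lemma null_level {d : ℕ} {μ : Measure (Euc d)} (hμ : μ ≪ volume) (t : Euc d →ᵃ[ℝ] ℝ) (u : Euc d)
    (hu : t.linear u = 1) (c : ℝ) : μ {x | t x = c} = 0 := by
  apply hμ
  have : {x | t x = c} = ((AffineSubspace.mk' c (⊥ : Submodule ℝ ℝ)).comap t : Set (Euc d)) := by
    ext x
    simp [AffineSubspace.mem_mk', sub_eq_zero]
  rw [this]
  apply Measure.addHaar_affineSubspace
  intro h
  have h0 : (0 : Euc d) ∈ ((AffineSubspace.mk' c (⊥ : Submodule ℝ ℝ)).comap t) := by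
    rw [h]; trivial
  have h1 : u ∈ ((AffineSubspace.mk' c (⊥ : Submodule ℝ ℝ)).comap t) := by
    rw [h]; trivial
  simp [AffineSubspace.mem_mk', sub_eq_zero] at h0 h1
  have h2 := t.map_vadd 0 u
  simp [hu] at h2
  linarith

lemma aff_add {d : ℕ} (t : Euc d →ᵃ[ℝ] ℝ) (u x : Euc d) (r : ℝ) :
    t (x + r • u) = t x + r * t.linear u := by
  have h2 := t.map_vadd x (r • u)
  simp only [vadd_eq_add, map_smul, smul_eq_mul] at h2
  rw [add_comm x, h2, add_comm]

lemma aff_cont {d : ℕ} (t : Euc d →ᵃ[ℝ] ℝ) : Continuous t :=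
  AffineMap.continuous_of_finiteDimensional t

lemma sum_upd (n i : ℕ) (hi : i < n) (p z : ℕ → ℝ) (y : ℝ) :
    ∑ j ∈ Finset.range n, update p i y j * z j =
      (∑ j ∈ Finset.range n, p j * z j) + (y - p i) * z i := by
  have hm : i ∈ Finset.range n := by simpa using hi
  rw [← Finset.add_sum_erase _ _ hm, ← Finset.add_sum_erase _ (fun j => p j * z j) hm]
  have : ∑ x ∈ (Finset.range n).erase i, update p i y x * z x
      = ∑ x ∈ (Finset.range n).erase i, p x * z x := by
    apply Finset.sum_congr rfl
    intro x hx
    rw [update_of_ne (Finset.ne_of_mem_erase hx)]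
  rw [this]
  simp
  ring

lemma leaf {d : ℕ} {μ : Measure (Euc d)} [IsFiniteMeasure μ] [μ.IsOpenPosMeasure]
    (hμ : μ ≪ volume) (n : ℕ) (t : ℕ → Euc d →ᵃ[ℝ] ℝ) (Y : Euc d →ᵃ[ℝ] ℝ) (u : Euc d)
    (hYu : Y.linear u = 1) (htu : ∀ i < n, (t i).linear u = 0)
    (hnul : ∀ i < n, μ {x | t i x = 0} = 0)
    (K O : Set (Euc d)) (hK : MeasurableSet K) (hO : IsOpen O) (hOK : O ⊆ K) (hne : O.Nonempty)
    (s : ℕ → ℝ) (hs : ∀ x ∈ K, ∀ i < n, 0 ≤ s i * t i x) (hsO : ∀ x ∈ O, ∀ i < n, 0 < s i * t i x)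
    (hOu : ∀ x ∈ O, ∀ r : ℝ, x + r • u ∈ O)
    (α : ℝ) (hα : 0 < α) (hαK : α < μ.real K) :
    ∃ ω : (ℕ → ℝ) → ℝ, Continuous ω ∧
      (∀ p, μ.real (K ∩ {x | Y x ≤ ω p + ∑ i ∈ Finset.range n, p i * t i x}) = α) ∧
      (∀ p i, i < n → StrictAnti fun y => ω (update p i (s i * y))) ∧
      (∀ p i, i < n → Tendsto (fun y => ω (update p i (s i * y))) atTop atBot) ∧
      (∀ p i, i < n → Tendsto (fun y => ω (update p i (s i * y))) atBot atTop) := by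
  set L : (ℕ → ℝ) → Euc d → ℝ := fun p x => ∑ i ∈ Finset.range n, p i * t i x with hL
  set S : (ℕ → ℝ) → ℝ → Set (Euc d) := fun p c => K ∩ {x | Y x ≤ c + L p x} with hS
  have Lc : ∀ p, Continuous (L p) := by
    intro p
    apply continuous_finsetSum
    intro i _
    exact continuous_const.mul (aff_cont _)
  have Lc' : ∀ x, Continuous (fun p => L p x) := by
    intro x
    apply continuous_finsetSum
    intro i _
    exact (continuous_apply i).mul continuous_const
  have Yc := aff_cont Y
  have Lu : ∀ p x (r : ℝ), L p (x + r • u) = L p x := by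
    intro p x r
    apply Finset.sum_congr rfl
    intro i hi
    rw [aff_add, htu i (by simpa using hi)]
    ring
  have Sm : ∀ p c, MeasurableSet (S p c) := by
    intro p c
    exact hK.inter (measurableSet_le Yc.measurable (measurable_const.add (Lc p).measurable))
  have Snul : ∀ p c, μ {x | Y x = c + L p x} = 0 := by
    intro p c
    have := null_level hμ (Y - ∑ i ∈ Finset.range n, p i • t i) u (by
      have : (∑ i ∈ Finset.range n, p i • t i).linear u = 0 := by
        have h1 : ∀ m, m ≤ n → (∑ i ∈ Finset.range m, p i • t i).linear u = 0 := by
          intro m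
          induction m with
          | zero => intro _; simp
          | succ m ih =>
            intro hm
            rw [Finset.sum_range_succ]
            simp [ih (by omega), htu m (by omega)]
        exact h1 n le_rfl
      simp [hYu, this]) c
    convert this using 2
    ext x
    have e : (∑ i ∈ Finset.range n, p i • t i) x = L p x := by
      have h1 : ∀ m, (∑ i ∈ Finset.range m, p i • t i) x = ∑ i ∈ Finset.range m, p i * t i x := by
        intro m
        induction m with
        | zero => simp
        | succ m ih =>
          rw [Finset.sum_range_succ, Finset.sum_range_succ, ← ih]
          simp
      exact h1 n
    simp [e, sub_eq_iff_eq_add]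
  -- strict monotonicity
  have strict : ∀ p c p' c', (∀ x ∈ K, c + L p x ≤ c' + L p' x) →
      (∀ x ∈ O, c + L p x < c' + L p' x) → μ.real (S p c) < μ.real (S p' c') := by
    intro p c p' c' h1 h2
    have hsub : S p c ⊆ S p' c' := fun x hx => ⟨hx.1, le_trans hx.2 (h1 x hx.1)⟩
    set U := O ∩ ({x | c + L p x < Y x} ∩ {x | Y x < c' + L p' x}) with hU
    have Uo : IsOpen U := hO.inter ((isOpen_lt (continuous_const.add (Lc p)) Yc).inter
      (isOpen_lt Yc (continuous_const.add (Lc p'))))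
    have Un : U.Nonempty := by
      obtain ⟨x, hx⟩ := hne
      have h3 := h2 x hx
      refine ⟨x + (((c + L p x) + (c' + L p' x)) / 2 - Y x) • u, hOu x hx _, ?_, ?_⟩
      · simp only [mem_ofPred_eq, Lu, aff_add, hYu]
        linarith
      · simp only [mem_ofPred_eq, Lu, aff_add, hYu]
        linarith
    have Up : 0 < μ.real U := by
      rw [measureReal_def]
      exact ENNReal.toReal_pos (Uo.measure_pos μ Un).ne' (measure_ne_top _ _)
    have hd : Disjoint (S p c) U := by
      rw [Set.disjoint_left]
      intro x hx hxU
      have h4 : Y x ≤ c + L p x := hx.2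
      have h5 : c + L p x < Y x := hxU.2.1
      linarith
    have hun : S p c ∪ U ⊆ S p' c' :=
      union_subset hsub (fun x hx => ⟨hOK hx.1, by have h6 : Y x < c' + L p' x := hx.2.2; exact h6.le⟩)
    have := measureReal_mono (μ := μ) hun (measure_ne_top _ _)
    rw [measureReal_union hd Uo.measurableSet] at this
    linarith
  -- convergence
  have conv : ∀ {ι : Type} (l : Filter ι) [l.IsCountablyGenerated] (P : ι → ℕ → ℝ) (C : ι → ℝ)
      (A : Set (Euc d)), MeasurableSet A →
      (∀ᵐ x ∂μ, ∀ᶠ i in l, x ∈ S (P i) (C i) ↔ x ∈ A) →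
      Tendsto (fun i => μ.real (S (P i) (C i))) l (𝓝 (μ.real A)) := by
    intro ι l _ P C A hA h
    have := tendsto_measure_of_ae_tendsto_indicator_of_isFiniteMeasure l hA
      (fun i => Sm (P i) (C i)) h
    exact (ENNReal.tendsto_toReal (measure_ne_top _ _)).comp this
  have Fc : Continuous (fun q : (ℕ → ℝ) × ℝ => μ.real (S q.1 q.2)) := by
    rw [continuous_iff_continuousAt]
    rintro ⟨p, c⟩
    apply conv (𝓝 (p, c)) (fun q => q.1) (fun q => q.2) _ (Sm p c)
    have : ∀ᵐ x ∂μ, Y x ≠ c + L p x := by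
      rw [ae_iff]; simpa using Snul p c
    filter_upwards [this] with x hx
    have hcq : Continuous (fun q : (ℕ → ℝ) × ℝ => q.2 + L q.1 x) :=
      continuous_snd.add ((Lc' x).comp continuous_fst)
    rcases lt_or_gt_of_ne hx with hlt | hlt
    · have : ∀ᶠ q in 𝓝 (p, c), Y x < q.2 + L q.1 x :=
        hcq.continuousAt.eventually (lt_mem_nhds hlt)
      filter_upwards [this] with q hq
      simp only [hS, mem_inter_iff, mem_ofPred_eq, hq.le, hlt.le]
    · have : ∀ᶠ q in 𝓝 (p, c), q.2 + L q.1 x < Y x :=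
        hcq.continuousAt.eventually (gt_mem_nhds hlt)
      filter_upwards [this] with q hq
      simp only [hS, mem_inter_iff, mem_ofPred_eq, not_le.2 hq, not_le.2 hlt]
  have Fmono : ∀ p, StrictMono (fun c => μ.real (S p c)) := by
    intro p c c' h
    exact strict _ _ _ _ (fun x _ => by linarith) (fun x _ => by linarith)
  have Ftop : ∀ p, Tendsto (fun c => μ.real (S p c)) atTop (𝓝 (μ.real K)) := by
    intro p
    apply conv atTop (fun _ => p) (fun c => c) _ hK
    refine Eventually.of_forall fun x => ?_
    filter_upwards [eventually_ge_atTop (Y x - L p x)] with c hc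
    have : Y x ≤ c + L p x := by linarith
    simp [hS, this]
  have Fbot : ∀ p, Tendsto (fun c => μ.real (S p c)) atBot (𝓝 0) := by
    intro p
    have := conv atBot (fun _ => p) (fun c => c) ∅ MeasurableSet.empty (by
      refine Eventually.of_forall fun x => ?_
      filter_upwards [eventually_lt_atBot (Y x - L p x)] with c hc
      have : ¬ Y x ≤ c + L p x := by linarith
      simp [hS, this])
    simpa using this
  obtain ⟨ω, ωc, ωz⟩ := implicit_zero (fun p c => α - μ.real (S p c)) (continuous_const.sub Fc)
    (fun p c c' h => by have := Fmono p h; dsimp only at *; linarith)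
    (fun p => by
      obtain ⟨c, hc⟩ := ((Fbot p).eventually (gt_mem_nhds hα)).exists
      exact ⟨c, by linarith⟩)
    (fun p => by
      obtain ⟨c, hc⟩ := ((Ftop p).eventually (lt_mem_nhds hαK)).exists
      exact ⟨c, by linarith⟩)
  have ωz' : ∀ p, μ.real (S p (ω p)) = α := fun p => by have := ωz p; linarith
  refine ⟨ω, ωc, ωz', ?_, ?_, ?_⟩
  · intro p i hi y y' hy
    dsimp only
    by_contra hcon
    push Not at hcon
    have := strict (update p i (s i * y)) (ω (update p i (s i * y)))
      (update p i (s i * y')) (ω (update p i (s i * y'))) (by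
        intro x hx
        simp only [hL, sum_upd n i hi]
        have := mul_le_mul_of_nonneg_left hy.le (hs x hx i hi)
        linarith) (by
        intro x hx
        simp only [hL, sum_upd n i hi]
        have := mul_lt_mul_of_pos_left hy (hsO x hx i hi)
        linarith)
    rw [ωz', ωz'] at this
    exact lt_irrefl _ this
  · intro p i hi
    rw [tendsto_atBot]
    intro b
    have hT : Tendsto (fun y => μ.real (S (update p i (s i * y)) b)) atTop (𝓝 (μ.real K)) := by
      apply conv atTop (fun y => update p i (s i * y)) (fun _ => b) _ hK
      have : ∀ᵐ x ∂μ, t i x ≠ 0 := by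
        rw [ae_iff]; simpa using hnul i hi
      filter_upwards [this] with x hx
      by_cases hxK : x ∈ K
      · have h1 : s i ≠ 0 := by
          obtain ⟨z, hz⟩ := hne
          have := hsO z hz i hi
          rintro h; simp [h] at this
        have h2 : 0 < s i * t i x := lt_of_le_of_ne (hs x hxK i hi) (mul_ne_zero h1 hx).symm
        have h3 : Tendsto (fun y : ℝ => y * (s i * t i x)) atTop atTop :=
          tendsto_id.atTop_mul_const h2
        filter_upwards [h3.eventually_ge_atTop (Y x - b - L p x + p i * t i x)] with y hy
        have : Y x ≤ b + L (update p i (s i * y)) x := by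
          simp only [hL, sum_upd n i hi] at hy ⊢
          linarith
        simp [hS, this]
      · exact Eventually.of_forall fun y => by simp [hS, hxK]
    filter_upwards [hT.eventually (lt_mem_nhds hαK)] with y hy
    rw [← ωz' (update p i (s i * y))] at hy
    exact ((Fmono _).lt_iff_lt.1 hy).le
  · intro p i hi
    rw [Filter.tendsto_atTop]
    intro b
    have hT : Tendsto (fun y => μ.real (S (update p i (s i * y)) b)) atBot (𝓝 (μ.real (∅ : Set (Euc d)))) := by
      apply conv atBot (fun y => update p i (s i * y)) (fun _ => b) _ MeasurableSet.empty
      have : ∀ᵐ x ∂μ, t i x ≠ 0 := by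
        rw [ae_iff]; simpa using hnul i hi
      filter_upwards [this] with x hx
      by_cases hxK : x ∈ K
      · have h1 : s i ≠ 0 := by
          obtain ⟨z, hz⟩ := hne
          have := hsO z hz i hi
          rintro h; simp [h] at this
        have h2 : 0 < s i * t i x := lt_of_le_of_ne (hs x hxK i hi) (mul_ne_zero h1 hx).symm
        have h3 : Tendsto (fun y : ℝ => y * (s i * t i x)) atBot atBot :=
          tendsto_id.atBot_mul_const h2
        filter_upwards [h3.eventually_lt_atBot (Y x - b - L p x + p i * t i x)] with y hy
        have : ¬ Y x ≤ b + L (update p i (s i * y)) x := by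
          simp only [hL, sum_upd n i hi] at hy ⊢
          linarith
        simp [hS, this]
      · exact Eventually.of_forall fun y => by simp [hS, hxK]
    rw [measureReal_empty] at hT
    filter_upwards [hT.eventually (gt_mem_nhds hα)] with y hy
    rw [← ωz' (update p i (s i * y))] at hy
    exact ((Fmono _).lt_iff_lt.1 hy).le


def XX (d j : ℕ) : Euc d →ᵃ[ℝ] ℝ :=
  if h : j < d then (EuclideanSpace.proj (𝕜 := ℝ) (⟨j, h⟩ : Fin d)).toLinearMap.toAffineMap else 0

def ee (d j : ℕ) : Euc d := if h : j < d then EuclideanSpace.single (⟨j, h⟩ : Fin d) 1 else 0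

lemma XX_apply {d j : ℕ} (h : j < d) (x : Euc d) : XX d j x = x ⟨j, h⟩ := by
  simp [XX, h]

lemma XX_ee {d j k : ℕ} (hj : j < d) (hk : k < d) :
    (XX d j).linear (ee d k) = if j = k then 1 else 0 := by
  simp [XX, ee, hj, hk, PiLp.single_apply]

def Cell {d : ℕ} (n : ℕ) (t : ℕ → (ℕ → Bool) → Euc d →ᵃ[ℝ] ℝ) (σ : ℕ → Bool) : Set (Euc d) :=
  {x | ∀ j < n, 0 ≤ sg (σ j) * t j σ x}

def OCell {d : ℕ} (n : ℕ) (t : ℕ → (ℕ → Bool) → Euc d →ᵃ[ℝ] ℝ) (σ : ℕ → Bool) : Set (Euc d) :=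
  {x | ∀ j < n, 0 < sg (σ j) * t j σ x}

lemma mem_Cell {d : ℕ} {n : ℕ} {t : ℕ → (ℕ → Bool) → Euc d →ᵃ[ℝ] ℝ} {σ : ℕ → Bool} {x : Euc d} :
    x ∈ Cell n t σ ↔ ∀ j < n, 0 ≤ sg (σ j) * t j σ x := Iff.rfl

lemma mem_OCell {d : ℕ} {n : ℕ} {t : ℕ → (ℕ → Bool) → Euc d →ᵃ[ℝ] ℝ} {σ : ℕ → Bool} {x : Euc d} :
    x ∈ OCell n t σ ↔ ∀ j < n, 0 < sg (σ j) * t j σ x := Iff.rfl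

lemma Cell_closed {d : ℕ} (n : ℕ) (t : ℕ → (ℕ → Bool) → Euc d →ᵃ[ℝ] ℝ) (σ : ℕ → Bool) :
    IsClosed (Cell n t σ) := by
  have : Cell n t σ = ⋂ j ∈ Finset.range n, {x | 0 ≤ sg (σ j) * t j σ x} := by
    ext x; simp [mem_Cell]
  rw [this]
  exact isClosed_biInter fun j _ => isClosed_le continuous_const (continuous_const.mul (aff_cont _))

lemma OCell_open {d : ℕ} (n : ℕ) (t : ℕ → (ℕ → Bool) → Euc d →ᵃ[ℝ] ℝ) (σ : ℕ → Bool) :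
    IsOpen (OCell n t σ) := by
  have : OCell n t σ = ⋂ j ∈ Finset.range n, {x | 0 < sg (σ j) * t j σ x} := by
    ext x; simp [mem_OCell]
  rw [this]
  exact isOpen_biInter_finset fun j _ =>
    isOpen_lt continuous_const (continuous_const.mul (aff_cont _))

lemma sg_ne (b : Bool) : sg b ≠ 0 := by cases b <;> simp

structure Stage (d n : ℕ) (μ : Measure (Euc d)) (A : ℕ → (ℕ → Bool) → ℝ)
    (c : ℕ → ℝ) (t : ℕ → (ℕ → Bool) → Euc d →ᵃ[ℝ] ℝ) (w : ℕ → ℕ → (ℕ → Bool) → ℝ) : Prop where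
  eq : ∀ j < n, ∀ σ x, XX d j x = c j + t j σ x + ∑ i ∈ Finset.range j, w j i σ * t i σ x
  tdep : ∀ j < n, ∀ σ τ, (∀ i < j, σ i = τ i) → t j σ = t j τ
  wdep : ∀ j < n, ∀ i σ τ, (∀ k < i, σ k = τ k) → w j i σ = w j i τ
  tlin : ∀ j < n, ∀ σ, ∀ k < d, j ≤ k → (t j σ).linear (ee d k) = if j = k then 1 else 0
  mass : ∀ σ, μ.real (Cell n t σ) = A n σ

lemma OCell_ne {d n : ℕ} {μ : Measure (Euc d)} (hμ : μ ≪ volume)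
    (t : ℕ → (ℕ → Bool) → Euc d →ᵃ[ℝ] ℝ) (σ : ℕ → Bool)
    (hnul : ∀ i < n, μ {x | t i σ x = 0} = 0) (hpos : 0 < μ.real (Cell n t σ)) :
    (OCell n t σ).Nonempty := by
  by_contra hcon
  rw [Set.not_nonempty_iff_eq_empty] at hcon
  have hsub : Cell n t σ ⊆ ⋃ i ∈ Finset.range n, {x | t i σ x = 0} := by
    intro x hx
    by_contra hx2
    have : x ∈ OCell n t σ := by
      intro j hj
      refine lt_of_le_of_ne (hx j hj) (mul_ne_zero (sg_ne _) ?_).symm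
      intro h0
      apply hx2
      simp only [mem_iUnion]
      exact ⟨j, by simpa using hj, h0⟩
    rw [hcon] at this
    exact this
  have h0 : μ (⋃ i ∈ Finset.range n, {x | t i σ x = 0}) = 0 := by
    refine measure_iUnion_null fun i => measure_iUnion_null fun hi => ?_
    exact hnul i (by simpa using hi)
  have := measure_mono_null hsub h0
  rw [measureReal_def, this] at hpos
  simp at hpos

lemma stage_succ {d n : ℕ} (hn : n < d) {μ : Measure (Euc d)} [IsFiniteMeasure μ]
    [μ.IsOpenPosMeasure] (hμ : μ ≪ volume) (A : ℕ → (ℕ → Bool) → ℝ)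
    (Apos : ∀ m σ, 0 < A m σ) (Adep : ∀ m σ τ, (∀ i < m, σ i = τ i) → A m σ = A m τ)
    (Asplit : ∀ m < d, ∀ σ, A m σ = A (m + 1) (update σ m true) + A (m + 1) (update σ m false))
    (c : ℕ → ℝ) (t : ℕ → (ℕ → Bool) → Euc d →ᵃ[ℝ] ℝ) (w : ℕ → ℕ → (ℕ → Bool) → ℝ)
    (h : Stage d n μ A c t w) : ∃ c t w, Stage d (n + 1) μ A c t w := by
  have hnul : ∀ σ, ∀ i < n, μ {x | t i σ x = 0} = 0 := by
    intro σ i hi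
    exact null_level hμ (t i σ) (ee d i) (by rw [h.tlin i hi σ i (by omega) le_rfl]; simp) 0
  have hlu : ∀ σ, ∀ i < n, (t i σ).linear (ee d n) = 0 := by
    intro σ i hi
    rw [h.tlin i hi σ n hn hi.le, if_neg (by omega)]
  have key : ∀ σ, _ := fun σ => leaf hμ n (fun i => t i σ) (XX d n) (ee d n)
    (by rw [XX_ee hn hn]; simp) (hlu σ) (hnul σ) (Cell n t σ) (OCell n t σ)
    (Cell_closed n t σ).measurableSet (OCell_open n t σ) (fun x hx j hj => (hx j hj).le)
    (OCell_ne hμ t σ (hnul σ) (by rw [h.mass]; exact Apos _ _))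
    (fun i => sg (σ i)) (fun x hx => hx) (fun x hx => hx)
    (by
      intro x hx r j hj
      rw [aff_add, hlu σ j hj]
      simpa using hx j hj)
    (A (n + 1) (update σ n false)) (Apos _ _)
    (by rw [h.mass, Asplit n hn]; have := Apos (n + 1) (update σ n true); linarith)
  choose ω ωc ωz ωa ωt ωb using key
  let tr : (ℕ → Bool) → ℕ → Bool := fun σ i => if i < n then σ i else true
  have tr_eq : ∀ σ, ∀ i < n, tr σ i = σ i := fun σ i hi => by simp [tr, hi]
  have ht_tr : ∀ σ, ∀ i < n, t i (tr σ) = t i σ := fun σ i hi =>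
    h.tdep i hi _ _ (fun k hk => tr_eq σ k (by omega))
  have hG : Good n (fun σ => ω (tr σ)) := by
    refine ⟨?_, fun σ => ωc _, ?_, ?_, ?_⟩
    · intro σ τ hst
      have : tr σ = tr τ := by
        funext i
        by_cases hi : i < n
        · simp [tr, hi, hst i hi]
        · simp [tr, hi]
      simp only [this]
    · intro σ p i hi
      have := ωa (tr σ) p i hi
      rwa [tr_eq σ i hi] at this
    · intro σ p i hi
      have := ωt (tr σ) p i hi
      rwa [tr_eq σ i hi] at this
    · intro σ p i hi
      have := ωb (tr σ) p i hi
      rwa [tr_eq σ i hi] at this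
  obtain ⟨c0, w0, hw1, hw2, hw3⟩ := tree n _ hG
  let tn : (ℕ → Bool) → Euc d →ᵃ[ℝ] ℝ := fun σ =>
    XX d n - AffineMap.const ℝ (Euc d) c0 - ∑ i ∈ Finset.range n, w0 i σ • t i σ
  have tn_app : ∀ σ x, tn σ x = XX d n x - c0 - ∑ i ∈ Finset.range n, w0 i σ * t i σ x := by
    intro σ x
    have h1 : ∀ m, (∑ i ∈ Finset.range m, w0 i σ • t i σ) x
        = ∑ i ∈ Finset.range m, w0 i σ * t i σ x := by
      intro m
      induction m with
      | zero => simp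
      | succ m ih =>
        rw [Finset.sum_range_succ, Finset.sum_range_succ, ← ih]
        simp
    simp [tn, h1]
  have tn_lin : ∀ σ, ∀ k < d, n ≤ k → (tn σ).linear (ee d k) = if n = k then 1 else 0 := by
    intro σ k hk hnk
    have h1 : ∀ m, m ≤ n → (∑ i ∈ Finset.range m, w0 i σ • t i σ).linear (ee d k) = 0 := by
      intro m
      induction m with
      | zero => intro _; simp
      | succ m ih =>
        intro hm
        rw [Finset.sum_range_succ]
        have := h.tlin m (by omega) σ k hk (by omega)
        rw [if_neg (by omega)] at this
        simp [ih (by omega), this]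
    simp [tn, h1 n le_rfl, XX_ee hn hk]
  have tn_dep : ∀ σ τ, (∀ i < n, σ i = τ i) → tn σ = tn τ := by
    intro σ τ hst
    simp only [tn]
    congr 1
    apply Finset.sum_congr rfl
    intro i hi
    have hi : i < n := by simpa using hi
    rw [hw1 i σ τ (fun k hk => hst k (by omega)), h.tdep i hi σ τ (fun k hk => hst k (by omega))]
  let t' := update t n tn
  have t'lt : ∀ j < n, t' j = t j := fun j hj => update_of_ne (by omega) _ _
  have t'n : t' n = tn := update_self _ _ _
  have lowmass : ∀ σ, μ.real (Cell n t σ ∩ {x | tn σ x ≤ 0}) = A (n + 1) (update σ n false) := by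
    intro σ
    have h1 := ωz (tr σ) (fun i => w0 i σ)
    have h2 := hw3 σ
    rw [h2] at h1
    have e1 : A (n + 1) (update (tr σ) n false) = A (n + 1) (update σ n false) := by
      apply Adep
      intro i hi
      by_cases hin : i = n
      · subst hin; simp
      · simp [hin, tr_eq σ i (by omega)]
    rw [← e1, ← h1]
    congr 1
    ext x
    simp only [mem_inter_iff, mem_Cell, mem_ofPred_eq, tn_app]
    have e2 : ∑ i ∈ Finset.range n, w0 i σ * t i (tr σ) x
        = ∑ i ∈ Finset.range n, w0 i σ * t i σ x := by
      apply Finset.sum_congr rfl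
      intro i hi
      rw [ht_tr σ i (by simpa using hi)]
    rw [e2]
    apply and_congr
    · apply forall₂_congr
      intro j hj
      rw [ht_tr σ j hj, tr_eq σ j hj]
    · constructor <;> intro h <;> linarith
  refine ⟨update c n c0, t', update w n w0, ?_, ?_, ?_, ?_, ?_⟩
  · intro j hj σ x
    by_cases hjn : j = n
    · subst hjn
      have e2 : ∑ i ∈ Finset.range j, w0 i σ * t' i σ x
        = ∑ i ∈ Finset.range j, w0 i σ * t i σ x := by
        apply Finset.sum_congr rfl
        intro i hi
        rw [t'lt i (by simpa using hi)]
      simp only [update_self, t'n, tn_app, e2]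
      ring
    · have hj' : j < n := by omega
      have e2 : ∑ i ∈ Finset.range j, w j i σ * t' i σ x
        = ∑ i ∈ Finset.range j, w j i σ * t i σ x := by
        apply Finset.sum_congr rfl
        intro i hi
        rw [t'lt i (by have : i < j := by simpa using hi
                       omega)]
      simp only [update_of_ne hjn, t'lt j hj', e2]
      exact h.eq j hj' σ x
  · intro j hj σ τ hst
    by_cases hjn : j = n
    · subst hjn
      rw [t'n]; exact tn_dep σ τ hst
    · have hj' : j < n := by omega
      rw [t'lt j hj']
      exact h.tdep j hj' σ τ hst
  · intro j hj i σ τ hst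
    by_cases hjn : j = n
    · subst hjn
      simp only [update_self]
      exact hw1 i σ τ hst
    · have hj' : j < n := by omega
      simp only [update_of_ne hjn]
      exact h.wdep j hj' i σ τ hst
  · intro j hj σ k hk hjk
    by_cases hjn : j = n
    · subst hjn
      rw [t'n]; exact tn_lin σ k hk hjk
    · have hj' : j < n := by omega
      rw [t'lt j hj']
      exact h.tlin j hj' σ k hk hjk
  · intro σ
    have hC : ∀ x, x ∈ Cell (n + 1) t' σ ↔ x ∈ Cell n t σ ∧ 0 ≤ sg (σ n) * tn σ x := by
      intro x
      simp only [mem_Cell]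
      constructor
      · intro hx
        refine ⟨fun j hj => ?_, ?_⟩
        · have := hx j (by omega)
          rwa [t'lt j hj] at this
        · have := hx n (by omega)
          rwa [t'n] at this
      · rintro ⟨h1, h2⟩ j hj
        by_cases hjn : j = n
        · subst hjn; rwa [t'n]
        · rw [t'lt j (by omega)]; exact h1 j (by omega)
    have hlow := lowmass σ
    cases hb : σ n with
    | false =>
      have e : Cell (n + 1) t' σ = Cell n t σ ∩ {x | tn σ x ≤ 0} := by
        ext x
        rw [hC, hb]
        simp
      rw [e, hlow, show update σ n false = σ by rw [← hb]; exact update_eq_self _ _]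
    | true =>
      have e : Cell (n + 1) t' σ = Cell n t σ \ (Cell n t σ ∩ {x | tn σ x < 0}) := by
        ext x
        rw [hC, hb]
        simp
      have hm1 : MeasurableSet (Cell n t σ) := (Cell_closed n t σ).measurableSet
      have hm2 : MeasurableSet {x | tn σ x < 0} :=
        (isOpen_lt (aff_cont _) continuous_const).measurableSet
      have e2 : μ.real (Cell n t σ ∩ {x | tn σ x < 0}) = μ.real (Cell n t σ ∩ {x | tn σ x ≤ 0}) := by
        apply measureReal_congr
        have : ∀ᵐ x ∂μ, tn σ x ≠ 0 := by
          rw [ae_iff]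
          simpa using null_level hμ (tn σ) (ee d n) (by rw [tn_lin σ n hn le_rfl]; simp) 0
        refine (ae_eq_refl _).inter ?_
        rw [Filter.eventuallyEq_set]
        filter_upwards [this] with x hx
        exact ⟨fun h => le_of_lt (show tn σ x < 0 from h), fun h => lt_of_le_of_ne (show tn σ x ≤ 0 from h) hx⟩
      rw [e, measureReal_sdiff inter_subset_left (hm1.inter hm2), e2, hlow, h.mass, Asplit n hn,
        show update σ n true = σ by rw [← hb]; exact update_eq_self _ _]
      ring

lemma stage_exists {d : ℕ} {μ : Measure (Euc d)} [IsProbabilityMeasure μ]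
    [μ.IsOpenPosMeasure] (hμ : μ ≪ volume) (A : ℕ → (ℕ → Bool) → ℝ)
    (Apos : ∀ m σ, 0 < A m σ) (Adep : ∀ m σ τ, (∀ i < m, σ i = τ i) → A m σ = A m τ)
    (Asplit : ∀ m < d, ∀ σ, A m σ = A (m + 1) (update σ m true) + A (m + 1) (update σ m false))
    (A0 : ∀ σ, A 0 σ = 1) (n : ℕ) (hn : n ≤ d) : ∃ c t w, Stage d n μ A c t w := by
  induction n with
  | zero =>
    refine ⟨0, 0, 0, by simp, by simp, by simp, by simp, ?_⟩
    intro σ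
    have : Cell 0 (0 : ℕ → (ℕ → Bool) → Euc d →ᵃ[ℝ] ℝ) σ = univ := by
      ext x; simp [mem_Cell]
    rw [this, A0]
    simp
  | succ n ih =>
    obtain ⟨c, t, w, h⟩ := ih (by omega)
    exact stage_succ (by omega) hμ A Apos Adep Asplit c t w h

lemma greedy (n : ℕ) (Q : ℕ → (ℕ → Bool) → ℝ)
    (hQ : ∀ j < n, ∀ σ τ, (∀ i < j, σ i = τ i) → Q j σ = Q j τ) :
    ∃ σ : ℕ → Bool, ∀ j < n, 0 ≤ sg (σ j) * Q j σ := by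
  induction n with
  | zero => exact ⟨fun _ => true, by simp⟩
  | succ n ih =>
    obtain ⟨σ, hσ⟩ := ih (fun j hj => hQ j (by omega))
    have hu : ∀ b, ∀ i < n, update σ n b i = σ i := fun b i hi => update_of_ne (by omega) _ _
    have hb : ∃ b, 0 ≤ sg b * Q n σ := by
      rcases le_total 0 (Q n σ) with h | h
      · exact ⟨true, by simpa using h⟩
      · exact ⟨false, by simpa using h⟩
    obtain ⟨b, hb⟩ := hb
    refine ⟨update σ n b, fun j hj => ?_⟩
    rw [hQ j hj (update σ n b) σ (fun i hi => hu b i (by omega))]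
    by_cases hjn : j = n
    · subst hjn
      simpa using hb
    · rw [hu b j (by omega)]
      exact hσ j (by omega)

lemma pos_interior {d : ℕ} (f : Euc d → ℝ) (u : Euc d) (hf : ∀ x (r : ℝ), f (x + r • u) = f x + r)
    (S : Set (Euc d)) (hS : ∀ x ∈ S, 0 ≤ f x) (x : Euc d) (hx : x ∈ interior S) : 0 < f x := by
  have hc : Continuous (fun r : ℝ => x + r • u) := by fun_prop
  have h1 : ∀ᶠ r in 𝓝 (0 : ℝ), x + r • u ∈ interior S := by
    apply hc.continuousAt.eventually
    simpa using isOpen_interior.mem_nhds hx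
  have h2 : ∀ᶠ r in 𝓝[<] (0 : ℝ), x + r • u ∈ interior S := h1.filter_mono nhdsWithin_le_nhds
  obtain ⟨r, hr, hr0⟩ := (h2.and self_mem_nhdsWithin).exists
  have := hS _ (interior_subset hr)
  rw [hf] at this
  have hr0 : r < 0 := hr0
  linarith

def wt {d : ℕ} (α : (Fin d → Bool) → ℝ) (n : ℕ) (σ : ℕ → Bool) : ℝ :=
  ∑ τ : Fin d → Bool, if (∀ i : Fin d, (i : ℕ) < n → τ i = σ i) then α τ else 0

lemma wt_pos {d : ℕ} (α : (Fin d → Bool) → ℝ) (hα : ∀ τ, 0 < α τ) (n : ℕ) (σ : ℕ → Bool) :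
    0 < wt α n σ := by
  unfold wt
  apply Finset.sum_pos'
  · intro τ _
    split_ifs
    · exact (hα τ).le
    · exact le_rfl
  · refine ⟨fun i => σ i, Finset.mem_univ _, ?_⟩
    simp [hα]

lemma wt_dep {d : ℕ} (α : (Fin d → Bool) → ℝ) (n : ℕ) (σ τ : ℕ → Bool)
    (h : ∀ i < n, σ i = τ i) : wt α n σ = wt α n τ := by
  unfold wt
  apply Finset.sum_congr rfl
  intro ρ _
  congr 1
  apply propext
  apply forall₂_congr
  intro i hi
  rw [h i hi]

lemma wt_split {d : ℕ} (α : (Fin d → Bool) → ℝ) (m : ℕ) (hm : m < d) (σ : ℕ → Bool) :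
    wt α m σ = wt α (m + 1) (update σ m true) + wt α (m + 1) (update σ m false) := by
  unfold wt
  rw [← Finset.sum_add_distrib]
  apply Finset.sum_congr rfl
  intro ρ _
  have key : ∀ b, (∀ i : Fin d, (i : ℕ) < m + 1 → ρ i = update σ m b i) ↔
      ((∀ i : Fin d, (i : ℕ) < m → ρ i = σ i) ∧ ρ ⟨m, hm⟩ = b) := by
    intro b
    constructor
    · intro h
      refine ⟨fun i hi => ?_, ?_⟩
      · have := h i (by omega)
        rwa [update_of_ne (by omega)] at this
      · have := h ⟨m, hm⟩ (by simp)
        simpa using this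
    · rintro ⟨h1, h2⟩ i hi
      by_cases him : (i : ℕ) = m
      · have : i = ⟨m, hm⟩ := Fin.ext him
        subst this
        simpa using h2
      · rw [update_of_ne him]
        exact h1 i (by omega)
  simp only [key]
  by_cases h1 : ∀ i : Fin d, (i : ℕ) < m → ρ i = σ i
  · cases h2 : ρ ⟨m, hm⟩ <;> simp [h1]
  · simp [h1]

lemma wt_full {d : ℕ} (α : (Fin d → Bool) → ℝ) (σ : ℕ → Bool) :
    wt α d σ = α (fun i => σ i) := by
  unfold wt
  rw [Finset.sum_eq_single (fun i : Fin d => σ i)]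
  · simp
  · intro τ _ hτ
    rw [if_neg]
    intro h
    apply hτ
    funext i
    exact h i i.2
  · simp

lemma Cell_convex {d : ℕ} (n : ℕ) (t : ℕ → (ℕ → Bool) → Euc d →ᵃ[ℝ] ℝ) (σ : ℕ → Bool) :
    Convex ℝ (Cell n t σ) := by
  have : Cell n t σ = ⋂ j ∈ Finset.range n, (sg (σ j) • t j σ) ⁻¹' Ici (0 : ℝ) := by
    ext x; simp [mem_Cell]
  rw [this]
  exact convex_iInter₂ fun j _ => (convex_Ici (0 : ℝ)).affine_preimage _

lemma inner_expand {d : ℕ} {μ : Measure (Euc d)} {A : ℕ → (ℕ → Bool) → ℝ}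
    {c : ℕ → ℝ} {t : ℕ → (ℕ → Bool) → Euc d →ᵃ[ℝ] ℝ} {w : ℕ → ℕ → (ℕ → Bool) → ℝ}
    (h : Stage d d μ A c t w) (v : ℕ → ℝ) (σ : ℕ → Bool) (x : Euc d) :
    ∑ k ∈ Finset.range d, v k * XX d k x = ∑ k ∈ Finset.range d, v k * c k +
      ∑ j ∈ Finset.range d, (v j + ∑ k ∈ Finset.range d, if j < k then w k j σ * v k else 0)
        * t j σ x := by
  have h1 : ∀ k ∈ Finset.range d, v k * XX d k x = v k * c k + (v k * t k σ x +
      ∑ j ∈ Finset.range d, (if j < k then w k j σ * v k else 0) * t j σ x) := by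
    intro k hk
    have hk : k < d := by simpa using hk
    rw [h.eq k hk σ x]
    have : ∑ i ∈ Finset.range k, w k i σ * t i σ x
        = ∑ i ∈ Finset.range d, if i < k then w k i σ * t i σ x else 0 := by
      rw [← Finset.sum_filter]
      apply Finset.sum_congr _ (fun _ _ => rfl)
      ext i
      simp only [Finset.mem_range, Finset.mem_filter]
      omega
    rw [this, mul_add, mul_add, Finset.mul_sum, add_assoc]
    congr 2
    apply Finset.sum_congr rfl
    intro i _
    split_ifs <;> ring
  rw [Finset.sum_congr rfl h1, Finset.sum_add_distrib, Finset.sum_add_distrib, Finset.sum_comm,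
    ← Finset.sum_add_distrib]
  congr 1
  apply Finset.sum_congr rfl
  intro j _
  rw [add_mul, Finset.sum_mul]

lemma exists_cell {d : ℕ} {μ : Measure (Euc d)} {A : ℕ → (ℕ → Bool) → ℝ}
    {c : ℕ → ℝ} {t : ℕ → (ℕ → Bool) → Euc d →ᵃ[ℝ] ℝ} {w : ℕ → ℕ → (ℕ → Bool) → ℝ}
    (h : Stage d d μ A c t w) : ∃ c0 : Euc d, ∀ v : Euc d,
      ∃ σ, ∀ x ∈ Cell d t σ, inner ℝ v c0 ≤ inner ℝ v x := by
  refine ⟨WithLp.toLp 2 (fun i => c i), fun v => ?_⟩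
  set v' : ℕ → ℝ := fun k => XX d k v with hv'
  obtain ⟨σ, hσ⟩ := greedy d
    (fun j σ => v' j + ∑ k ∈ Finset.range d, if j < k then w k j σ * v' k else 0) (by
      intro j hj σ τ hst
      congr 1
      apply Finset.sum_congr rfl
      intro k hk
      rw [h.wdep k (by simpa using hk) j σ τ hst])
  refine ⟨σ, fun x hx => ?_⟩
  have e1 : (inner ℝ v x : ℝ) = ∑ k ∈ Finset.range d, v' k * XX d k x := by
    rw [Finset.sum_range, PiLp.inner_apply]
    apply Finset.sum_congr rfl
    intro i _
    simp [hv', XX_apply i.2, mul_comm]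
  have e2 : (inner ℝ v (WithLp.toLp 2 (fun i : Fin d => c i) : Euc d) : ℝ)
      = ∑ k ∈ Finset.range d, v' k * c k := by
    rw [Finset.sum_range, PiLp.inner_apply]
    apply Finset.sum_congr rfl
    intro i _
    simp [hv', XX_apply i.2, mul_comm]
  rw [e1, e2, inner_expand h v' σ x]
  have : 0 ≤ ∑ j ∈ Finset.range d, (v' j + ∑ k ∈ Finset.range d,
      if j < k then w k j σ * v' k else 0) * t j σ x := by
    apply Finset.sum_nonneg
    intro j hj
    have hj : j < d := by simpa using hj
    have h1 := hσ j hj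
    have h2 := hx j hj
    cases hb : σ j with
    | true =>
      simp only [hb, sg_true, one_mul] at h1 h2
      exact mul_nonneg h1 h2
    | false =>
      simp only [hb, sg_false, neg_mul, one_mul] at h1 h2
      exact mul_nonneg_of_nonpos_of_nonpos (by linarith) (by linarith)
  linarith

lemma inner_add_dir {d : ℕ} (v : Euc d) (hv : v ≠ 0) (x : Euc d) (r : ℝ) :
    (inner ℝ v (x + r • ((‖v‖ ^ 2)⁻¹ • v)) : ℝ) = inner ℝ v x + r := by
  have : ‖v‖ ^ 2 ≠ 0 := by positivity
  rw [inner_add_right, inner_smul_right, inner_smul_right, real_inner_self_eq_norm_sq]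
  field_simp

end YY

theorem yao_yao_prescribed (d : ℕ) (hd : 1 ≤ d) (μ : Measure (Euc d))
    (hμ : NiceMeasure d μ) (a : Fin (2 ^ d) → ℝ) (ha : ∀ i, 0 < a i)
    (hsum : ∑ i, a i = 1) :
    ∃ C : Fin (2 ^ d) → Set (Euc d), IsConvexPartition C ∧
      (∀ i, μ (C i) = ENNReal.ofReal (a i)) ∧
      (∀ v : Euc d, ∀ c : ℝ, v ≠ 0 → 1 ≤ {i | Avoids (Hyperplane v c) (C i)}.ncard) := by
  obtain ⟨hprob, f, fc, fpos, hf⟩ := hμ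
  have hac : μ ≪ volume := by
    rw [hf]; exact withDensity_absolutelyContinuous _ _
  have hac' : volume ≪ μ := by
    rw [hf]
    apply withDensity_absolutelyContinuous'
    · exact fc.measurable.ennreal_ofReal.aemeasurable
    · exact Filter.Eventually.of_forall fun x => by simpa using fpos x
  have hop : μ.IsOpenPosMeasure := hac'.isOpenPosMeasure
  let e : Fin (2 ^ d) ≃ (Fin d → Bool) := Fintype.equivOfCardEq (by simp)
  let α : (Fin d → Bool) → ℝ := fun τ => a (e.symm τ)
  have hα : ∀ τ, 0 < α τ := fun τ => ha _
  have hαs : ∑ τ, α τ = 1 := by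
    rw [← hsum]; exact Equiv.sum_comp e.symm a
  obtain ⟨c, t, w, h⟩ := YY.stage_exists hac (YY.wt α) (YY.wt_pos α hα) (YY.wt_dep α)
    (YY.wt_split α) (fun σ => by simpa [YY.wt] using hαs) d le_rfl
  -- extension of finite sign sequences
  let ex : (Fin d → Bool) → ℕ → Bool := fun τ i => if hi : i < d then τ ⟨i, hi⟩ else true
  have ex_eq : ∀ τ (i : Fin d), ex τ i = τ i := fun τ i => by simp [ex]
  have cell_eq : ∀ σ : ℕ → Bool, YY.Cell d t (ex fun i => σ i) = YY.Cell d t σ := by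
    intro σ
    have hs : ∀ i < d, ex (fun i => σ i) i = σ i := fun i hi => by simp [ex, hi]
    ext x
    rw [YY.mem_Cell, YY.mem_Cell]
    apply forall₂_congr
    intro j hj
    rw [hs j hj, h.tdep j hj _ σ (fun i hi => hs i (by omega))]
  let C : Fin (2 ^ d) → Set (Euc d) := fun i => YY.Cell d t (ex (e i))
  have Cσ : ∀ σ : ℕ → Bool, C (e.symm fun i => σ i) = YY.Cell d t σ := by
    intro σ
    simp only [C, Equiv.apply_symm_apply]
    exact cell_eq σ
  refine ⟨C, ⟨fun i => YY.Cell_closed _ _ _, fun i => YY.Cell_convex _ _ _, ?_, ?_⟩, ?_, ?_⟩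
  · intro i j hij
    rw [Set.eq_empty_iff_forall_notMem]
    rintro x ⟨hxi, hxj⟩
    have hne : ∃ k, k < d ∧ ex (e i) k ≠ ex (e j) k := by
      by_contra hcon
      push Not at hcon
      apply hij
      apply e.injective
      funext k
      rw [← ex_eq (e i) k, ← ex_eq (e j) k]
      exact hcon k k.2
    classical
    obtain ⟨hk, hkne⟩ := Nat.find_spec hne
    set k := Nat.find hne
    have hlt : ∀ l < k, ex (e i) l = ex (e j) l := by
      intro l hl
      by_contra hcon
      exact Nat.find_min hne hl ⟨by omega, hcon⟩
    have ht := h.tdep k hk _ _ hlt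
    have hs : ∀ l, 0 < YY.sg (ex (e l) k) * t k (ex (e l)) x ∨ x ∉ interior (C l) := by
      intro l
      by_cases hx : x ∈ interior (C l)
      · left
        apply YY.pos_interior (fun x => YY.sg (ex (e l) k) * t k (ex (e l)) x)
          (YY.sg (ex (e l) k) • YY.ee d k) _ (C l) (fun y hy => hy k hk) x hx
        intro y r
        rw [smul_smul, YY.aff_add, h.tlin k hk _ k hk le_rfl]
        cases ex (e l) k <;> simp [add_comm]
      · right; exact hx
    have h1 := (hs i).resolve_right (fun h => h hxi)
    have h2 := (hs j).resolve_right (fun h => h hxj)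
    rw [← ht] at h2
    cases hbi : ex (e i) k <;> cases hbj : ex (e j) k
    · exact hkne (hbi.trans hbj.symm)
    · rw [hbi] at h1; rw [hbj] at h2
      simp at h1 h2
      linarith
    · rw [hbi] at h1; rw [hbj] at h2
      simp at h1 h2
      linarith
    · exact hkne (hbi.trans hbj.symm)
  · rw [Set.eq_univ_iff_forall]
    intro x
    obtain ⟨σ, hσ⟩ := YY.greedy d (fun j σ => t j σ x)
      (fun j hj σ τ hst => by simp only [h.tdep j hj σ τ hst])
    rw [Set.mem_iUnion]
    refine ⟨e.symm fun i => σ i, ?_⟩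
    rw [Cσ]
    exact hσ
  · intro i
    have h1 := h.mass (ex (e i))
    rw [YY.wt_full] at h1
    have h2 : (fun k : Fin d => ex (e i) k) = e i := funext fun k => ex_eq _ k
    rw [h2] at h1
    have h3 : α (e i) = a i := by simp [α]
    rw [h3] at h1
    rw [← h1, measureReal_def, ENNReal.ofReal_toReal (measure_ne_top _ _)]
  · intro v r hv
    obtain ⟨c0, hc0⟩ := YY.exists_cell h
    apply (Set.ncard_pos (Set.toFinite _)).2
    rcases le_total r (inner ℝ v c0) with hr | hr
    · obtain ⟨σ, hσ⟩ := hc0 v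
      refine ⟨e.symm fun i => σ i, ?_⟩
      change Avoids _ _
      rw [Cσ, Avoids, Set.eq_empty_iff_forall_notMem]
      rintro x ⟨hx1, hx2⟩
      have hx1 : inner ℝ v x = r := hx1
      have := YY.pos_interior (fun x => inner ℝ v x - r) ((‖v‖ ^ 2)⁻¹ • v)
        (fun y s => by rw [YY.inner_add_dir v hv]; ring) _
        (fun y hy => by have := hσ y hy; linarith) x hx2
      linarith
    · obtain ⟨σ, hσ⟩ := hc0 (-v)
      refine ⟨e.symm fun i => σ i, ?_⟩
      change Avoids _ _
      rw [Cσ, Avoids, Set.eq_empty_iff_forall_notMem]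
      rintro x ⟨hx1, hx2⟩
      have hx1 : inner ℝ v x = r := hx1
      have := YY.pos_interior (fun x => r + inner ℝ (-v) x) ((‖-v‖ ^ 2)⁻¹ • (-v))
        (fun y s => by rw [YY.inner_add_dir (-v) (neg_ne_zero.2 hv)]; ring) _
        (fun y hy => by
          have := hσ y hy
          rw [inner_neg_left] at this
          linarith) x hx2
      rw [inner_neg_left] at this
      linarith
end
end

section
/- For every d ≥ 1 and all positive integers k_1 and k_2, N_d(k_1 + k_2) ≤ N_d(k_1) + N_d(k_2). -/
open MeasureTheory Set Metric
open scoped ENNReal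
noncomputable section

/-- affine functional -/
def ell {d : ℕ} (w : Euc d × ℝ) (x : Euc d) : ℝ := inner ℝ w.1 x - w.2

lemma ell_cont {d : ℕ} (w : Euc d × ℝ) : Continuous (ell w) := by
  unfold ell; fun_prop

lemma ell_neg {d : ℕ} (w : Euc d × ℝ) (x : Euc d) : ell (-w) x = - ell w x := by
  simp [ell]; ring

lemma ell_convex {d : ℕ} (w : Euc d × ℝ) : Convex ℝ {x | ell w x ≤ 0} := by
  have : {x | ell w x ≤ 0} = {x | (innerSL ℝ w.1) x ≤ w.2} := by
    ext x; simp [ell]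
  rw [this]
  exact convex_halfSpace_le (innerSL ℝ w.1).toLinearMap.isLinear w.2

lemma ell_closed {d : ℕ} (w : Euc d × ℝ) : IsClosed {x | ell w x ≤ 0} :=
  isClosed_le (ell_cont w) continuous_const

lemma ell_interior {d : ℕ} {w : Euc d × ℝ} (hw : w ≠ 0) {x : Euc d}
    (hx : x ∈ interior {x | ell w x ≤ 0}) : ell w x < 0 := by
  by_cases hv : w.1 = 0
  · have h1 : ell w x ≤ 0 := (interior_subset hx : x ∈ {x | ell w x ≤ 0})
    have h2 : w.2 ≠ 0 := fun h => hw (Prod.ext hv h)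
    simp only [ell, hv, inner_zero_left, zero_sub] at h1 ⊢
    exact lt_of_le_of_ne h1 (by simpa using h2)
  · have hc : Filter.Tendsto (fun t : ℝ => x + t • w.1) (nhds 0) (nhds x) := by
      have : Continuous (fun t : ℝ => x + t • w.1) := by fun_prop
      simpa using this.tendsto 0
    have h1 : ∀ᶠ t in nhdsWithin (0:ℝ) (Ioi 0), ell w (x + t • w.1) ≤ 0 := by
      apply Filter.Eventually.filter_mono nhdsWithin_le_nhds
      filter_upwards [hc (isOpen_interior.mem_nhds hx)] with t ht
      exact (interior_subset ht : _ ∈ {x | ell w x ≤ 0})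
    obtain ⟨t, ht, ht0⟩ := (h1.and self_mem_nhdsWithin).exists
    have h3 : 0 < t * ‖w.1‖ ^ 2 := mul_pos ht0 (by positivity)
    simp only [ell, inner_add_right, inner_smul_right, real_inner_self_eq_norm_sq] at ht ⊢
    linarith

lemma ell_null {d : ℕ} {w : Euc d × ℝ} (hw : w ≠ 0) : volume {x | ell w x = 0} = 0 := by
  refine measure_mono_null ?_ ((ell_convex w).addHaar_frontier volume)
  intro x hx
  refine ⟨subset_closure (le_of_eq hx), fun h => ?_⟩
  exact (ell_interior hw h).ne hx

lemma sep {d n : ℕ} {C : Fin n → Set (Euc d)} (hC : IsConvexPartition C)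
    (hpos : ∀ i, volume (C i) ≠ 0) :
    ∃ w : Fin n → Fin n → sphere (0 : Euc d × ℝ) 1, ∀ i j, i ≠ j →
      (∀ x ∈ C i, ell (w i j) x ≤ 0) ∧ (∀ x ∈ C j, 0 ≤ ell (w i j) x) := by
  obtain ⟨hcl, hcv, hdis, -⟩ := hC
  have hne : ∀ i, (interior (C i)).Nonempty := by
    intro i
    by_contra h
    rw [not_nonempty_iff_eq_empty] at h
    apply hpos i
    have := (hcv i).addHaar_frontier volume
    rwa [(hcl i).frontier_eq, h, sdiff_empty] at this
  have hcc : ∀ i, closure (interior (C i)) = C i := fun i => by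
    rw [(hcv i).closure_interior_eq_closure_of_nonempty_interior (hne i), (hcl i).closure_eq]
  have key : ∀ i j, ∃ w : sphere (0 : Euc d × ℝ) 1, i ≠ j →
      (∀ x ∈ C i, ell w x ≤ 0) ∧ (∀ x ∈ C j, 0 ≤ ell w x) := by
    intro i j
    by_cases hij : i = j
    · exact ⟨⟨(0, 1), by simp⟩, fun h => absurd hij h⟩
    obtain ⟨f, u, h1, h2⟩ := geometric_hahn_banach_open_open (hcv i).interior isOpen_interior
      (hcv j).interior isOpen_interior (disjoint_iff_inter_eq_empty.2 (hdis i j hij))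
    let v := (InnerProductSpace.toDual ℝ (Euc d)).symm f
    have hf : ∀ x, f x = inner ℝ v x := fun x => by simp [v]
    have hw : ((v, u) : Euc d × ℝ) ≠ 0 := by
      intro h
      obtain ⟨a, ha⟩ := hne i
      have h3 := h1 a ha
      rw [hf] at h3
      have e1 : v = 0 := congrArg Prod.fst h
      have e2 : u = 0 := congrArg Prod.snd h
      rw [e1, e2] at h3
      simp at h3
    set c := ‖((v, u) : Euc d × ℝ)‖⁻¹ with hc
    have hc0 : 0 < c := inv_pos.2 (norm_pos_iff.2 hw)
    refine ⟨⟨c • (v, u), ?_⟩, fun _ => ?_⟩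
    · rw [mem_sphere_zero_iff_norm, norm_smul, hc, norm_inv, norm_norm,
        inv_mul_cancel₀ (norm_ne_zero_iff.2 hw)]
    have he : ∀ x, ell (c • (v, u)) x = c * (f x - u) := by
      intro x
      simp [ell, hf, inner_smul_left]; ring
    constructor
    · intro x hx
      rw [← hcc i] at hx
      refine closure_minimal (t := {x | ell (c • (v, u)) x ≤ 0}) ?_ (ell_closed _) hx
      intro y hy
      have := h1 y hy
      simp only [mem_ofPred_eq, he]
      exact mul_nonpos_of_nonneg_of_nonpos hc0.le (by linarith)
    · intro x hx
      rw [← hcc j] at hx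
      refine closure_minimal (t := {x | 0 ≤ ell (c • (v, u)) x}) ?_
        (isClosed_le continuous_const (ell_cont _)) hx
      intro y hy
      have := h2 y hy
      simp only [mem_ofPred_eq, he]
      exact mul_nonneg hc0.le (by linarith)
  choose w hw using key
  exact ⟨w, hw⟩

/-- scaled version of `HasEquipartition` -/
lemma scaled {d k n : ℕ} (hE : HasEquipartition d k n) {g : Euc d → ℝ} (hg : Continuous g)
    (hg0 : ∀ x, 0 < g x) (hfin : ∫⁻ x, ENNReal.ofReal (g x) ≠ ⊤) :
    ∃ C : Fin n → Set (Euc d), IsConvexPartition C ∧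
      (∀ i, ∫⁻ x in C i, ENNReal.ofReal (g x) = (∫⁻ x, ENNReal.ofReal (g x)) * (n : ℝ≥0∞)⁻¹) ∧
      ∀ v : Euc d, ∀ c : ℝ, v ≠ 0 → k ≤ {i | Avoids (Hyperplane v c) (C i)}.ncard := by
  set Z := ∫⁻ x, ENNReal.ofReal (g x) with hZ
  have hZ0 : Z ≠ 0 := by
    intro h
    rw [hZ, lintegral_eq_zero_iff (by fun_prop)] at h
    have : ∀ᵐ x : Euc d, False := by
      filter_upwards [h] with x hx
      exact (ENNReal.ofReal_pos.2 (hg0 x)).ne' hx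
    rw [Filter.eventually_false_iff_eq_bot, ae_eq_bot] at this
    exact NeZero.ne (volume : Measure (Euc d)) this
  have hZr : 0 < Z.toReal := ENNReal.toReal_pos hZ0 hfin
  have hdens : ∀ x, ENNReal.ofReal (Z.toReal⁻¹ * g x) = Z⁻¹ * ENNReal.ofReal (g x) := by
    intro x
    rw [ENNReal.ofReal_mul (by positivity), ENNReal.ofReal_inv_of_pos hZr, ENNReal.ofReal_toReal hfin]
  have hm : Measurable fun x => ENNReal.ofReal (g x) := by fun_prop
  obtain ⟨C, h1, h2, h3⟩ := hE (volume.withDensity (fun x => ENNReal.ofReal (Z.toReal⁻¹ * g x)))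
    ⟨⟨by
      rw [withDensity_apply _ MeasurableSet.univ, Measure.restrict_univ]
      simp only [hdens]
      rw [lintegral_const_mul _ hm]
      exact ENNReal.inv_mul_cancel hZ0 hfin⟩,
     fun x => Z.toReal⁻¹ * g x, by fun_prop, fun x => mul_pos (by positivity) (hg0 x), rfl⟩
  refine ⟨C, h1, fun i => ?_, h3⟩
  have := h2 i
  rw [withDensity_apply _ (h1.1 i).measurableSet] at this
  simp only [hdens] at this
  rw [lintegral_const_mul _ hm] at this
  rw [← this, ← mul_assoc, ENNReal.mul_inv_cancel hZ0 hfin, one_mul]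

open Filter Topology in
lemma limit_part {d k n : ℕ} (hn : 0 < n) (hE : HasEquipartition d k n) {f : Euc d → ℝ}
    (hf : Continuous f) (hf0 : ∀ x, 0 < f x) (hfin : ∫⁻ x, ENNReal.ofReal (f x) ≠ ⊤)
    (φ : ℕ → Euc d → ℝ) (hφ : ∀ m, Continuous (φ m)) (hφ0 : ∀ m x, 0 < φ m x)
    (hφ1 : ∀ m x, φ m x ≤ 1) {A : Set (Euc d)} (hA : MeasurableSet A)
    (hlim : ∀ x, Tendsto (fun m => φ m x) atTop (𝓝 (A.indicator 1 x))) :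
    ∃ C : Fin n → Set (Euc d), IsConvexPartition C ∧
      (∀ i, ∫⁻ x in C i ∩ A, ENNReal.ofReal (f x) =
        (∫⁻ x in A, ENNReal.ofReal (f x)) * (n : ℝ≥0∞)⁻¹) ∧
      ∀ v : Euc d, ∀ c : ℝ, v ≠ 0 → k ≤ {i | Avoids (Hyperplane v c) (C i)}.ncard := by
  have hle : ∀ m x, ENNReal.ofReal (f x * φ m x) ≤ ENNReal.ofReal (f x) := fun m x =>
    ENNReal.ofReal_le_ofReal (mul_le_of_le_one_right (hf0 x).le (hφ1 m x))
  have hZfin : ∀ m, ∫⁻ x, ENNReal.ofReal (f x * φ m x) ≠ ⊤ := fun m =>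
    ne_top_of_le_ne_top hfin (lintegral_mono (hle m))
  have hmeas : ∀ m, Measurable fun x => ENNReal.ofReal (f x * φ m x) := fun m => by
    have := hφ m
    fun_prop
  have hstep : ∀ m, ∃ C : Fin n → Set (Euc d), IsConvexPartition C ∧
      (∀ i, ∫⁻ x in C i, ENNReal.ofReal (f x * φ m x) =
        (∫⁻ x, ENNReal.ofReal (f x * φ m x)) * (n : ℝ≥0∞)⁻¹) ∧
      ∀ v : Euc d, ∀ c : ℝ, v ≠ 0 → k ≤ {i | Avoids (Hyperplane v c) (C i)}.ncard := fun m =>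
    scaled hE (hf.mul (hφ m)) (fun x => mul_pos (hf0 x) (hφ0 m x)) (hZfin m)
  choose C hCp hCm hCk using hstep
  have hCpos : ∀ m i, volume (C m i) ≠ 0 := by
    intro m i h
    have h1 := hCm m i
    rw [Measure.restrict_eq_zero.2 h, lintegral_zero_measure, eq_comm, mul_eq_zero] at h1
    rcases h1 with h1 | h1
    · rw [lintegral_eq_zero_iff (hmeas m)] at h1
      have : ∀ᵐ x : Euc d, False := by
        filter_upwards [h1] with x hx
        exact (ENNReal.ofReal_pos.2 (mul_pos (hf0 x) (hφ0 m x))).ne' hx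
      rw [Filter.eventually_false_iff_eq_bot, ae_eq_bot] at this
      exact NeZero.ne (volume : Measure (Euc d)) this
    · simp at h1
  have hsep := fun m => sep (hCp m) (hCpos m)
  choose w hw using hsep
  obtain ⟨a, s, hs, ha⟩ := CompactSpace.tendsto_subseq w
  have ha0 : ∀ i j, (a i j : Euc d × ℝ) ≠ 0 := fun i j => ne_zero_of_mem_unit_sphere _
  have hell : ∀ i j (x : Euc d), Tendsto (fun m => ell (w (s m) i j) x) atTop (𝓝 (ell (a i j) x)) := by
    intro i j x
    have h1 : Tendsto (fun m => w (s m) i j) atTop (𝓝 (a i j)) :=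
      (tendsto_pi_nhds.1 ((tendsto_pi_nhds.1 ha) i)) j
    have h2 : Continuous (fun z : sphere (0 : Euc d × ℝ) 1 => ell (z : Euc d × ℝ) x) := by
      unfold ell; fun_prop
    exact (h2.tendsto _).comp h1
  let L : Fin n → Set (Euc d) := fun i =>
    {x | ∀ j, i ≠ j → ell (a i j) x ≤ 0 ∧ 0 ≤ ell (a j i) x}
  have hLeq : ∀ i, L i = ⋂ j, ⋂ (_ : i ≠ j),
      ({x | ell (a i j) x ≤ 0} ∩ {x | ell (-(a j i : Euc d × ℝ)) x ≤ 0}) := by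
    intro i; ext x; simp [L, ell_neg]
  have hLcl : ∀ i, IsClosed (L i) := fun i => by
    rw [hLeq]
    exact isClosed_iInter fun j => isClosed_iInter fun _ => (ell_closed _).inter (ell_closed _)
  have hLcv : ∀ i, Convex ℝ (L i) := fun i => by
    rw [hLeq]
    exact convex_iInter fun j => convex_iInter fun _ => (ell_convex _).inter (ell_convex _)
  have hLint : ∀ i x, x ∈ interior (L i) → ∀ j, i ≠ j → ell (a i j) x < 0 ∧ 0 < ell (a j i) x := by
    intro i x hx j hij
    constructor
    · exact ell_interior (ha0 i j) (interior_mono (fun y hy => (hy j hij).1) hx)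
    · have := ell_interior (w := -(a j i : Euc d × ℝ)) (neg_ne_zero.2 (ha0 j i))
        (interior_mono (fun y hy => by
          have := (hy j hij).2
          simp only [mem_ofPred_eq, ell_neg]; linarith) hx)
      rw [ell_neg] at this; linarith
  -- interior points
  have hin : ∀ i x, x ∈ interior (L i) → ∀ᶠ m in atTop, x ∈ interior (C (s m) i) := by
    intro i x hx
    have h1 : ∀ᶠ m in atTop, ∀ j, i ≠ j → ell (w (s m) i j) x < 0 := by
      rw [eventually_all]
      intro j
      by_cases hij : i = j
      · exact Eventually.of_forall fun _ h => absurd hij h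
      · filter_upwards [(hell i j x).eventually_lt_const (hLint i x hx j hij).1] with m hm _
        exact hm
    filter_upwards [h1] with m hm
    have hop : IsOpen (⋂ j, ⋂ (_ : i ≠ j), {y : Euc d | ell (w (s m) i j : Euc d × ℝ) y < 0}) :=
      isOpen_iInter_of_finite fun j => isOpen_iInter_of_finite fun _ =>
        isOpen_lt (ell_cont (w (s m) i j : Euc d × ℝ)) continuous_const
    refine interior_maximal ?_ hop (by simpa using hm)
    intro y hy
    simp only [mem_iInter, mem_ofPred_eq] at hy
    have hu : y ∈ ⋃ j, C (s m) j := by rw [(hCp (s m)).2.2.2]; trivial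
    obtain ⟨j, hj⟩ := mem_iUnion.1 hu
    by_cases hij : i = j
    · rwa [hij]
    · exact absurd ((hw (s m) i j hij).2 y hj) (not_le.2 (hy j hij))
  have hfreq : ∀ i x, (∃ᶠ m in atTop, x ∈ C (s m) i) → x ∈ L i := by
    intro i x hx j hij
    constructor
    · exact le_of_tendsto_of_frequently (hell i j x)
        (hx.mono fun m hm => (hw (s m) i j hij).1 x hm)
    · exact ge_of_tendsto_of_frequently (hell j i x)
        (hx.mono fun m hm => (hw (s m) j i hij.symm).2 x hm)
  refine ⟨L, ⟨hLcl, hLcv, ?_, ?_⟩, ?_, ?_⟩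
  · intro i j hij
    rw [eq_empty_iff_forall_notMem]
    rintro x ⟨hxi, hxj⟩
    exact lt_asymm (hLint i x hxi j hij).1 (hLint j x hxj i hij.symm).2
  · rw [eq_univ_iff_forall]
    intro x
    have : ∃ᶠ m in atTop, ∃ i, x ∈ C (s m) i := by
      refine Eventually.frequently (Eventually.of_forall fun m => ?_)
      have hu : x ∈ ⋃ j, C (s m) j := by rw [(hCp (s m)).2.2.2]; trivial
      exact mem_iUnion.1 hu
    by_contra hx
    simp only [mem_iUnion, not_exists] at hx
    have h2 : ∀ᶠ m in atTop, ∀ i, x ∉ C (s m) i := by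
      rw [eventually_all]
      intro i
      have := mt (hfreq i x) (hx i)
      rwa [not_frequently] at this
    obtain ⟨m, ⟨i, hi⟩, hm⟩ := (this.and_eventually h2).exists
    exact hm i hi
  · intro i
    have hptw : ∀ x, Tendsto (fun m => ENNReal.ofReal (f x * φ (s m) x)) atTop
        (𝓝 (A.indicator (fun x => ENNReal.ofReal (f x)) x)) := by
      intro x
      have h1 := ENNReal.tendsto_ofReal
        (((hlim x).comp hs.tendsto_atTop).const_mul (f x))
      have h2 : A.indicator (fun x => ENNReal.ofReal (f x)) x =
          ENNReal.ofReal (f x * A.indicator 1 x) := by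
        by_cases hx : x ∈ A <;> simp [hx]
      rw [h2]
      exact h1
    have T1 : Tendsto (fun m => ∫⁻ x, ENNReal.ofReal (f x * φ (s m) x)) atTop
        (𝓝 (∫⁻ x in A, ENNReal.ofReal (f x))) := by
      rw [← lintegral_indicator hA]
      exact tendsto_lintegral_of_dominated_convergence _ (fun m => hmeas (s m))
        (fun m => ae_of_all _ (hle (s m))) hfin (ae_of_all _ hptw)
    have T2 : Tendsto (fun m => ∫⁻ x in C (s m) i, ENNReal.ofReal (f x * φ (s m) x)) atTop
        (𝓝 (∫⁻ x in L i ∩ A, ENNReal.ofReal (f x))) := by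
      rw [← lintegral_indicator ((hLcl i).measurableSet.inter hA)]
      simp_rw [fun m => (lintegral_indicator ((hCp (s m)).1 i).measurableSet
        (fun x => ENNReal.ofReal (f x * φ (s m) x)) (μ := volume)).symm]
      refine tendsto_lintegral_of_dominated_convergence (fun x => ENNReal.ofReal (f x))
        (fun m => (hmeas (s m)).indicator ((hCp (s m)).1 i).measurableSet)
        (fun m => ae_of_all _ fun x => (indicator_le_self' (fun _ _ => zero_le) x).trans
          (hle (s m) x)) hfin ?_
      have hfr := (hLcv i).addHaar_frontier volume
      filter_upwards [compl_mem_ae_iff.2 hfr] with x hx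
      rw [(hLcl i).frontier_eq] at hx
      by_cases hxL : x ∈ L i
      · have hxi : x ∈ interior (L i) := by
          by_contra h
          exact hx ⟨hxL, h⟩
        have : (L i ∩ A).indicator (fun x => ENNReal.ofReal (f x)) x =
            A.indicator (fun x => ENNReal.ofReal (f x)) x := by
          by_cases hxA : x ∈ A <;> simp [hxA, hxL]
        rw [this]
        refine (hptw x).congr' ?_
        filter_upwards [hin i x hxi] with m hm
        rw [indicator_of_mem (interior_subset hm)]
      · rw [indicator_of_notMem (fun h => hxL h.1)]
        refine tendsto_const_nhds.congr' ?_
        have := mt (hfreq i x) hxL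
        rw [not_frequently] at this
        filter_upwards [this] with m hm
        rw [indicator_of_notMem hm]
    simp_rw [hCm] at T2
    refine tendsto_nhds_unique T2 (ENNReal.Tendsto.mul_const T1 (Or.inr ?_))
    simp [hn.ne']
  · intro v c hv
    have h1 : ∀ᶠ m in atTop, ∀ i, ¬ Avoids (Hyperplane v c) (L i) →
        ¬ Avoids (Hyperplane v c) (C (s m) i) := by
      rw [eventually_all]
      intro i
      by_cases h : Avoids (Hyperplane v c) (L i)
      · exact Eventually.of_forall fun _ h' => absurd h h'
      · obtain ⟨x, hxH, hxi⟩ := nonempty_iff_ne_empty.2 h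
        filter_upwards [hin i x hxi] with m hm _
        exact nonempty_iff_ne_empty.1 ⟨x, hxH, hm⟩
    obtain ⟨m, hm⟩ := h1.exists
    refine (hCk (s m) v c hv).trans (ncard_le_ncard ?_ (toFinite _))
    intro i hi
    by_contra h
    exact hm i h hi

open Filter Topology in
lemma half_part {d k n : ℕ} (hn : 0 < n) (hE : HasEquipartition d k n) {f : Euc d → ℝ}
    (hf : Continuous f) (hf0 : ∀ x, 0 < f x) (hfin : ∫⁻ x, ENNReal.ofReal (f x) ≠ ⊤)
    (w : Euc d × ℝ) :
    ∃ C : Fin n → Set (Euc d), IsConvexPartition C ∧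
      (∀ i, ∫⁻ x in C i ∩ {x | ell w x ≤ 0}, ENNReal.ofReal (f x) =
        (∫⁻ x in {x | ell w x ≤ 0}, ENNReal.ofReal (f x)) * (n : ℝ≥0∞)⁻¹) ∧
      ∀ v : Euc d, ∀ c : ℝ, v ≠ 0 → k ≤ {i | Avoids (Hyperplane v c) (C i)}.ncard := by
  have hec := ell_cont w
  refine limit_part hn hE hf hf0 hfin
    (fun m x => max (1 / ((m : ℝ) + 1)) (min 1 (1 - m * ell w x))) (fun m => by fun_prop)
    (fun m x => lt_max_of_lt_left (by positivity))
    (fun m x => max_le ?_ (min_le_left _ _)) (ell_closed w).measurableSet ?_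
  · rw [div_le_one (by positivity)]
    have : (0 : ℝ) ≤ m := by positivity
    linarith
  · intro x
    by_cases hx : ell w x ≤ 0
    · rw [indicator_of_mem (by exact hx)]
      refine tendsto_const_nhds.congr fun m => ?_
      have hm : (0 : ℝ) ≤ m := by positivity
      have : m * ell w x ≤ 0 := mul_nonpos_of_nonneg_of_nonpos hm hx
      rw [min_eq_left (by linarith), max_eq_right]
      · rfl
      · rw [div_le_one (by positivity)]
        linarith
    · rw [indicator_of_notMem (by exact hx)]
      push Not at hx
      refine (tendsto_one_div_add_atTop_nhds_zero_nat (𝕜 := ℝ)).congr' ?_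
      have : Tendsto (fun m : ℕ => (m : ℝ) * ell w x) atTop atTop :=
        tendsto_natCast_atTop_atTop.atTop_mul_const hx
      filter_upwards [this.eventually_ge_atTop 1] with m hm
      rw [max_eq_left]
      exact (min_le_right _ _).trans ((by linarith : (1 : ℝ) - m * ell w x ≤ 0).trans (by positivity))

open Filter Topology in
lemma exists_level {d : ℕ} {e : Euc d} (he : e ≠ 0) {μ : Measure (Euc d)} [IsProbabilityMeasure μ]
    (hac : μ ≪ volume) {r : ℝ} (hr0 : 0 < r) (hr1 : r < 1) :
    ∃ t, μ.real {x | ell (e, t) x ≤ 0} = r := by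
  have hm : Measurable fun x : Euc d => inner ℝ e x := by fun_prop
  have : IsProbabilityMeasure (μ.map fun x => inner ℝ e x) :=
    Measure.isProbabilityMeasure_map hm.aemeasurable
  set ν := μ.map fun x => inner ℝ e x with hν
  have hcont : Continuous (ProbabilityTheory.cdf ν) := by
    rw [continuous_iff_continuousAt]
    intro t
    rw [(ProbabilityTheory.cdf ν).mono.continuousAt_iff_leftLim_eq_rightLim,
      StieltjesFunction.rightLim_eq]
    have h1 := (ProbabilityTheory.cdf ν).measure_singleton t
    rw [ProbabilityTheory.measure_cdf, hν, Measure.map_apply hm (measurableSet_singleton t)] at h1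
    have h2 : μ ((fun x => inner ℝ e x) ⁻¹' {t}) = 0 := by
      apply hac
      have := ell_null (w := (e, t)) (fun h => he (congrArg Prod.fst h))
      convert this using 2
      ext x; simp [ell, sub_eq_zero]
    rw [h2, eq_comm, ENNReal.ofReal_eq_zero] at h1
    exact le_antisymm ((ProbabilityTheory.cdf ν).mono.leftLim_le le_rfl) (by linarith)
  obtain ⟨t, ht⟩ := mem_range_of_exists_le_of_exists_ge hcont (c := r)
    ((ProbabilityTheory.tendsto_cdf_atBot ν).eventually_le_const hr0).exists
    ((ProbabilityTheory.tendsto_cdf_atTop ν).eventually_const_le hr1).exists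
  refine ⟨t, ?_⟩
  rw [ProbabilityTheory.cdf_eq_real, measureReal_def, hν,
    Measure.map_apply hm measurableSet_Iic] at ht
  rw [← ht, measureReal_def]
  congr 2
  ext x; simp [ell]

lemma hasEquipartition_add {d k₁ k₂ n₁ n₂ : ℕ} (hd : 1 ≤ d) (hn₁ : 0 < n₁) (hn₂ : 0 < n₂)
    (h₁ : HasEquipartition d k₁ n₁) (h₂ : HasEquipartition d k₂ n₂) :
    HasEquipartition d (k₁ + k₂) (n₁ + n₂) := by
  rintro μ ⟨hμ, f, hf, hf0, hμf⟩
  have hμA : ∀ S, MeasurableSet S → ∫⁻ x in S, ENNReal.ofReal (f x) = μ S := fun S hS => by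
    rw [hμf, withDensity_apply _ hS]
  have hfin : ∫⁻ x, ENNReal.ofReal (f x) ≠ ⊤ := by
    have := hμA univ MeasurableSet.univ
    rw [Measure.restrict_univ, measure_univ] at this
    simp [this]
  have hac : μ ≪ volume := by rw [hμf]; exact withDensity_absolutelyContinuous _ _
  have he : (EuclideanSpace.single (⟨0, hd⟩ : Fin d) (1 : ℝ)) ≠ 0 := by simp
  set e := EuclideanSpace.single (⟨0, hd⟩ : Fin d) (1 : ℝ)
  have p1 : (0 : ℝ) < n₁ := by exact_mod_cast hn₁
  have p2 : (0 : ℝ) < n₂ := by exact_mod_cast hn₂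
  obtain ⟨t, ht⟩ := exists_level he hac (r := n₁ / (n₁ + n₂)) (by positivity)
    (by rw [div_lt_one (by positivity)]; linarith)
  set w : Euc d × ℝ := (e, t) with hw
  have hw0 : w ≠ 0 := fun h => he (congrArg Prod.fst h)
  set A := {x | ell w x ≤ 0} with hA
  set B := {x | ell (-w) x ≤ 0} with hB
  have hAm : MeasurableSet A := (ell_closed w).measurableSet
  have hBm : MeasurableSet B := (ell_closed (-w)).measurableSet
  have hBr : μ.real B = n₂ / (n₁ + n₂) := by
    have h1 : μ.real Aᶜ = 1 - μ.real A := probReal_compl_eq_one_sub hAm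
    have h2 : B =ᵐ[μ] (Aᶜ : Set (Euc d)) := by
      have := compl_mem_ae_iff.2 (hac (ell_null hw0))
      filter_upwards [this] with x hx
      have hx' : ell w x ≠ 0 := hx
      apply propext
      change ell (-w) x ≤ 0 ↔ ¬ (ell w x ≤ 0)
      rw [ell_neg, not_le]
      constructor
      · intro h; exact lt_of_le_of_ne (by linarith) hx'.symm
      · intro h; linarith
    rw [measureReal_congr h2, h1, ht]
    field_simp
    ring
  have hreal : ∀ {S : Set (Euc d)} {m : ℕ}, 0 < m → μ.real S = m / (n₁ + n₂) →
      μ S * (m : ℝ≥0∞)⁻¹ = ((n₁ + n₂ : ℕ) : ℝ≥0∞)⁻¹ := by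
    intro S m hm hS
    have hm' : (0 : ℝ) < m := by exact_mod_cast hm
    have hfi : μ S * (m : ℝ≥0∞)⁻¹ ≠ ⊤ :=
      ENNReal.mul_ne_top (measure_ne_top _ _) (by simp [hm.ne'])
    rw [← ENNReal.toReal_eq_toReal_iff' hfi (by simp; omega)]
    rw [ENNReal.toReal_mul, ← measureReal_def, hS]
    simp only [ENNReal.toReal_inv, ENNReal.toReal_natCast]
    push_cast
    field_simp
  obtain ⟨C, ⟨hC1, hC2, hC3, hC4⟩, hCm, hCk⟩ := half_part hn₁ h₁ hf hf0 hfin w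
  obtain ⟨D, ⟨hD1, hD2, hD3, hD4⟩, hDm, hDk⟩ := half_part hn₂ h₂ hf hf0 hfin (-w)
  rw [← hA] at hCm
  rw [← hB] at hDm
  have hAB : ∀ i j, interior (C i ∩ A) ∩ interior (D j ∩ B) = ∅ := by
    intro i j
    rw [eq_empty_iff_forall_notMem]
    rintro x ⟨hx1, hx2⟩
    have g1 := ell_interior hw0 (interior_mono inter_subset_right hx1)
    have g2 := ell_interior (neg_ne_zero.2 hw0) (interior_mono inter_subset_right hx2)
    rw [ell_neg] at g2
    linarith
  let P : Fin (n₁ + n₂) → Set (Euc d) := Fin.append (fun i => C i ∩ A) (fun j => D j ∩ B)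
  have hPl : ∀ i, P (Fin.castAdd n₂ i) = C i ∩ A := fun i => Fin.append_left _ _ i
  have hPr : ∀ j, P (Fin.natAdd n₁ j) = D j ∩ B := fun j => Fin.append_right _ _ j
  refine ⟨P, ⟨?_, ?_, ?_, ?_⟩, ?_, ?_⟩
  · intro i
    refine Fin.addCases (fun i => ?_) (fun j => ?_) i
    · rw [hPl]; exact (hC1 i).inter (ell_closed _)
    · rw [hPr]; exact (hD1 j).inter (ell_closed _)
  · intro i
    refine Fin.addCases (fun i => ?_) (fun j => ?_) i
    · rw [hPl]; exact (hC2 i).inter (ell_convex _)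
    · rw [hPr]; exact (hD2 j).inter (ell_convex _)
  · intro i j
    refine Fin.addCases (fun i => ?_) (fun i => ?_) i <;>
    refine Fin.addCases (fun j => ?_) (fun j => ?_) j <;> intro hij
    · rw [hPl, hPl]
      have := hC3 i j (fun h => hij (by rw [h]))
      exact subset_eq_empty (inter_subset_inter (interior_mono inter_subset_left)
        (interior_mono inter_subset_left)) this
    · rw [hPl, hPr]; exact hAB i j
    · rw [hPl, hPr, inter_comm]; exact hAB j i
    · rw [hPr, hPr]
      have := hD3 i j (fun h => hij (by rw [h]))
      exact subset_eq_empty (inter_subset_inter (interior_mono inter_subset_left)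
        (interior_mono inter_subset_left)) this
  · rw [eq_univ_iff_forall]
    intro x
    rcases le_total (ell w x) 0 with h | h
    · obtain ⟨i, hi⟩ := mem_iUnion.1 (hC4 ▸ mem_univ x : x ∈ ⋃ i, C i)
      exact mem_iUnion.2 ⟨Fin.castAdd n₂ i, by rw [hPl]; exact ⟨hi, h⟩⟩
    · obtain ⟨i, hi⟩ := mem_iUnion.1 (hD4 ▸ mem_univ x : x ∈ ⋃ i, D i)
      refine mem_iUnion.2 ⟨Fin.natAdd n₁ i, ?_⟩
      rw [hPr]
      refine ⟨hi, ?_⟩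
      change ell (-w) x ≤ 0
      rw [ell_neg]; linarith
  · intro i
    refine Fin.addCases (fun i => ?_) (fun j => ?_) i
    · rw [hPl, ← hμA _ ((hC1 i).measurableSet.inter hAm), hCm, hμA _ hAm]
      exact hreal hn₁ ht
    · rw [hPr, ← hμA _ ((hD1 j).measurableSet.inter hBm), hDm, hμA _ hBm]
      exact hreal hn₂ hBr
  · intro v c hv
    set H := Hyperplane v c
    have hmono : ∀ {S T : Set (Euc d)}, S ⊆ T → Avoids H T → Avoids H S := fun hST h =>
      subset_eq_empty (inter_subset_inter_right _ (interior_mono hST)) h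
    have hsub : Fin.castAdd n₂ '' {i | Avoids H (C i)} ∪ Fin.natAdd n₁ '' {j | Avoids H (D j)} ⊆
        {i | Avoids H (P i)} := by
      rintro _ (⟨i, hi, rfl⟩ | ⟨i, hi, rfl⟩)
      · rw [mem_ofPred_eq, hPl]; exact hmono inter_subset_left hi
      · rw [mem_ofPred_eq, hPr]; exact hmono inter_subset_left hi
    refine le_trans ?_ (ncard_le_ncard hsub (toFinite _))
    rw [ncard_union_eq ?_ (toFinite _) (toFinite _),
      ncard_image_of_injective _ (Fin.castAdd_injective n₁ n₂),
      ncard_image_of_injective _ (Fin.natAdd_injective n₂ n₁)]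
    · exact add_le_add (hCk v c hv) (hDk v c hv)
    · rw [Set.disjoint_left]
      rintro _ ⟨i, _, rfl⟩ ⟨j, _, hj⟩
      have := congrArg Fin.val hj
      simp at this
      omega

lemma hasEquipartition_mono {d k k' n : ℕ} (h : k ≤ k') (hE : HasEquipartition d k' n) :
    HasEquipartition d k n := by
  intro μ hμ
  obtain ⟨C, h1, h2, h3⟩ := hE μ hμ
  exact ⟨C, h1, h2, fun v c hv => h.trans (h3 v c hv)⟩

/-- Subadditivity: N_d(k₁ + k₂) ≤ N_d(k₁) + N_d(k₂). -/
theorem Nd_subadditive (d k₁ k₂ : ℕ) (hd : 1 ≤ d) (hk₁ : 1 ≤ k₁) (hk₂ : 1 ≤ k₂) :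
    Nd d (k₁ + k₂) ≤ Nd d k₁ + Nd d k₂ := by
  rcases Set.eq_empty_or_nonempty {n | 0 < n ∧ HasEquipartition d (k₁ + k₂) n} with h | ⟨n, hn, hE⟩
  · simp [Nd, h]
  · have m1 : Nd d k₁ ∈ {n | 0 < n ∧ HasEquipartition d k₁ n} :=
      Nat.sInf_mem ⟨n, hn, hasEquipartition_mono (by omega) hE⟩
    have m2 : Nd d k₂ ∈ {n | 0 < n ∧ HasEquipartition d k₂ n} :=
      Nat.sInf_mem ⟨n, hn, hasEquipartition_mono (by omega) hE⟩
    exact Nat.sInf_le ⟨Nat.add_pos_left m1.1 _, hasEquipartition_add hd m1.1 m2.1 m1.2 m2.2⟩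
end
end
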